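/- Let L be an s-dimensional affine subspace of ℝ^n parametrized by the affine map h : ℝ^s → ℝ^n determined by (1, h(x)) = x̃ P for some P ∈ M_{s+1,n+1}(ℝ). Then the following are equivalent: (i) condition (3.6) holds for P; (ii) L contains at least one not very well approximable point; (iii) L is extremal; (iv) every smooth map f : U → L, U ⊂ ℝ^d open, which is nondegenerate in L is extremal. -/

import Mathlib

open MeasureTheory

/-- `y ∈ W_v(1,n)`: infinitely many `q ∈ ℤ^n` with `|y·q + p| ≤ ‖q‖^{-v}` for some `p ∈ ℤ`. -/
def InW {n : ℕ} (y : Fin n → ℝ) (v : ℝ) : Prop :=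
  {q : Fin n → ℤ | ∃ p : ℤ,
    |(∑ i, y i * (q i : ℝ)) + (p : ℝ)| ≤
      ‖(fun i => (q i : ℝ) : Fin n → ℝ)‖ ^ (-v)}.Infinite

/-- `y` is very well approximable. -/
def IsVWA {n : ℕ} (y : Fin n → ℝ) : Prop :=
  ∃ v : ℝ, (n : ℝ) < v ∧ InW y v

/-- `f` is extremal on `U`: `f x` is not VWA for a.e. `x ∈ U`. -/
def IsExtremal {α : Type*} [MeasureSpace α] {n : ℕ} (U : Set α) (f : α → Fin n → ℝ) : Prop :=
  volume {x ∈ U | IsVWA (f x)} = 0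

/-- An affine subspace of `ℝ^n` is extremal if any (equivalently, one) injective affine
parametrization of it is an extremal map. -/
def AffineExtremal {n : ℕ} (L : AffineSubspace ℝ (Fin n → ℝ)) : Prop :=
  ∀ (s : ℕ) (h : (Fin s → ℝ) →ᵃ[ℝ] (Fin n → ℝ)), Function.Injective h →
    Set.range h = (L : Set (Fin n → ℝ)) → IsExtremal Set.univ (fun x => h x)

/-- `f : U → L` is nondegenerate in `L` at `x`: for some `l`, the partial derivatives of `f`
at `x` of order up to `l` span the linear part of `L`. -/
def NondegAt {d n : ℕ} (U : Set (Fin d → ℝ)) (L : AffineSubspace ℝ (Fin n → ℝ))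
    (f : (Fin d → ℝ) → Fin n → ℝ) (x : Fin d → ℝ) : Prop :=
  ∃ l : ℕ, Submodule.span ℝ
      {y : Fin n → ℝ | ∃ m : ℕ, 1 ≤ m ∧ m ≤ l ∧
        ∃ u : Fin m → (Fin d → ℝ), y = iteratedFDerivWithin ℝ m f U x u} = L.direction

/-- The `I`-th coordinate (in the basis `e_I`) of `v₁ ∧ … ∧ v_j`, i.e. the `j×j` minor
determinant of the matrix with rows `v₁,…,v_j` and columns indexed by `I`. -/
noncomputable def minorDet {k j : ℕ} (v : Fin j → Fin k → ℤ) (I : Finset (Fin k)) : ℤ :=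
  if h : I.card = j then
    Matrix.det (Matrix.of fun a b : Fin j => v a ((I.orderIsoOfFin h) b : Fin k))
  else 0

/-- `w` (given by its coordinates in the basis `(e_I)_{|I|=j}` of `Λ^j(ℝ^k)`) belongs to
`S_{k,j}`: it represents a rank-`j` subgroup of `ℤ^k`, i.e. `w = v₁ ∧ … ∧ v_j` for some
`ℤ`-basis `v₁,…,v_j` of such a subgroup (equivalently, a `ℤ`-linearly independent family). -/
def IsPrim {k : ℕ} (j : ℕ) (w : Finset (Fin k) → ℝ) : Prop :=
  ∃ v : Fin j → (Fin k → ℤ), LinearIndependent ℤ v ∧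
    ∀ I : Finset (Fin k), w I = (minorDet v I : ℝ)

/-- `l(I,i)`: the number of elements of `I` strictly between `0` and `i`. -/
def lIi {k : ℕ} (I : Finset (Fin (k + 1))) (i : Fin (k + 1)) : ℕ :=
  (I.filter fun a => 0 < a ∧ a < i).card

/-- For `I ∋ 0`, the vector `c_{I,w} = w_I e₀ + ∑_{i ∉ I} (-1)^{l(I,i)} w_{I∪{i}∖{0}} eᵢ`. -/
noncomputable def cIw {k : ℕ} (w : Finset (Fin (k + 1)) → ℝ) (I : Finset (Fin (k + 1))) :
    Fin (k + 1) → ℝ := fun i =>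
  if i = 0 then w I
  else if i ∈ I then 0
  else (-1 : ℝ) ^ (lIi I i) * w ((insert i I).erase 0)

/-- `max_{I ∋ 0, |I| = j} ‖P c_{I,w}‖` (sup norm on `ℝ^{s+1}`). -/
noncomputable def maxNormP {s n : ℕ} (P : Matrix (Fin (s + 1)) (Fin (n + 1)) ℝ) (j : ℕ)
    (w : Finset (Fin (n + 1)) → ℝ) : ℝ :=
  ⨆ I : {I : Finset (Fin (n + 1)) // 0 ∈ I ∧ I.card = j}, ‖P.mulVec (cIw w I.1)‖

/-- `max_{I ∌ 0, |I| = j} |w_I|`. -/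
noncomputable def maxCoeff {n : ℕ} (j : ℕ) (w : Finset (Fin (n + 1)) → ℝ) : ℝ :=
  ⨆ I : {I : Finset (Fin (n + 1)) // 0 ∉ I ∧ I.card = j}, |w I.1|

/-- Condition (3.6) for a matrix `P ∈ M_{s+1,n+1}(ℝ)`: for every `β > 0` there is `T > 0`
such that for all `t ≥ T`, `j = 1,…,n` and `w ∈ S_{n+1,j}`,
`max(e^{((n+1-j)/n)t} max_{I∋0} ‖P c_{I,w}‖, e^{-(j/n)t} max_{I∌0} |w_I|) ≥ e^{-βt}`. -/
def Cond36 {s n : ℕ} (P : Matrix (Fin (s + 1)) (Fin (n + 1)) ℝ) : Prop :=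
  ∀ β : ℝ, 0 < β → ∃ T : ℝ, 0 < T ∧ ∀ t : ℝ, T ≤ t → ∀ j : ℕ, 1 ≤ j → j ≤ n →
    ∀ w : Finset (Fin (n + 1)) → ℝ, IsPrim j w →
      Real.exp (-β * t) ≤
        max (Real.exp ((((n : ℝ) + 1 - (j : ℝ)) / (n : ℝ)) * t) * maxNormP P j w)
            (Real.exp (-((j : ℝ) / (n : ℝ)) * t) * maxCoeff j w)

section

open Set

/-- A finite family of bounded open intervals has a subfamily with the same union covering no
point more than twice. -/
theorem exists_subcover_multiplicity_le_two {κ : Type*} (T : Finset κ) (p q : κ → ℝ) :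
    ∃ T' ⊆ T, (⋃ k ∈ T', Ioo (p k) (q k)) = (⋃ k ∈ T, Ioo (p k) (q k)) ∧
      ∀ x, {k ∈ (T' : Set κ) | x ∈ Ioo (p k) (q k)}.encard ≤ 2 := by
  classical
  induction T using Finset.strongInduction with
  | H T ih =>
    by_cases hT : ∃ k ∈ T, (⋃ i ∈ T.erase k, Ioo (p i) (q i)) = ⋃ i ∈ T, Ioo (p i) (q i)
    · obtain ⟨k, hk, hU⟩ := hT
      obtain ⟨T', hT', hU', hm⟩ := ih _ (Finset.erase_ssubset hk)
      exact ⟨T', hT'.trans (Finset.erase_subset _ _), hU'.trans hU, hm⟩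
    · refine ⟨T, subset_rfl, rfl, fun x => ?_⟩
      by_contra! hlt
      push Not at hT
      set S := T.filter fun k => x ∈ Ioo (p k) (q k) with hS
      have hcard : 2 < S.card := by
        have : {k ∈ (T : Set κ) | x ∈ Ioo (p k) (q k)} = (S : Set κ) := by
          ext; simp [hS]
        rw [this, Set.encard_coe_eq_coe_finsetCard] at hlt
        exact_mod_cast hlt
      have hne : S.Nonempty := Finset.card_pos.mp (by omega)
      obtain ⟨i, hi, hmin⟩ := S.exists_min_image p hne
      obtain ⟨j, hj, hmax⟩ := S.exists_max_image q hne
      obtain ⟨k, hk, hkij⟩ : ∃ k ∈ S, k ∉ ({i, j} : Finset κ) := by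
        by_contra! hsub
        have := Finset.card_le_card (show S ⊆ {i, j} from hsub)
        have := Finset.card_le_two (a := i) (b := j)
        omega
      simp only [Finset.mem_insert, Finset.mem_singleton, not_or] at hkij
      have hmem : ∀ l ∈ S, l ∈ T ∧ p l < x ∧ x < q l := fun l hl => by
        simpa [hS] using hl
      refine hT k (hmem k hk).1 (Subset.antisymm ?_ ?_)
      · exact biUnion_subset_biUnion_left (fun a ha => Finset.mem_of_mem_erase ha)
      · intro y hy
        simp only [mem_iUnion, exists_prop] at hy ⊢
        obtain ⟨l, hl, hyl⟩ := hy
        by_cases hlk : l = k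
        · subst hlk
          by_cases hyx : y ≤ x
          · exact ⟨i, Finset.mem_erase.2 ⟨Ne.symm hkij.1, (hmem i hi).1⟩,
              lt_of_le_of_lt (hmin l hk) hyl.1, lt_of_le_of_lt hyx (hmem i hi).2.2⟩
          · exact ⟨j, Finset.mem_erase.2 ⟨Ne.symm hkij.2, (hmem j hj).1⟩,
              (hmem j hj).2.1.trans (not_le.1 hyx), lt_of_lt_of_le hyl.2 (hmax l hk)⟩
        · exact ⟨l, Finset.mem_erase.2 ⟨hlk, hl⟩, hyl⟩

theorem sum_volume_le_of_multiplicity {κ : Type*} (T : Finset κ) (p q : κ → ℝ) {a b : ℝ}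
    (hsub : ∀ k ∈ T, Ioo (p k) (q k) ⊆ Icc a b)
    (hm : ∀ x, {k ∈ (T : Set κ) | x ∈ Ioo (p k) (q k)}.encard ≤ 2) :
    ∑ k ∈ T, volume (Ioo (p k) (q k)) ≤ 2 * volume (Icc a b) := by
  classical
  calc ∑ k ∈ T, volume (Ioo (p k) (q k))
      = ∫⁻ x, ∑ k ∈ T, (Ioo (p k) (q k)).indicator 1 x := by
        rw [lintegral_finsetSum _ fun k _ => measurable_one.indicator measurableSet_Ioo]
        exact Finset.sum_congr rfl fun k _ => (lintegral_indicator_one measurableSet_Ioo).symm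
    _ ≤ ∫⁻ x, (Icc a b).indicator (fun _ => 2) x := by
        refine lintegral_mono fun x => ?_
        have hsum : (∑ k ∈ T, (Ioo (p k) (q k)).indicator (1 : ℝ → ENNReal) x) =
            ((T.filter fun k => x ∈ Ioo (p k) (q k)).card : ENNReal) := by
          simp only [indicator_apply, Pi.one_apply]
          rw [Finset.sum_ite]; simp
        rw [hsum]
        by_cases hx : x ∈ Icc a b
        · rw [indicator_of_mem hx]
          have := hm x
          rw [show {k ∈ (T : Set κ) | x ∈ Ioo (p k) (q k)} =
            ((T.filter fun k => x ∈ Ioo (p k) (q k) : Finset κ) : Set κ) by ext; simp,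
            Set.encard_coe_eq_coe_finsetCard] at this
          have h2 : (T.filter fun k => x ∈ Ioo (p k) (q k)).card ≤ 2 := by exact_mod_cast this
          exact (Nat.cast_le (α := ENNReal)).2 h2
        · rw [indicator_of_notMem hx, Finset.filter_eq_empty_iff.2]
          · simp
          · exact fun k hk hxk => hx (hsub k hk hxk)
    _ = 2 * volume (Icc a b) := by
        rw [lintegral_indicator measurableSet_Icc]; simp

/-- A set that has density at most `δ` in intervals covering it has density at most `2 δ`. -/
theorem measure_le_of_interval_cover {a b : ℝ} {δ : ENNReal} {E : Set ℝ}
    (h : ∀ y ∈ E, ∃ p q, a ≤ p ∧ p < q ∧ q ≤ b ∧ y ∈ Icc p q ∧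
      volume (E ∩ Icc p q) ≤ δ * volume (Icc p q)) :
    volume E ≤ 2 * δ * volume (Icc a b) := by
  choose! p q hap hpq hqb hy hE using h
  set V : Set ℝ := ⋃ y ∈ E, Ioo (p y) (q y) with hV
  have hcount : (E \ V).Countable := by
    have key : ∀ y ∈ E \ V, y = p y ∨ y = q y := by
      intro y hyV
      by_contra! hne
      exact hyV.2 (mem_biUnion hyV.1 ⟨lt_of_le_of_ne (hy y hyV.1).1 hne.1.symm,
        lt_of_le_of_ne (hy y hyV.1).2 hne.2⟩)
    have h1 : ({y ∈ E \ V | y = p y}).Countable := by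
      refine Set.PairwiseDisjoint.countable_of_Ioo (y := q) ?_ ?_
      · intro y hyy z hzz hyz
        refine Set.disjoint_left.2 fun x hxy hxz => ?_
        rcases lt_or_gt_of_ne hyz with hlt | hlt
        · exact hzz.1.2 (mem_biUnion hyy.1.1 ⟨hyy.2 ▸ hlt, hxz.1.trans hxy.2⟩)
        · exact hyy.1.2 (mem_biUnion hzz.1.1 ⟨hzz.2 ▸ hlt, hxy.1.trans hxz.2⟩)
      · intro y hyy
        have := hpq y hyy.1.1
        rw [hyy.2]; rw [← hyy.2]; rwa [← hyy.2] at this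
    have h2 : ({y ∈ E \ V | y = q y}).Countable := by
      have : (Neg.neg '' {y ∈ E \ V | y = q y}).Countable := by
        refine Set.PairwiseDisjoint.countable_of_Ioo (y := fun z => - p (-z)) ?_ ?_
        · rintro _ ⟨y, hyy, rfl⟩ _ ⟨z, hzz, rfl⟩ hyz
          refine Set.disjoint_left.2 fun x hxy hxz => ?_
          simp only [mem_Ioo, neg_neg] at hxy hxz
          have hyz' : y ≠ z := fun h => hyz (by rw [h])
          rcases lt_or_gt_of_ne hyz' with hlt | hlt
          · exact hyy.1.2 (mem_biUnion hzz.1.1 ⟨by linarith [hxy.1, hxz.2], by linarith [hzz.2]⟩)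
          · exact hzz.1.2 (mem_biUnion hyy.1.1 ⟨by linarith [hxy.2, hxz.1], by linarith [hyy.2]⟩)
        · rintro _ ⟨y, hyy, rfl⟩
          have := hpq y hyy.1.1
          rw [neg_neg]; linarith [hyy.2]
      exact MapsTo.countable_of_injOn (mapsTo_image _ _) neg_injective.injOn this
    refine (h1.union h2).mono fun y hyV => ?_
    rcases key y hyV with h | h
    · exact Or.inl ⟨hyV, h⟩
    · exact Or.inr ⟨hyV, h⟩
  obtain ⟨c, hcE, hcc, hcV⟩ := TopologicalSpace.isOpen_biUnion_countable E
    (fun y => Ioo (p y) (q y)) fun _ _ => isOpen_Ioo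
  have hfin : ∀ T : Finset c, volume (⋃ k ∈ T, E ∩ Ioo (p k) (q k)) ≤ 2 * δ * volume (Icc a b) := by
    intro T
    obtain ⟨T', -, hU, hm⟩ := exists_subcover_multiplicity_le_two T (fun k : c => p k) fun k => q k
    have hsub : ∀ k ∈ T', Ioo (p k) (q k) ⊆ Icc a b := fun k _ =>
      Ioo_subset_Icc_self.trans (Icc_subset_Icc (hap k (hcE k.2)) (hqb k (hcE k.2)))
    rw [← inter_iUnion₂, ← hU, inter_iUnion₂]
    calc volume (⋃ k ∈ T', E ∩ Ioo (p k) (q k))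
        ≤ ∑ k ∈ T', volume (E ∩ Ioo (p k) (q k)) := measure_biUnion_finset_le _ _
      _ ≤ ∑ k ∈ T', δ * volume (Ioo (p k) (q k)) := by
          refine Finset.sum_le_sum fun k _ => ?_
          refine (measure_mono (inter_subset_inter_right E Ioo_subset_Icc_self)).trans
            ((hE k (hcE k.2)).trans_eq ?_)
          simp
      _ = δ * ∑ k ∈ T', volume (Ioo (p k) (q k)) := by rw [Finset.mul_sum]
      _ ≤ δ * (2 * volume (Icc a b)) := by
          gcongr; exact sum_volume_le_of_multiplicity T' _ _ hsub hm
      _ = 2 * δ * volume (Icc a b) := by ring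
  have hEV : volume (E ∩ V) ≤ 2 * δ * volume (Icc a b) := by
    have := hcc.to_subtype
    have : E ∩ V = ⋃ T : Finset c, ⋃ k ∈ T, E ∩ Ioo (p k) (q k) := by
      rw [hV, ← hcV]
      ext x
      simp only [mem_inter_iff, mem_iUnion, exists_prop, Subtype.exists]
      constructor
      · rintro ⟨hx, k, hk, hxk⟩
        exact ⟨{⟨k, hk⟩}, k, hk, by simp, hx, hxk⟩
      · rintro ⟨T, k, hk, -, hx, hxk⟩
        exact ⟨hx, k, hk, hxk⟩
    rw [this, Directed.measure_iUnion]
    · exact iSup_le hfin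
    · exact directed_of_isDirected_le fun S T hST =>
        biUnion_subset_biUnion_left hST
  calc volume E ≤ volume (E ∩ V) + volume (E \ V) := measure_le_inter_add_sdiff _ _ _
    _ ≤ 2 * δ * volume (Icc a b) := by rw [hcount.measure_zero, add_zero]; exact hEV

end

section

open Set

/-- A point `x` is marked for the family `S` if it admits a flag `F ⊆ S` with
`ε ≤ ψ i x ≤ ρ` on `F` and `ρ ≤ ψ i x` for the other members of `S` comparable with `F`. -/
def Marked {ι : Type*} (r : ι → ι → Prop) (S : Finset ι) (ψ : ι → ℝ → ℝ) (ε ρ x : ℝ) : Prop :=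
  ∃ F ⊆ S, (∀ i ∈ F, ∀ j ∈ F, r i j) ∧ (∀ i ∈ F, ε ≤ ψ i x ∧ ψ i x ≤ ρ) ∧
    ∀ i ∈ S, i ∉ F → (∀ j ∈ F, r i j) → ρ ≤ ψ i x

theorem exists_maximal_interval {ι : Type*} (S : Finset ι) (ψ : ι → ℝ → ℝ) {ρ a b y : ℝ}
    (hψ : ∀ i ∈ S, Continuous (ψ i)) (hsup : ∀ i ∈ S, ∃ x ∈ Icc a b, ρ ≤ ψ i x)
    (hy : y ∈ Icc a b) (hlt : ∃ i ∈ S, ψ i y < ρ) :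
    ∃ p q, a ≤ p ∧ p < q ∧ q ≤ b ∧ y ∈ Icc p q ∧ (∃ i ∈ S, ∀ x ∈ Icc p q, ψ i x ≤ ρ) ∧
      ∀ i ∈ S, ∃ x ∈ Icc p q, ρ ≤ ψ i x := by
  set K : ι → Set (ℝ × ℝ) := fun i => (Icc a y ×ˢ Icc y b) ∩
    {z | ∀ θ ∈ Icc (0 : ℝ) 1, ψ i (y + θ * (z.1 - y)) ≤ ρ ∧ ψ i (y + θ * (z.2 - y)) ≤ ρ} with hK
  have hmem : ∀ i p q, (p, q) ∈ K i ↔ p ∈ Icc a y ∧ q ∈ Icc y b ∧ ∀ x ∈ Icc p q, ψ i x ≤ ρ := by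
    intro i p q
    simp only [hK, mem_inter_iff, mem_prod, mem_ofPred_eq, and_assoc]
    refine and_congr_right fun hp => and_congr_right fun hq => ⟨fun h x hx => ?_, fun h θ hθ => ?_⟩
    · rcases le_total x y with hxy | hxy
      · rcases hxy.eq_or_lt with rfl | hxy
        · simpa using (h 0 (by simp)).1
        have hpy : p - y < 0 := by linarith [hx.1]
        have := (h ((x - y) / (p - y)) ⟨div_nonneg_of_nonpos (by linarith) hpy.le,
          (div_le_one_of_neg hpy).2 (by linarith [hx.1])⟩).1
        rwa [div_mul_cancel₀ _ hpy.ne, add_sub_cancel] at this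
      · rcases hxy.eq_or_lt with rfl | hxy
        · simpa using (h 0 (by simp)).1
        have hpy : 0 < q - y := by linarith [hx.2]
        have := (h ((x - y) / (q - y)) ⟨div_nonneg (by linarith) hpy.le,
          (div_le_one hpy).2 (by linarith [hx.2])⟩).2
        rwa [div_mul_cancel₀ _ hpy.ne', add_sub_cancel] at this
    · exact ⟨h _ ⟨by nlinarith [hp.2, hθ.2], by nlinarith [hp.2, hθ.1, hq.1]⟩,
        h _ ⟨by nlinarith [hp.2, hθ.1, hq.1], by nlinarith [hq.1, hθ.2]⟩⟩
  have hcompact : IsCompact (⋃ i ∈ S, K i) := by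
    refine S.isCompact_biUnion fun i hi => (isCompact_Icc.prod isCompact_Icc).inter_right ?_
    simp only [ofPred_forall]
    refine isClosed_biInter fun θ _ => ?_
    have := hψ i hi
    exact (isClosed_le (f := fun z : ℝ × ℝ => ψ i (y + θ * (z.1 - y))) (by fun_prop)
      continuous_const).inter (isClosed_le (f := fun z : ℝ × ℝ => ψ i (y + θ * (z.2 - y)))
        (by fun_prop) continuous_const)
  obtain ⟨i₀, hi₀, hψ₀⟩ := hlt
  have hne : (⋃ i ∈ S, K i).Nonempty := by
    refine ⟨(y, y), mem_biUnion hi₀ ((hmem _ _ _).2 ⟨⟨hy.1, le_rfl⟩, ⟨le_rfl, hy.2⟩, ?_⟩)⟩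
    intro x hx
    rw [le_antisymm hx.2 hx.1]; exact hψ₀.le
  obtain ⟨⟨p, q⟩, hpq, hmax⟩ := hcompact.exists_isMaxOn hne
    (f := fun z : ℝ × ℝ => z.2 - z.1) (by fun_prop)
  simp only [mem_iUnion, exists_prop] at hpq
  obtain ⟨i, hi, hpq⟩ := hpq
  obtain ⟨hp, hq, hle⟩ := (hmem _ _ _).1 hpq
  have hfull : ∀ j ∈ S, ∃ x ∈ Icc p q, ρ ≤ ψ j x := by
    intro j hj
    by_contra! hlt
    obtain ⟨η, hη, hsub⟩ := (isCompact_Icc (a := p) (b := q)).exists_thickening_subset_open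
      (isOpen_lt (hψ j hj) continuous_const) hlt
    have hbig : (max a (p - η / 2), min b (q + η / 2)) ∈ ⋃ i ∈ S, K i := by
      refine mem_biUnion hj ((hmem _ _ _).2 ⟨⟨le_max_left _ _, max_le hy.1 (by linarith [hp.2])⟩,
        ⟨le_min hy.2 (by linarith [hq.1]), min_le_left _ _⟩, fun x hx => ?_⟩)
      have h1 := (le_max_right a _).trans hx.1
      have h2 := hx.2.trans (min_le_right b _)
      refine le_of_lt (hsub (Metric.mem_thickening_iff.2 ?_))
      have hpq' := hp.2.trans hq.1
      rcases lt_or_ge x p with hxp | hxp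
      · exact ⟨p, ⟨le_rfl, hpq'⟩, by rw [Real.dist_eq, abs_lt]; constructor <;> linarith⟩
      rcases lt_or_ge q x with hxq | hxq
      · exact ⟨q, ⟨hpq', le_rfl⟩, by rw [Real.dist_eq, abs_lt]; constructor <;> linarith⟩
      · exact ⟨x, ⟨hxp, hxq⟩, by simpa using hη⟩
    have hle' : min b (q + η / 2) - max a (p - η / 2) ≤ q - p := hmax hbig
    have hpa : p = a := by
      by_contra hne
      have hlt : a < p := lt_of_le_of_ne hp.1 (Ne.symm hne)
      have h1 : max a (p - η / 2) < p := max_lt hlt (by linarith)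
      have h2 : q ≤ min b (q + η / 2) := le_min hq.2 (by linarith)
      linarith
    have hqb : q = b := by
      by_contra hne
      have hlt : q < b := lt_of_le_of_ne hq.2 hne
      have h1 : max a (p - η / 2) ≤ p := max_le hp.1 (by linarith)
      have h2 : q < min b (q + η / 2) := lt_min hlt (by linarith)
      linarith
    obtain ⟨x, hx, hρ⟩ := hsup j hj
    exact absurd hρ (not_le.2 (hlt x (by rwa [hpa, hqb])))
  refine ⟨p, q, hp.1, ?_, hq.2, ⟨hp.2, hq.1⟩, ⟨i, hi, hle⟩, hfull⟩
  refine lt_of_le_of_ne (hp.2.trans hq.1) fun hpq' => ?_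
  obtain ⟨x, hx, hρ⟩ := hfull i₀ hi₀
  have : x = y := by
    have := hp.2; have := hq.1; have := hx.1; have := hx.2
    linarith
  exact absurd hρ (not_le.2 (this ▸ hψ₀))

/-- Quantitative nondivergence on an interval, for an abstract family of functions indexed by a set
with a symmetric relation playing the role of comparability in a poset. -/
theorem measure_not_marked_le {ι : Type*} (r : ι → ι → Prop) (hr : ∀ i j, r i j → r j i)
    (hrefl : ∀ i, r i i)
    (ψ : ι → ℝ → ℝ) (ε ρ : ℝ) (δ : ENNReal) (m : ℕ) : ∀ (S : Finset ι) (a b : ℝ),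
    (∀ i ∈ S, Continuous (ψ i)) →
    (∀ T ⊆ S, (∀ i ∈ T, ∀ j ∈ T, r i j) → T.card ≤ m) →
    (∀ i ∈ S, ∃ x ∈ Icc a b, ρ ≤ ψ i x) →
    (∀ i ∈ S, ∀ p q, a ≤ p → p < q → q ≤ b → (∃ x ∈ Icc p q, ρ ≤ ψ i x) →
      volume {x ∈ Icc p q | ψ i x < ε} ≤ δ * volume (Icc p q)) →
    volume {x ∈ Icc a b | ¬ Marked r S ψ ε ρ x} ≤ (4 ^ m - 1 : ℕ) * δ * volume (Icc a b) := by
  classical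
  induction m with
  | zero =>
    intro S a b _ hch _ _
    have hS : S = ∅ := by
      by_contra hne
      obtain ⟨i, hi⟩ := Finset.nonempty_of_ne_empty hne
      have := hch {i} (by simpa using hi) (by simpa using hrefl i)
      simp at this
    have : {x ∈ Icc a b | ¬ Marked r S ψ ε ρ x} = ∅ := by
      refine eq_empty_of_forall_notMem fun x hx => hx.2 ⟨∅, by simp, by simp, by simp, by simp [hS]⟩
    rw [this]; simp
  | succ m ih =>
    intro S a b hψ hch hsup hgood
    set D : ENNReal := ((4 ^ m - 1 : ℕ) : ENNReal) with hD
    have key : volume {x ∈ Icc a b | ¬ Marked r S ψ ε ρ x} ≤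
        2 * ((1 + D) * δ) * volume (Icc a b) := by
      refine measure_le_of_interval_cover fun y hy => ?_
      have hlt : ∃ i ∈ S, ψ i y < ρ := by
        by_contra! hge
        exact hy.2 ⟨∅, by simp, by simp, by simp, fun i hi _ _ => hge i hi⟩
      obtain ⟨p, q, hap, hpq, hqb, hypq, ⟨i, hi, hle⟩, hfull⟩ :=
        exists_maximal_interval S ψ hψ hsup hy.1 hlt
      refine ⟨p, q, hap, hpq, hqb, hypq, ?_⟩
      set S' := S.filter fun j => r i j ∧ j ≠ i with hS'
      have hS'S : S' ⊆ S := Finset.filter_subset _ _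
      have hm := ih S' p q (fun j hj => hψ j (hS'S hj)) ?_ (fun j hj => hfull j (hS'S hj))
        (fun j hj p' q' h1 h2 h3 => hgood j (hS'S hj) p' q' (hap.trans h1) h2 (h3.trans hqb))
      · have hsub : {x ∈ Icc a b | ¬ Marked r S ψ ε ρ x} ∩ Icc p q ⊆
            {x ∈ Icc p q | ψ i x < ε} ∪ {x ∈ Icc p q | ¬ Marked r S' ψ ε ρ x} := by
          rintro x ⟨⟨-, hx⟩, hxpq⟩
          by_contra hcon
          simp only [mem_union, mem_ofPred_eq, not_or, not_and, not_lt, not_not] at hcon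
          obtain ⟨F, hFS, hFr, hF, hFc⟩ := hcon.2 hxpq
          have hFi : ∀ j ∈ F, r i j := fun j hj => (Finset.mem_filter.1 (hFS hj)).2.1
          refine hx ⟨insert i F, Finset.insert_subset hi (hFS.trans hS'S), ?_, ?_, ?_⟩
          · intro j hj k hk
            rcases Finset.mem_insert.1 hj with rfl | hj' <;>
              rcases Finset.mem_insert.1 hk with rfl | hk'
            · exact hrefl _
            · exact hFi k hk'
            · exact hr _ _ (hFi j hj')
            · exact hFr j hj' k hk'
          · intro j hj
            rcases Finset.mem_insert.1 hj with rfl | hj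
            · exact ⟨hcon.1 hxpq, hle x hxpq⟩
            · exact hF j hj
          · intro j hj hjF hjr
            rw [Finset.mem_insert, not_or] at hjF
            exact hFc j (Finset.mem_filter.2 ⟨hj, hr _ _ (hjr i (Finset.mem_insert_self _ _)),
              hjF.1⟩) hjF.2 fun k hk => hjr k (Finset.mem_insert_of_mem hk)
        calc _ ≤ _ := measure_mono hsub
          _ ≤ _ := measure_union_le _ _
          _ ≤ δ * volume (Icc p q) + D * δ * volume (Icc p q) :=
            add_le_add (hgood i hi p q hap hpq hqb (hfull i hi)) hm
          _ = (1 + D) * δ * volume (Icc p q) := by ring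
      · intro T hT hTr
        have hiT : i ∉ T := fun h => (Finset.mem_filter.1 (hT h)).2.2 rfl
        have := hch (insert i T) (Finset.insert_subset hi (hT.trans hS'S)) ?_
        · rw [Finset.card_insert_of_notMem hiT] at this
          omega
        · have hTi : ∀ j ∈ T, r i j := fun j hj => (Finset.mem_filter.1 (hT hj)).2.1
          intro j hj k hk
          rcases Finset.mem_insert.1 hj with rfl | hj' <;>
            rcases Finset.mem_insert.1 hk with rfl | hk'
          · exact hrefl _
          · exact hTi k hk'
          · exact hr _ _ (hTi j hj')
          · exact hTr j hj' k hk'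
    refine key.trans ?_
    have hnum : 2 * (1 + D) ≤ ((4 ^ (m + 1) - 1 : ℕ) : ENNReal) := by
      rw [hD]
      have h4 : 1 ≤ 4 ^ m := Nat.one_le_pow _ _ (by norm_num)
      have : 2 * (1 + (4 ^ m - 1)) ≤ 4 ^ (m + 1) - 1 := by rw [pow_succ]; omega
      exact_mod_cast this
    calc 2 * ((1 + D) * δ) * volume (Icc a b) = 2 * (1 + D) * δ * volume (Icc a b) := by ring
      _ ≤ _ := by gcongr

end

section

open Set Polynomial

theorem exists_iteratedDeriv_eq_zero {V : Set ℝ} (hV : IsOpen V) (hVc : V.OrdConnected) (k : ℕ) :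
    ∀ (F : ℝ → ℝ), ContDiffOn ℝ k F V → ∀ x : Fin (k + 1) → ℝ, StrictMono x →
      (∀ i, x i ∈ V) → (∀ i, F (x i) = 0) → ∃ ξ ∈ V, iteratedDeriv k F ξ = 0 := by
  induction k with
  | zero => exact fun F _ x _ hxV hF => ⟨x 0, hxV 0, by simpa using hF 0⟩
  | succ k ih =>
    intro F hFd x hx hxV hF
    have hex : ∀ i : Fin (k + 1), ∃ y ∈ Ioo (x i.castSucc) (x i.succ), deriv F y = 0 := fun i =>
      exists_deriv_eq_zero (hx Fin.castSucc_lt_succ)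
        (hFd.continuousOn.mono (hVc.out (hxV _) (hxV _))) (by rw [hF, hF])
    choose y hy hy0 using hex
    have hsm : StrictMono y := fun i j hij =>
      (hy i).2.trans_le ((hx.monotone (by simpa [Fin.le_def] using hij)).trans (hy j).1.le)
    have hd : ContDiffOn ℝ k (deriv F) V := by
      have := (contDiffOn_succ_iff_deriv_of_isOpen (n := (k : WithTop ℕ∞)) hV (f := F)).1
        (by exact_mod_cast hFd)
      exact this.2.2
    obtain ⟨ξ, hξ, h0⟩ := ih (deriv F) hd y hsm
      (fun i => hVc.out (hxV _) (hxV _) ⟨(hy i).1.le, (hy i).2.le⟩) hy0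
    exact ⟨ξ, hξ, by rwa [iteratedDeriv_succ']⟩

theorem exists_iteratedDeriv_eq_zero_of_card {V : Set ℝ} (hV : IsOpen V) (hVc : V.OrdConnected)
    {k : ℕ} {F : ℝ → ℝ} (hF : ContDiffOn ℝ k F V) (Z : Finset ℝ) (hZ : Z.card = k + 1)
    (hZV : ∀ z ∈ Z, z ∈ V) (h0 : ∀ z ∈ Z, F z = 0) : ∃ ξ ∈ V, iteratedDeriv k F ξ = 0 :=
  exists_iteratedDeriv_eq_zero hV hVc k F hF (Z.orderEmbOfFin hZ)
    (Z.orderEmbOfFin hZ).strictMono (fun i => hZV _ (Z.orderEmbOfFin_mem hZ i))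
    fun i => h0 _ (Z.orderEmbOfFin_mem hZ i)

theorem iteratedDeriv_polynomial_eval (Q : ℝ[X]) (k : ℕ) :
    iteratedDeriv k (fun x => Q.eval x) = fun x => (derivative^[k] Q).eval x := by
  induction k with
  | zero => simp
  | succ k ih =>
    rw [iteratedDeriv_succ, ih, Function.iterate_succ_apply']
    ext x
    exact Polynomial.deriv _

theorem iterate_derivative_nodal (Z : Finset ℝ) :
    derivative^[Z.card] (Lagrange.nodal Z id) = C (Z.card.factorial : ℝ) := by
  have hdeg : (derivative^[Z.card] (Lagrange.nodal Z (id : ℝ → ℝ))).natDegree ≤ 0 := by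
    refine (natDegree_iterate_derivative _ _).trans ?_
    rw [Lagrange.natDegree_nodal]; simp
  rw [eq_C_of_natDegree_le_zero hdeg, coeff_iterate_derivative, zero_add]
  have := (Lagrange.nodal_monic (s := Z) (v := (id : ℝ → ℝ))).coeff_natDegree
  rw [Lagrange.natDegree_nodal] at this
  rw [this, Nat.descFactorial_self]; simp

/-- The error formula for Lagrange interpolation. -/
theorem exists_sub_interpolate_eq {V : Set ℝ} (hV : IsOpen V) (hVc : V.OrdConnected)
    {k : ℕ} {φ : ℝ → ℝ} (hφ : ContDiffOn ℝ k φ V) (Z : Finset ℝ) (hZ : Z.card = k)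
    (hZV : ∀ z ∈ Z, z ∈ V) {x : ℝ} (hx : x ∈ V) :
    ∃ ξ ∈ V, φ x - (Lagrange.interpolate Z id φ).eval x =
      iteratedDeriv k φ ξ / k.factorial * ∏ z ∈ Z, (x - z) := by
  set P := Lagrange.interpolate Z (id : ℝ → ℝ) φ with hP
  have hnode : ∀ z ∈ Z, P.eval z = φ z := fun z hz =>
    Lagrange.eval_interpolate_at_node (v := (id : ℝ → ℝ)) φ (Set.injOn_id _) hz
  by_cases hxZ : x ∈ Z
  · refine ⟨x, hx, ?_⟩
    rw [hnode x hxZ, Finset.prod_eq_zero hxZ (sub_self x)]; simp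
  have hprod : ∏ z ∈ Z, (x - z) ≠ 0 := Finset.prod_ne_zero_iff.2 fun z hz h =>
    hxZ (by rwa [sub_eq_zero.1 h])
  set c := (φ x - P.eval x) / ∏ z ∈ Z, (x - z) with hc
  set Q : ℝ[X] := P + C c * Lagrange.nodal Z id with hQ
  have hQd : ContDiff ℝ k fun t => Q.eval t := by
    simpa using Q.contDiff_aeval (𝕜 := ℝ) k
  obtain ⟨ξ, hξ, h0⟩ := exists_iteratedDeriv_eq_zero_of_card hV hVc
    (hφ.sub hQd.contDiffOn) (insert x Z) (by rw [Finset.card_insert_of_notMem hxZ, hZ])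
    (fun z hz => by
      rcases Finset.mem_insert.1 hz with rfl | hz
      exacts [hx, hZV z hz])
    (fun z hz => by
      rcases Finset.mem_insert.1 hz with rfl | hz
      · simp only [hQ, eval_add, eval_mul, eval_C, Lagrange.eval_nodal, id]
        rw [hc, div_mul_cancel₀ _ hprod]; ring
      · have : ∏ w ∈ Z, (z - w) = 0 := Finset.prod_eq_zero hz (sub_self z)
        simp only [hQ, eval_add, eval_mul, eval_C, Lagrange.eval_nodal, id, this]
        rw [hnode z hz]; ring)
  refine ⟨ξ, hξ, ?_⟩
  change iteratedDeriv k (φ - fun t => Q.eval t) ξ = 0 at h0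
  rw [iteratedDeriv_sub (hφ.contDiffAt (hV.mem_nhds hξ)) hQd.contDiffAt,
    iteratedDeriv_polynomial_eval, hQ, iterate_map_add, iterate_derivative_C_mul] at h0
  have hP0 : derivative^[k] P = 0 := by
    refine iterate_derivative_eq_zero_of_degree_lt ?_
    rw [← hZ]
    exact Lagrange.degree_interpolate_lt _ (Set.injOn_id _)
  have hN := iterate_derivative_nodal Z
  rw [hZ] at hN
  rw [hP0, hN, zero_add] at h0
  simp only [eval_mul, eval_C] at h0
  rw [sub_eq_zero] at h0
  rw [h0, mul_div_assoc, div_self (by positivity), mul_one, hc, div_mul_cancel₀ _ hprod]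

theorem abs_eval_interpolate_le {Z : Finset ℝ} {φ : ℝ → ℝ} {ε L r x : ℝ} (hr : 0 < r) (hrL : r ≤ L)
    (hφ : ∀ z ∈ Z, |φ z| ≤ ε) (hsep : ∀ z ∈ Z, ∀ w ∈ Z, z ≠ w → r ≤ |z - w|)
    (hx : ∀ z ∈ Z, |x - z| ≤ L) :
    |(Lagrange.interpolate Z id φ).eval x| ≤ Z.card * (ε * (L / r) ^ Z.card) := by
  rw [Lagrange.interpolate_apply, eval_finsetSum]
  refine (Finset.abs_sum_le_sum_abs _ _).trans ?_
  rw [← nsmul_eq_mul]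
  refine Finset.sum_le_card_nsmul _ _ _ fun z hz => ?_
  have hε : 0 ≤ ε := (abs_nonneg _).trans (hφ z hz)
  have h1 : 1 ≤ L / r := (one_le_div hr).2 hrL
  rw [eval_mul, eval_C, abs_mul]
  refine mul_le_mul (hφ z hz) ?_ (abs_nonneg _) hε
  rw [Lagrange.basis, eval_prod, Finset.abs_prod]
  calc ∏ w ∈ Z.erase z, |eval x (Lagrange.basisDivisor (id z) (id w))|
      ≤ ∏ w ∈ Z.erase z, L / r := by
        refine Finset.prod_le_prod (fun _ _ => abs_nonneg _) fun w hw => ?_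
        rw [Finset.mem_erase] at hw
        simp only [Lagrange.basisDivisor, eval_mul, eval_C, eval_sub, eval_X, id, abs_mul, abs_inv]
        rw [div_eq_inv_mul]
        refine mul_le_mul (inv_anti₀ hr (hsep z hz w hw.2 hw.1.symm)) (hx w hw.2) (abs_nonneg _)
          (by positivity)
    _ ≤ (L / r) ^ Z.card := by
        rw [Finset.prod_const]
        exact pow_le_pow_right₀ h1 (Finset.card_erase_le)

theorem exists_separated_finset {E : Set ℝ} {r : ℝ} (k : ℕ)
    (hE : ENNReal.ofReal (2 * r * k) < volume E) :
    ∃ Z : Finset ℝ, Z.card = k + 1 ∧ (∀ z ∈ Z, z ∈ E) ∧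
      ∀ z ∈ Z, ∀ w ∈ Z, z ≠ w → r ≤ |z - w| := by
  classical
  suffices h : ∀ j ≤ k + 1, ∃ Z : Finset ℝ, Z.card = j ∧ (∀ z ∈ Z, z ∈ E) ∧
      ∀ z ∈ Z, ∀ w ∈ Z, z ≠ w → r ≤ |z - w| from h _ le_rfl
  intro j
  induction j with
  | zero => exact fun _ => ⟨∅, by simp⟩
  | succ j ih =>
    intro hj
    obtain ⟨Z, hZc, hZE, hsep⟩ := ih (by omega)
    obtain ⟨x, hxE, hx⟩ : ∃ x ∈ E, ∀ z ∈ Z, r ≤ |x - z| := by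
      by_contra! hcon
      have hsub : E ⊆ ⋃ z ∈ Z, Metric.ball z r := fun x hx => by
        obtain ⟨z, hz, hlt⟩ := hcon x hx
        exact mem_biUnion hz hlt
      have : volume E ≤ ENNReal.ofReal (2 * r * k) := by
        calc volume E ≤ ∑ z ∈ Z, volume (Metric.ball z r) :=
              (measure_mono hsub).trans (measure_biUnion_finset_le _ _)
          _ = j * ENNReal.ofReal (2 * r) := by
              simp_rw [Real.volume_ball, Finset.sum_const, hZc, nsmul_eq_mul]
          _ ≤ k * ENNReal.ofReal (2 * r) := by
              gcongr; omega
          _ = ENNReal.ofReal (2 * r * k) := by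
              rw [ENNReal.ofReal_mul' (p := 2 * r) (Nat.cast_nonneg k), ENNReal.ofReal_natCast,
                mul_comm]
      exact absurd hE (not_lt.2 this)
    by_cases hr : 0 < r
    · have hxZ : x ∉ Z := fun h => by have := hx x h; simp at this; linarith
      refine ⟨insert x Z, by rw [Finset.card_insert_of_notMem hxZ, hZc], ?_, ?_⟩
      · intro z hz
        rcases Finset.mem_insert.1 hz with rfl | hz
        exacts [hxE, hZE z hz]
      · intro z hz w hw hzw
        rcases Finset.mem_insert.1 hz with rfl | hz' <;>
          rcases Finset.mem_insert.1 hw with rfl | hw'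
        · exact absurd rfl hzw
        · exact hx w hw'
        · rw [abs_sub_comm]; exact hx z hz'
        · exact hsep z hz' w hw' hzw
    · have hinf : E.Infinite := fun hf => by
        rw [hf.measure_zero] at hE; simp at hE
      obtain ⟨Z', hZ', hc⟩ := hinf.exists_subset_card_eq (j + 1)
      exact ⟨Z', hc, fun z hz => hZ' hz, fun z _ w _ _ => (not_lt.1 hr).trans (abs_nonneg _)⟩

/-- A function one of whose derivatives is bounded above and below on an interval has small
sublevel sets on every subinterval. -/
theorem pow_measure_sublevel_le {V : Set ℝ} (hV : IsOpen V) (hVc : V.OrdConnected)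
    {k N : ℕ} (hkN : 2 * k ≤ N) (hN : 0 < N) {φ : ℝ → ℝ} (hφ : ContDiffOn ℝ k φ V) {A B : ℝ}
    (hA : 0 < A)
    (hlo : ∀ x ∈ V, A ≤ |iteratedDeriv k φ x|) (hhi : ∀ x ∈ V, |iteratedDeriv k φ x| ≤ B)
    {p q ε : ℝ} (hpq : p ≤ q) (hpqV : Icc p q ⊆ V) (hε : 0 < ε) {x : ℝ} (hx : x ∈ Icc p q) :
    |φ x| * (volume.real {y ∈ Icc p q | |φ y| < ε}) ^ N ≤
      (2 * (k + 1)) ^ N * (k + 1) * (1 + B / A) * ε * (q - p) ^ N := by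
  set E := {y ∈ Icc p q | |φ y| < ε} with hE
  set m := volume.real E with hm
  have hB : 0 < B := hA.trans_le ((hlo x (hpqV hx)).trans (hhi x (hpqV hx)))
  have hL : 0 ≤ q - p := by linarith
  have hm0 : 0 ≤ m := measureReal_nonneg
  have hEfin : volume E ≠ ⊤ := ((measure_mono fun y hy => hy.1).trans_lt
    (measure_Icc_lt_top (a := p) (b := q))).ne
  have hmL : m ≤ q - p := by
    have := measureReal_mono (μ := volume) (s₁ := E) (s₂ := Icc p q) (fun y hy => hy.1)
      measure_Icc_lt_top.ne
    rwa [Real.volume_real_Icc_of_le hpq] at this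
  rcases hm0.eq_or_lt with h0 | hmpos
  · rw [← h0, zero_pow hN.ne', mul_zero]
    positivity
  set r := m / (2 * (k + 1)) with hr
  have hrpos : 0 < r := by positivity
  have hrm : 2 * (k + 1) * r = m := by rw [hr]; field_simp
  have hrL : r ≤ q - p := by
    have : r ≤ m := by rw [hr]; exact div_le_self hm0 (by norm_cast; omega)
    linarith
  obtain ⟨Z, hZc, hZE, hsep⟩ := exists_separated_finset (E := E) (r := r) k (by
    rw [← ENNReal.ofReal_toReal hEfin]
    refine (ENNReal.ofReal_lt_ofReal_iff hmpos).2 ?_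
    nlinarith)
  obtain ⟨x₀, hx₀⟩ : Z.Nonempty := Finset.card_pos.1 (by omega)
  set W := Z.erase x₀ with hW
  have hWZ : W ⊆ Z := Finset.erase_subset _ _
  have hWc : W.card = k := by rw [hW, Finset.card_erase_of_mem hx₀, hZc]; rfl
  have hWV : ∀ z ∈ W, z ∈ V := fun z hz => hpqV (hZE z (hWZ hz)).1
  set R := (q - p) / r with hR
  have hR1 : 1 ≤ R := (one_le_div hrpos).2 hrL
  have hdist : ∀ y ∈ Icc p q, ∀ z ∈ W, |y - z| ≤ q - p := fun y hy z hz => by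
    have := (hZE z (hWZ hz)).1
    rw [abs_le]; constructor <;> linarith [hy.1, hy.2, this.1, this.2]
  have hint : ∀ y ∈ Icc p q, |(Lagrange.interpolate W id φ).eval y| ≤ k * (ε * R ^ k) := by
    intro y hy
    have := abs_eval_interpolate_le (Z := W) (φ := φ) (ε := ε) (x := y) hrpos hrL
      (fun z hz => (hZE z (hWZ hz)).2.le)
      (fun z hz w hw => hsep z (hWZ hz) w (hWZ hw)) (hdist y hy)
    rwa [hWc] at this
  have hk : (0 : ℝ) < k.factorial := by positivity
  obtain ⟨ξ, hξ, he⟩ := exists_sub_interpolate_eq hV hVc hφ W hWc hWV (hpqV (hZE x₀ hx₀).1)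
  obtain ⟨ζ, hζ, he'⟩ := exists_sub_interpolate_eq hV hVc hφ W hWc hWV (hpqV hx)
  have hAr : A / k.factorial * r ^ k ≤ (k + 1) * (ε * R ^ k) := by
    have h1 : r ^ k ≤ |∏ z ∈ W, (x₀ - z)| := by
      rw [Finset.abs_prod, ← hWc, ← Finset.prod_const]
      exact Finset.prod_le_prod (fun _ _ => hrpos.le) fun z hz =>
        hsep x₀ hx₀ z (hWZ hz) (Finset.ne_of_mem_erase hz).symm
    have h2 : A / k.factorial * r ^ k ≤ |φ x₀ - (Lagrange.interpolate W id φ).eval x₀| := by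
      rw [he, abs_mul, abs_div, abs_of_pos hk]
      gcongr
      exact hlo ξ hξ
    have h3 := abs_sub (φ x₀) ((Lagrange.interpolate W id φ).eval x₀)
    have h4 := hint x₀ (hZE x₀ hx₀).1
    have h5 := (hZE x₀ hx₀).2
    have h6 : ε ≤ ε * R ^ k := le_mul_of_one_le_right hε.le (one_le_pow₀ hR1)
    linarith
  have hx1 : |φ x| ≤ k * (ε * R ^ k) + B / k.factorial * (q - p) ^ k := by
    have h1 : |∏ z ∈ W, (x - z)| ≤ (q - p) ^ k := by
      rw [Finset.abs_prod, ← hWc, ← Finset.prod_const]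
      exact Finset.prod_le_prod (fun _ _ => abs_nonneg _) fun z hz => hdist x hx z hz
    have h2 : |φ x - (Lagrange.interpolate W id φ).eval x| ≤ B / k.factorial * (q - p) ^ k := by
      rw [he', abs_mul, abs_div, abs_of_pos hk]
      gcongr
      exact hhi ζ hζ
    have h3 := abs_sub_abs_le_abs_sub (φ x) ((Lagrange.interpolate W id φ).eval x)
    have h4 := hint x hx
    linarith
  have hLR : q - p = R * r := by rw [hR, div_mul_cancel₀ _ hrpos.ne']
  have hx2 : |φ x| ≤ (k + 1) * (1 + B / A) * ε * R ^ N := by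
    have h1 : B / k.factorial * (q - p) ^ k ≤ B / A * ((k + 1) * (ε * R ^ k)) * R ^ k := by
      calc B / k.factorial * (q - p) ^ k = B / A * (A / k.factorial * r ^ k) * R ^ k := by
            rw [hLR, mul_pow]; field_simp
        _ ≤ _ := by gcongr
    have h2 : R ^ k ≤ R ^ N := pow_le_pow_right₀ hR1 (by omega)
    have h3 : R ^ k * R ^ k ≤ R ^ N := by
      rw [← pow_add]; exact pow_le_pow_right₀ hR1 (by omega)
    calc |φ x| ≤ k * (ε * R ^ k) + B / A * ((k + 1) * (ε * R ^ k)) * R ^ k := by linarith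
      _ = k * ε * R ^ k + B / A * (k + 1) * ε * (R ^ k * R ^ k) := by ring
      _ ≤ k * ε * R ^ N + B / A * (k + 1) * ε * R ^ N := by gcongr
      _ ≤ (k + 1) * (1 + B / A) * ε * R ^ N := by
          have : 0 ≤ ε * R ^ N := by positivity
          linarith
  calc |φ x| * m ^ N ≤ (k + 1) * (1 + B / A) * ε * R ^ N * (2 * (k + 1) * r) ^ N := by
        rw [hrm]; gcongr
    _ = _ := by rw [hLR, mul_pow, mul_pow]; ring_nf

end

section

open Matrix

/-- The largest absolute value of a maximal minor of `A`. -/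
noncomputable def maxMinor {j k : ℕ} (A : Matrix (Fin j) (Fin k) ℝ) : ℝ :=
  ‖fun c : Fin j → Fin k => (A.submatrix id c).det‖

theorem abs_det_le_maxMinor {j k : ℕ} (A : Matrix (Fin j) (Fin k) ℝ) (c : Fin j → Fin k) :
    |(A.submatrix id c).det| ≤ maxMinor A :=
  norm_le_pi_norm (fun c : Fin j → Fin k => (A.submatrix id c).det) c

theorem maxMinor_le {j k : ℕ} {A : Matrix (Fin j) (Fin k) ℝ} {r : ℝ} (hr : 0 ≤ r)
    (h : ∀ c : Fin j → Fin k, |(A.submatrix id c).det| ≤ r) : maxMinor A ≤ r :=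
  (pi_norm_le_iff_of_nonneg hr).2 h

theorem maxMinor_nonneg {j k : ℕ} (A : Matrix (Fin j) (Fin k) ℝ) : 0 ≤ maxMinor A :=
  norm_nonneg _

theorem maxMinor_mul_left {j k : ℕ} (R : Matrix (Fin j) (Fin j) ℝ) (A : Matrix (Fin j) (Fin k) ℝ) :
    maxMinor (R * A) = |R.det| * maxMinor A := by
  rw [maxMinor, maxMinor, ← Real.norm_eq_abs, ← norm_smul]
  congr 1
  ext c
  rw [Pi.smul_apply, smul_eq_mul, ← det_mul]
  rfl

theorem maxMinor_cons_le {j k : ℕ} (v : Fin k → ℝ) (A : Matrix (Fin j) (Fin k) ℝ) :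
    maxMinor (of (Fin.cons v A : Fin (j + 1) → Fin k → ℝ)) ≤ (j + 1) * ‖v‖ * maxMinor A := by
  refine maxMinor_le (mul_nonneg (by positivity) (maxMinor_nonneg A)) fun c => ?_
  rw [det_succ_row_zero]
  refine (Finset.abs_sum_le_sum_abs _ _).trans ?_
  refine (Finset.sum_le_card_nsmul _ _ (‖v‖ * maxMinor A) fun i _ => ?_).trans_eq ?_
  · rw [abs_mul, abs_mul, abs_pow, abs_neg, abs_one, one_pow, one_mul]
    exact mul_le_mul (norm_le_pi_norm v (c i)) (abs_det_le_maxMinor A fun b => c (i.succAbove b))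
      (abs_nonneg _) (norm_nonneg _)
  · simp [mul_assoc]

theorem exists_det_submatrix_ne_zero {j k : ℕ} {A : Matrix (Fin j) (Fin k) ℝ}
    (hA : LinearIndependent ℝ A.row) : ∃ c : Fin j → Fin k, (A.submatrix id c).det ≠ 0 := by
  have hrank : A.rank = j := by simpa using hA.rank_matrix
  rw [rank_eq_finrank_span_cols] at hrank
  have htop : Submodule.span ℝ (Set.range A.col) = ⊤ :=
    Submodule.eq_top_of_finrank_eq (by rw [hrank]; simp)
  obtain ⟨κ, a, ha, hspan, hli⟩ := exists_linearIndependent' ℝ A.col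
  have : Finite κ := Finite.of_injective a ha
  have := Fintype.ofFinite κ
  have hcard : Fintype.card κ = j := by
    have := finrank_span_eq_card hli
    rw [hspan, htop] at this
    simpa using this.symm
  let e := (Fintype.equivFinOfCardEq hcard).symm
  refine ⟨a ∘ e, ?_⟩
  have h2 : LinearIndependent ℝ (A.submatrix id (a ∘ e)).col :=
    hli.comp e e.injective
  exact ((isUnit_iff_isUnit_det _).1 (linearIndependent_cols_iff_isUnit.1 h2)).ne_zero

/-- Every minor is, up to sign, either zero or one with increasing columns. -/
theorem abs_det_submatrix_eq {j k : ℕ} (A : Matrix (Fin j) (Fin k) ℝ) (c : Fin j → Fin k) :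
    (A.submatrix id c).det = 0 ∨ ∃ (I : Finset (Fin k)) (hI : I.card = j),
      |(A.submatrix id c).det| = |(A.submatrix id (I.orderEmbOfFin hI)).det| := by
  classical
  by_cases hc : Function.Injective c
  · right
    set I := Finset.univ.image c with hIdef
    have hI : I.card = j := by rw [Finset.card_image_of_injective _ hc]; simp
    refine ⟨I, hI, ?_⟩
    let f : Fin j → Fin j := fun a => (I.orderIsoOfFin hI).symm ⟨c a, by simp [hIdef]⟩
    have hf : Function.Injective f := fun a b hab => hc (by simpa [f] using hab)
    let σ : Equiv.Perm (Fin j) := Equiv.ofBijective f (Finite.injective_iff_bijective.1 hf)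
    have hσ : ∀ a, I.orderEmbOfFin hI (σ a) = c a := fun a => by
      have := (I.orderIsoOfFin hI).apply_symm_apply ⟨c a, by simp [hIdef]⟩
      exact congrArg Subtype.val this
    have : A.submatrix id c = (A.submatrix id (I.orderEmbOfFin hI)).submatrix id σ := by
      ext a b
      simp [hσ]
    rw [this, det_permute', abs_mul]
    rcases Int.units_eq_one_or (Equiv.Perm.sign σ) with h | h <;> simp [h]
  · left
    simp only [Function.Injective, not_forall] at hc
    obtain ⟨a, b, hab, hne⟩ := hc
    exact det_zero_of_column_eq hne fun i => by simp [hab]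

theorem det_submatrix_cons_sum {m k : ℕ} (V : Matrix (Fin (m + 1)) (Fin k) ℝ)
    (M : Matrix (Fin (m + 1)) (Fin (m + 1)) ℝ) (y : Fin k → ℝ) (d : Fin m → Fin k)
    (h0 : ∀ a, M a 0 = ∑ i, y i * V a i) (hd : ∀ a b, M a b.succ = V a (d b)) :
    M.det = ∑ i, y i * (V.submatrix id (Fin.cons i d : Fin (m + 1) → Fin k)).det := by
  rw [det_succ_column_zero]
  simp_rw [h0, Finset.mul_sum, Finset.sum_mul]
  rw [Finset.sum_comm]
  refine Finset.sum_congr rfl fun i _ => ?_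
  rw [det_succ_column_zero, Finset.mul_sum]
  refine Finset.sum_congr rfl fun a _ => ?_
  have : M.submatrix a.succAbove Fin.succ =
      (V.submatrix id (Fin.cons i d : Fin (m + 1) → Fin k)).submatrix a.succAbove Fin.succ := by
    ext p q
    simp [hd]
  rw [this]
  simp only [submatrix_apply, id, Fin.cons_zero]
  ring

theorem minorDet_cast {k j : ℕ} (v : Fin j → Fin k → ℤ) (I : Finset (Fin k)) (hI : I.card = j) :
    (minorDet v I : ℝ) =
      ((Matrix.of fun a i => (v a i : ℝ)).submatrix id (I.orderEmbOfFin hI)).det := by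
  rw [minorDet, dif_pos hI]
  exact RingHom.map_det (Int.castRingHom ℝ) _

theorem orderEmbOfFin_comp_succ {m k : ℕ} (I : Finset (Fin (k + 1))) (hI : I.card = m + 1)
    (h0 : 0 ∈ I) : I.orderEmbOfFin hI 0 = 0 ∧ ∀ b : Fin m, I.orderEmbOfFin hI b.succ ≠ 0 := by
  have h : I.orderEmbOfFin hI 0 = 0 := by
    have h1 : (0 : Fin (k + 1)) ∈ Set.range (I.orderEmbOfFin hI) := by
      rw [Finset.range_orderEmbOfFin]; exact h0
    obtain ⟨a, ha⟩ := h1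
    have := (I.orderEmbOfFin hI).monotone (Fin.zero_le a)
    rw [ha] at this
    exact Fin.le_zero_iff.1 this
  refine ⟨h, fun b hb => ?_⟩
  rw [← h] at hb
  exact absurd ((I.orderEmbOfFin hI).injective hb) (Fin.succ_ne_zero b)

theorem det_submatrix_cons_eq {m k : ℕ} (v : Fin (m + 1) → Fin (k + 1) → ℤ)
    (I : Finset (Fin (k + 1))) (hI : I.card = m + 1) (h0 : 0 ∈ I) (i : Fin (k + 1)) :
    ((Matrix.of fun a i => (v a i : ℝ)).submatrix id
      (Fin.cons i (fun b => I.orderEmbOfFin hI b.succ) : Fin (m + 1) → Fin (k + 1))).det =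
      cIw (fun I => (minorDet v I : ℝ)) I i := by
  classical
  obtain ⟨hz, hs⟩ := orderEmbOfFin_comp_succ I hI h0
  rw [cIw]
  have hcons : (Fin.cons 0 (fun b => I.orderEmbOfFin hI b.succ) : Fin (m + 1) → Fin (k + 1)) =
      I.orderEmbOfFin hI := by
    ext b
    refine Fin.cases ?_ (fun b => ?_) b <;> simp [hz]
  split_ifs with hi hiI
  · rw [hi, hcons, minorDet_cast v I hI]
  · have h1 : i ∈ Set.range (I.orderEmbOfFin hI) := by
      rw [Finset.range_orderEmbOfFin]; exact hiI
    obtain ⟨a, ha⟩ := h1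
    obtain ⟨b, rfl⟩ := Fin.exists_succ_eq.2 (show a ≠ 0 by rintro rfl; exact hi (ha ▸ hz))
    exact det_zero_of_column_eq (Fin.succ_ne_zero b).symm fun x => by simp [ha]
  · set J := (insert i I).erase 0 with hJ
    have hJc : J.card = m + 1 := by
      rw [hJ, Finset.card_erase_of_mem (Finset.mem_insert_of_mem h0),
        Finset.card_insert_of_notMem hiI, hI]; rfl
    have hmem : ∀ x ∈ J, x ≠ 0 ∧ (x = i ∨ x ∈ I) := fun x hx => by
      rwa [hJ, Finset.mem_erase, Finset.mem_insert] at hx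
    have hiJ : i ∈ J := by simp [hJ, hi]
    have h1 : i ∈ Set.range (J.orderEmbOfFin hJc) := by
      rw [Finset.range_orderEmbOfFin]; exact hiJ
    obtain ⟨p, hp⟩ := h1
    have hrem : (fun b => J.orderEmbOfFin hJc (p.succAbove b)) =
        fun b => I.orderEmbOfFin hI b.succ := by
      have hc : (I.erase 0).card = m := by rw [Finset.card_erase_of_mem h0, hI]; rfl
      rw [Finset.orderEmbOfFin_unique hc (f := fun b => J.orderEmbOfFin hJc (p.succAbove b)),
        Finset.orderEmbOfFin_unique hc (f := fun b => I.orderEmbOfFin hI b.succ)]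
      · exact fun b => Finset.mem_erase.2 ⟨hs b, Finset.orderEmbOfFin_mem _ _ _⟩
      · exact fun a b hab => (I.orderEmbOfFin hI).strictMono (Fin.succ_lt_succ_iff.2 hab)
      · intro b
        have h2 := Finset.orderEmbOfFin_mem J hJc (p.succAbove b)
        have h3 : J.orderEmbOfFin hJc (p.succAbove b) ≠ i := fun h => by
          rw [← hp] at h
          exact Fin.succAbove_ne p b ((J.orderEmbOfFin hJc).injective h)
        have h2' := hmem _ h2
        exact Finset.mem_erase.2 ⟨h2'.1, h2'.2.resolve_left h3⟩
      · exact fun a b hab => (J.orderEmbOfFin hJc).strictMono (Fin.strictMono_succAbove p hab)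
    have hl : lIi I i = p := by
      rw [lIi]
      have : (I.filter fun a => 0 < a ∧ a < i) =
          (Finset.Iio p).map (J.orderEmbOfFin hJc).toEmbedding := by
        ext a
        simp only [Finset.mem_filter, Finset.mem_map, Finset.mem_Iio]
        constructor
        · rintro ⟨haI, ha0, hai⟩
          have haJ : a ∈ Set.range (J.orderEmbOfFin hJc) := by
            rw [Finset.range_orderEmbOfFin]; simp [hJ, haI, ha0.ne']
          obtain ⟨q, rfl⟩ := haJ
          refine ⟨q, ?_, rfl⟩
          rwa [← hp, OrderEmbedding.lt_iff_lt] at hai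
        · rintro ⟨q, hq, rfl⟩
          have hlt : J.orderEmbOfFin hJc q < i := by
            rw [← hp]; exact (J.orderEmbOfFin hJc).strictMono hq
          have h2 := Finset.orderEmbOfFin_mem J hJc q
          have h2' := hmem _ h2
          exact ⟨h2'.2.resolve_left hlt.ne, Fin.pos_of_ne_zero h2'.1, hlt⟩
      rw [this, Finset.card_map, Fin.card_Iio]
    have hins : (Fin.cons i (fun b => I.orderEmbOfFin hI b.succ) : Fin (m + 1) → Fin (k + 1)) =
        J.orderEmbOfFin hJc ∘ p.cycleRange.symm := by
      funext b
      rw [← hrem]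
      refine Fin.cases ?_ (fun b => ?_) b
      · simp [hp]
      · simp
    rw [minorDet_cast v J hJc, hins, hl]
    have := det_permute' p.cycleRange.symm
      ((Matrix.of fun a i => (v a i : ℝ)).submatrix id (J.orderEmbOfFin hJc))
    rw [submatrix_submatrix] at this
    rw [show (id : Fin (m + 1) → Fin (m + 1)) = id ∘ id from rfl, this, Equiv.Perm.sign_symm,
      Fin.sign_cycleRange]
    simp

end

section

open Matrix

/-- The matrix with real entries attached to an integer family. -/
def castMat {j k : ℕ} (V : Fin j → Fin k → ℤ) : Matrix (Fin j) (Fin k) ℝ :=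
  of fun a i => (V a i : ℝ)

/-- The matrix (acting on row vectors on the right) sending `(p, q)` to
`(e^t (p + y·q), e^{-t/n} q)`. -/
noncomputable def daniMat {n : ℕ} (y : Fin n → ℝ) (t : ℝ) : Matrix (Fin (n + 1)) (Fin (n + 1)) ℝ :=
  of fun i c => if c = 0 then Real.exp t * (Fin.cons 1 y : Fin (n + 1) → ℝ) i
    else if i = c then Real.exp (-t / n) else 0

theorem castMat_mul_daniMat_zero {j n : ℕ} (V : Fin j → Fin (n + 1) → ℤ) (y : Fin n → ℝ) (t : ℝ)
    (a : Fin j) : (castMat V * daniMat y t) a 0 =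
      Real.exp t * ∑ i, (Fin.cons 1 y : Fin (n + 1) → ℝ) i * V a i := by
  simp only [mul_apply, castMat, daniMat, of_apply, if_true, Finset.mul_sum]
  exact Finset.sum_congr rfl fun i _ => by ring

theorem castMat_mul_daniMat_of_ne {j n : ℕ} (V : Fin j → Fin (n + 1) → ℤ) (y : Fin n → ℝ) (t : ℝ)
    (a : Fin j) {c : Fin (n + 1)} (hc : c ≠ 0) : (castMat V * daniMat y t) a c =
      Real.exp (-t / n) * V a c := by
  simp [mul_apply, castMat, daniMat, hc, mul_comm]

theorem det_daniMat {n : ℕ} (hn : 0 < n) (y : Fin n → ℝ) (t : ℝ) : (daniMat y t).det = 1 := by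
  have hn' : (n : ℝ) ≠ 0 := by positivity
  rw [det_of_isLowerTriangular]
  · rw [Fin.prod_univ_succ]
    simp only [daniMat, of_apply, if_true, Fin.cons_zero, mul_one, Fin.succ_ne_zero, if_false,
      Finset.prod_const, Finset.card_univ, Fintype.card_fin]
    rw [← Real.exp_nat_mul, ← Real.exp_add]
    field_simp
    simp
  · intro i c hic
    have hic' : i < c := hic
    have : c ≠ 0 := (Fin.pos_iff_ne_zero).1 ((Fin.zero_le i).trans_lt hic')
    simp [daniMat, this, hic'.ne]

theorem det_castMat_mul_daniMat_of_mem {j n : ℕ} (hn : 0 < n) (V : Fin j → Fin (n + 1) → ℤ)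
    (y : Fin n → ℝ) (t : ℝ) (I : Finset (Fin (n + 1))) (hI : I.card = j) (h0 : 0 ∈ I) :
    ((castMat V * daniMat y t).submatrix id (I.orderEmbOfFin hI)).det =
      Real.exp (((n : ℝ) + 1 - j) / n * t) *
        ∑ i, (Fin.cons 1 y : Fin (n + 1) → ℝ) i * cIw (fun I => (minorDet V I : ℝ)) I i := by
  obtain _ | m := j
  · simp at hI; simp [hI] at h0
  have hn' : (n : ℝ) ≠ 0 := by positivity
  obtain ⟨hz, hs⟩ := orderEmbOfFin_comp_succ I hI h0
  set M : Matrix (Fin (m + 1)) (Fin (m + 1)) ℝ :=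
    of fun a b => (Fin.cons (∑ i, (Fin.cons 1 y : Fin (n + 1) → ℝ) i * V a i)
      (fun b => (V a (I.orderEmbOfFin hI b.succ) : ℝ)) : Fin (m + 1) → ℝ) b with hM
  have h1 : (castMat V * daniMat y t).submatrix id (I.orderEmbOfFin hI) =
      of fun a b => (Fin.cons (Real.exp t) (fun _ => Real.exp (-t / n)) : Fin (m + 1) → ℝ) b *
        M a b := by
    ext a b
    refine Fin.cases ?_ (fun b => ?_) b
    · simp only [submatrix_apply, id, hz, castMat_mul_daniMat_zero, hM, of_apply, Fin.cons_zero]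
    · simp only [submatrix_apply, id, castMat_mul_daniMat_of_ne _ _ _ _ (hs b), hM, of_apply,
        Fin.cons_succ]
  rw [h1, det_mul_row, det_submatrix_cons_sum (castMat V) M (Fin.cons 1 y)
    (fun b => I.orderEmbOfFin hI b.succ) (fun a => by simp [hM, castMat])
    (fun a b => by simp [hM, castMat])]
  congr 1
  · rw [Fin.prod_univ_succ]
    simp only [Fin.cons_zero, Fin.cons_succ, Finset.prod_const, Finset.card_univ, Fintype.card_fin]
    rw [← Real.exp_nat_mul, ← Real.exp_add]
    congr 1
    push_cast
    field_simp
    ring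
  · exact Finset.sum_congr rfl fun i _ => by
      rw [← det_submatrix_cons_eq V I hI h0 i]; rfl

theorem det_castMat_mul_daniMat_of_notMem {j n : ℕ} (V : Fin j → Fin (n + 1) → ℤ)
    (y : Fin n → ℝ) (t : ℝ) (I : Finset (Fin (n + 1))) (hI : I.card = j) (h0 : 0 ∉ I) :
    ((castMat V * daniMat y t).submatrix id (I.orderEmbOfFin hI)).det =
      Real.exp (-((j : ℝ) / n) * t) * minorDet V I := by
  have h1 : (castMat V * daniMat y t).submatrix id (I.orderEmbOfFin hI) =
      of fun a b => (fun _ => Real.exp (-t / n)) b *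
        (castMat V).submatrix id (I.orderEmbOfFin hI) a b := by
    ext a b
    have : I.orderEmbOfFin hI b ≠ 0 := fun h => h0 (h ▸ Finset.orderEmbOfFin_mem I hI b)
    simp only [submatrix_apply, id, castMat_mul_daniMat_of_ne _ _ _ _ this, of_apply]
    rfl
  rw [h1, det_mul_row, minorDet_cast V I hI, Finset.prod_const, ← Real.exp_nat_mul]
  congr 2
  simp
  ring

theorem maxMinor_daniMat_le {j n : ℕ} (hn : 0 < n) (V : Fin j → Fin (n + 1) → ℤ)
    (y : Fin n → ℝ) (t : ℝ) {r : ℝ} (hr : 0 ≤ r)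
    (h1 : ∀ I : Finset (Fin (n + 1)), I.card = j → 0 ∈ I →
      Real.exp (((n : ℝ) + 1 - j) / n * t) *
        |∑ i, (Fin.cons 1 y : Fin (n + 1) → ℝ) i * cIw (fun I => (minorDet V I : ℝ)) I i| ≤ r)
    (h2 : ∀ I : Finset (Fin (n + 1)), I.card = j → 0 ∉ I →
      Real.exp (-((j : ℝ) / n) * t) * |(minorDet V I : ℝ)| ≤ r) :
    maxMinor (castMat V * daniMat y t) ≤ r := by
  refine maxMinor_le hr fun c => ?_
  rcases abs_det_submatrix_eq (castMat V * daniMat y t) c with h | ⟨I, hI, h⟩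
  · rw [h, abs_zero]; exact hr
  · rw [h]
    by_cases h0 : 0 ∈ I
    · rw [det_castMat_mul_daniMat_of_mem hn V y t I hI h0, abs_mul, Real.abs_exp]
      exact h1 I hI h0
    · rw [det_castMat_mul_daniMat_of_notMem V y t I hI h0, abs_mul, Real.abs_exp]
      exact h2 I hI h0

theorem sum_cons_mul_eq {s n : ℕ} {P : Matrix (Fin (s + 1)) (Fin (n + 1)) ℝ}
    {x : Fin s → ℝ} {y : Fin n → ℝ} (hy : Fin.cons 1 y = vecMul (Fin.cons 1 x) P)
    (c : Fin (n + 1) → ℝ) :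
    ∑ i, (Fin.cons 1 y : Fin (n + 1) → ℝ) i * c i =
      ∑ a, (Fin.cons 1 x : Fin (s + 1) → ℝ) a * P.mulVec c a := by
  rw [hy]
  exact (dotProduct_mulVec (Fin.cons 1 x) P c).symm

theorem linearIndependent_castMat {j k : ℕ} {V : Fin j → Fin k → ℤ} (hV : LinearIndependent ℤ V) :
    LinearIndependent ℝ (castMat V).row := by
  have h := (linearIndependent_algebraMap_comp_iff (R := ℤ) (S := ℝ) (v := V)).2 hV
  have he : (castMat V).row = fun i => algebraMap ℤ ℝ ∘ V i := by
    ext a i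
    simp [castMat]
  rwa [he]

end

section

open Matrix

theorem exists_ne_zero_vecMul_norm_lt {j : ℕ} {D : Matrix (Fin j) (Fin j) ℝ} (hD : D.det ≠ 0)
    {θ : ℝ} (hθ : 0 < θ) (h : |D.det| < θ ^ j) :
    ∃ m : Fin j → ℤ, m ≠ 0 ∧ ‖(fun a => (m a : ℝ)) ᵥ* D‖ < θ := by
  have hu : IsUnit D := (isUnit_iff_isUnit_det D).2 hD.isUnit
  have hli : LinearIndependent ℝ D.row := linearIndependent_rows_iff_isUnit.2 hu
  rcases Nat.eq_zero_or_pos j with rfl | hj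
  · simp at h
  have : Nonempty (Fin j) := ⟨⟨0, hj⟩⟩
  let b : Module.Basis (Fin j) ℝ (Fin j → ℝ) :=
    basisOfLinearIndependentOfCardEqFinrank hli (by simp)
  have hb : ∀ a, b a = D a := fun a => by simp [b]; rfl
  have hcount : Countable (Submodule.span ℤ (Set.range b)).toAddSubgroup :=
    inferInstanceAs (Countable (Submodule.span ℤ (Set.range b)))
  obtain ⟨x, hx0, hx⟩ := exists_ne_zero_mem_lattice_of_measure_mul_two_pow_lt_measure
    (s := Metric.ball (0 : Fin j → ℝ) θ) (ZSpan.isAddFundamentalDomain' b volume)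
    (fun x hx => by simpa using hx) (convex_ball _ _) (by
      rw [ZSpan.volume_fundamentalDomain, Real.volume_pi_ball _ hθ, Module.finrank_pi,
        show (of b : Matrix (Fin j) (Fin j) ℝ) = D from by ext a i; simp [hb],
        show (2 : ENNReal) ^ Fintype.card (Fin j) =
          ENNReal.ofReal (2 ^ Fintype.card (Fin j)) by
            rw [ENNReal.ofReal_pow (by norm_num)]; simp,
        ← ENNReal.ofReal_mul (abs_nonneg _)]
      refine (ENNReal.ofReal_lt_ofReal_iff (by positivity)).2 ?_
      rw [Fintype.card_fin, mul_pow, mul_comm]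
      gcongr)
  have hmem : (x : Fin j → ℝ) ∈ Submodule.span ℤ (Set.range b) := x.2
  rw [Submodule.mem_span_range_iff_exists_fun] at hmem
  obtain ⟨m, hm⟩ := hmem
  have he : (fun a => (m a : ℝ)) ᵥ* D = x := by
    rw [← hm, vecMul_eq_sum]
    refine Finset.sum_congr rfl fun a _ => ?_
    rw [hb, Int.cast_smul_eq_zsmul]
  refine ⟨m, ?_, by rw [he]; simpa using hx⟩
  rintro rfl
  apply hx0
  ext i
  rw [← he]
  simp [vecMul, dotProduct]

/-- If all maximal minors of a matrix with independent rows are small, then some nonzero integer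
combination of the rows is short. -/
theorem exists_ne_zero_vecMul_norm_le {j k : ℕ} {B : Matrix (Fin j) (Fin k) ℝ}
    (hB : LinearIndependent ℝ B.row) {θ : ℝ} (hθ : 0 < θ) (h : maxMinor B < θ ^ j) :
    ∃ m : Fin j → ℤ, m ≠ 0 ∧ ‖(fun a => (m a : ℝ)) ᵥ* B‖ ≤ j * θ := by
  obtain ⟨c₀, hc₀⟩ := exists_det_submatrix_ne_zero hB
  have : Nonempty (Fin j → Fin k) := ⟨c₀⟩
  obtain ⟨c, hc⟩ := Finite.exists_max fun c : Fin j → Fin k => |(B.submatrix id c).det|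
  set D := B.submatrix id c with hDdef
  have hD : 0 < |D.det| := (abs_pos.2 hc₀).trans_le (hc c₀)
  obtain ⟨m, hm0, hm⟩ := exists_ne_zero_vecMul_norm_lt (abs_pos.1 hD) hθ
    ((abs_det_le_maxMinor B c).trans_lt h)
  refine ⟨m, hm0, (pi_norm_le_iff_of_nonneg (by positivity)).2 fun i => ?_⟩
  set z : Fin j → ℝ := fun a => (m a : ℝ) with hz
  have h1 : D.det * (z ᵥ* B) i = (z ᵥ* D) ⬝ᵥ cramer D (B.col i) := by
    rw [← dotProduct_mulVec, mulVec_cramer, dotProduct_smul, smul_eq_mul]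
    rfl
  have h2 : ∀ a, |cramer D (B.col i) a| ≤ |D.det| := fun a => by
    rw [cramer_apply]
    have : D.updateCol a (B.col i) = B.submatrix id (Function.update c a i) := by
      ext p q
      by_cases hq : q = a
      · subst hq; simp [hDdef]
      · simp [hDdef, hq]
    rw [this]
    exact hc _
  have h3 : |D.det| * |(z ᵥ* B) i| ≤ |D.det| * (j * θ) := by
    rw [← abs_mul, h1]
    refine (Finset.abs_sum_le_sum_abs _ _).trans ?_
    refine (Finset.sum_le_card_nsmul _ _ (θ * |D.det|) fun a _ => ?_).trans_eq ?_
    · rw [abs_mul]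
      exact mul_le_mul ((norm_le_pi_norm (z ᵥ* D) a).trans hm.le) (h2 a) (abs_nonneg _) hθ.le
    · simp; ring
  exact le_of_mul_le_mul_left h3 hD

end

section

open Matrix Filter

theorem intCast_vecMul_daniMat_zero {n : ℕ} (v : Fin (n + 1) → ℤ) (y : Fin n → ℝ) (t : ℝ) :
    ((fun i => (v i : ℝ)) ᵥ* daniMat y t) 0 =
      Real.exp t * (∑ i, y i * (v i.succ : ℝ) + v 0) := by
  simp only [vecMul, dotProduct, daniMat, of_apply, if_true, Fin.sum_univ_succ, Fin.cons_zero,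
    Fin.cons_succ, mul_add, Finset.mul_sum]
  rw [add_comm]
  congr 1
  · exact Finset.sum_congr rfl fun i _ => by ring
  · ring

theorem intCast_vecMul_daniMat_succ {n : ℕ} (v : Fin (n + 1) → ℤ) (y : Fin n → ℝ) (t : ℝ)
    (i : Fin n) : ((fun i => (v i : ℝ)) ᵥ* daniMat y t) i.succ =
      Real.exp (-t / n) * v i.succ := by
  simp [vecMul, dotProduct, daniMat, Fin.succ_ne_zero, mul_comm]

theorem infinite_setOf_inW_of_eq_zero {n : ℕ} {y : Fin n → ℝ} {v : Fin (n + 1) → ℤ} (hv : v ≠ 0)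
    (h : ∑ i, y i * (v i.succ : ℝ) + v 0 = 0) (w : ℝ) : InW y w := by
  have hq : (fun i : Fin n => v i.succ) ≠ 0 := by
    intro h0
    have h1 : ∀ i : Fin n, v i.succ = 0 := fun i => congrFun h0 i
    simp only [h1, Int.cast_zero, mul_zero, Finset.sum_const_zero, zero_add, Int.cast_eq_zero] at h
    exact hv (funext fun i => Fin.cases h h1 i)
  refine Set.infinite_of_injective_forall_mem (f := fun m : ℤ => m • fun i : Fin n => v i.succ)
    (fun a b hab => ?_) fun m => ⟨m * v 0, ?_⟩
  · exact smul_left_injective ℤ hq hab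
  · have : ∑ i, y i * ((m • fun i : Fin n => v i.succ) i : ℝ) + ((m * v 0 : ℤ) : ℝ) = 0 := by
      calc _ = m * (∑ i, y i * (v i.succ : ℝ) + v 0) := by
            rw [mul_add, Finset.mul_sum]
            push_cast
            congr 1
            exact Finset.sum_congr rfl fun i _ => by simp; ring
        _ = 0 := by rw [h, mul_zero]
    simp only [Pi.smul_apply] at this ⊢
    rw [this, abs_zero]
    positivity

theorem isVWA_of_frequently {n : ℕ} (hn : 0 < n) {y : Fin n → ℝ} {γ C : ℝ} (hγ : 0 < γ)
    (h : ∃ᶠ t : ℝ in atTop, ∃ v : Fin (n + 1) → ℤ, v ≠ 0 ∧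
      ‖(fun i => (v i : ℝ)) ᵥ* daniMat y t‖ ≤ C * Real.exp (-γ * t)) : IsVWA y := by
  have hn' : (0 : ℝ) < n := by positivity
  wlog hC : 0 < C generalizing C
  · refine this (C := 1) (h.mono ?_) one_pos
    rintro t ⟨v, hv, hle⟩
    refine ⟨v, hv, hle.trans ?_⟩
    gcongr
    linarith
  refine ⟨n * (1 + γ / 2), by nlinarith, ?_⟩
  set w := (n : ℝ) * (1 + γ / 2) with hw
  by_cases hex : ∃ v : Fin (n + 1) → ℤ, v ≠ 0 ∧ ∑ i, y i * (v i.succ : ℝ) + v 0 = 0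
  · obtain ⟨v, hv, h0⟩ := hex
    exact infinite_setOf_inW_of_eq_zero hv h0 w
  push Not at hex
  intro hfin
  have hdecay : ∀ d : ℝ, 0 < d → ∀ᶠ t : ℝ in atTop, C * Real.exp (-(1 + γ) * t) < d := by
    intro d hd
    have : Tendsto (fun t : ℝ => C * Real.exp (-(1 + γ) * t)) atTop (nhds (C * 0)) := by
      refine Tendsto.const_mul _ (Real.tendsto_exp_atBot.comp ?_)
      exact tendsto_id.const_mul_atTop_of_neg (by linarith)
    rw [mul_zero] at this
    exact this.eventually_lt_const hd
  have hgrow : ∀ᶠ t : ℝ in atTop, C * C ^ w ≤ Real.exp (γ / 2 * t) :=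
    (Real.tendsto_exp_atTop.comp (tendsto_id.const_mul_atTop (by linarith))).eventually_ge_atTop _
  have hev : ∀ᶠ t : ℝ in atTop, ∀ q ∈ {q : Fin n → ℤ | ∃ p : ℤ,
      |(∑ i, y i * (q i : ℝ)) + (p : ℝ)| ≤ ‖(fun i => (q i : ℝ) : Fin n → ℝ)‖ ^ (-w)}, q ≠ 0 →
      C * Real.exp (-(1 + γ) * t) <
        |(∑ i, y i * (q i : ℝ)) - round (∑ i, y i * (q i : ℝ))| := by
    refine (eventually_all_finite hfin).2 fun q _ => ?_
    by_cases hq : q = 0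
    · exact Eventually.of_forall fun t h => absurd hq h
    refine (hdecay _ (abs_pos.2 fun h0 => ?_)).mono fun t ht _ => ht
    refine hex (Fin.cons (-round (∑ i, y i * (q i : ℝ))) q) (fun hc => hq ?_) ?_
    · ext i
      simpa using congrFun hc i.succ
    · simpa [sub_eq_add_neg] using h0
  obtain ⟨t, ⟨v, hv, hle⟩, ht1, ht2, ht3, ht0⟩ := (h.and_eventually
    ((hdecay 1 one_pos).and (hgrow.and (hev.and (eventually_ge_atTop 0))))).exists
  have h0 : |∑ i, y i * (v i.succ : ℝ) + v 0| ≤ C * Real.exp (-(1 + γ) * t) := by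
    have := (norm_le_pi_norm _ 0).trans hle
    rw [intCast_vecMul_daniMat_zero, Real.norm_eq_abs, abs_mul, Real.abs_exp] at this
    rw [show -(1 + γ) * t = -γ * t - t by ring, Real.exp_sub, ← mul_div_assoc,
      le_div_iff₀ (Real.exp_pos _), mul_comm]
    exact this
  have hq : (fun i : Fin n => v i.succ) ≠ 0 := by
    intro hc
    have h1 : ∀ i : Fin n, v i.succ = 0 := fun i => congrFun hc i
    simp only [h1, Int.cast_zero, mul_zero, Finset.sum_const_zero, zero_add] at h0
    have h2 : |(v 0 : ℝ)| < 1 := h0.trans_lt ht1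
    have h3 : v 0 = 0 := by
      rw [← Int.cast_abs] at h2
      exact Int.abs_lt_one_iff.1 (by exact_mod_cast h2)
    exact hv (funext fun i => Fin.cases h3 h1 i)
  have hqn : ‖(fun i : Fin n => (v i.succ : ℝ))‖ ≤ C * Real.exp (t / n) := by
    refine (pi_norm_le_iff_of_nonneg (by positivity)).2 fun i => ?_
    have := (norm_le_pi_norm _ i.succ).trans hle
    rw [intCast_vecMul_daniMat_succ, Real.norm_eq_abs, abs_mul, Real.abs_exp, neg_div,
      Real.exp_neg, inv_mul_le_iff₀ (Real.exp_pos _)] at this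
    rw [Real.norm_eq_abs]
    have h2 : Real.exp (-γ * t) ≤ 1 := Real.exp_le_one_iff.2 (by nlinarith)
    calc _ ≤ Real.exp (t / n) * (C * Real.exp (-γ * t)) := this
      _ ≤ Real.exp (t / n) * (C * 1) := by gcongr
      _ = _ := by ring
  have hqpos : 0 < ‖(fun i : Fin n => (v i.succ : ℝ))‖ := by
    rw [norm_pos_iff]
    intro hc
    apply hq
    ext i
    simpa using congrFun hc i
  have hmem : |∑ i, y i * (v i.succ : ℝ) + v 0| ≤
      ‖(fun i : Fin n => (v i.succ : ℝ))‖ ^ (-w) := by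
    refine h0.trans (le_trans ?_ (Real.rpow_le_rpow_of_nonpos hqpos hqn (by
      have : 0 < w := by positivity
      linarith)))
    rw [Real.mul_rpow hC.le (Real.exp_pos _).le, ← Real.exp_mul, Real.rpow_neg hC.le,
      ← div_eq_inv_mul, le_div_iff₀ (by positivity)]
    calc C * Real.exp (-(1 + γ) * t) * C ^ w = C * C ^ w * Real.exp (-(1 + γ) * t) := by ring
      _ ≤ Real.exp (γ / 2 * t) * Real.exp (-(1 + γ) * t) := by gcongr
      _ = Real.exp (t / n * -w) := by
        rw [← Real.exp_add]
        congr 1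
        rw [hw]
        field_simp
        ring
  have h1 := ht3 (fun i => v i.succ) ⟨v 0, hmem⟩ hq
  have h2 := round_le (∑ i, y i * (v i.succ : ℝ)) (-v 0)
  push_cast at h2
  rw [sub_neg_eq_add] at h2
  linarith

theorem finite_setOf_norm_intCast_le (n : ℕ) (R : ℝ) :
    {q : Fin n → ℤ | ‖(fun i => (q i : ℝ))‖ ≤ R}.Finite := by
  refine (Set.finite_Icc (fun _ : Fin n => -⌈R⌉) (fun _ => ⌈R⌉)).subset fun q hq => ?_
  have h : ∀ i, |(q i : ℝ)| ≤ ⌈R⌉ := fun i =>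
    ((norm_le_pi_norm (fun i => (q i : ℝ)) i).trans hq).trans (Int.le_ceil R)
  simp only [abs_le] at h
  exact ⟨fun i => by exact_mod_cast (h i).1, fun i => by exact_mod_cast (h i).2⟩

theorem frequently_of_isVWA {n : ℕ} (hn : 0 < n) {y : Fin n → ℝ} (hy : IsVWA y) :
    ∃ N : ℕ, ∃ᶠ t : ℕ in atTop, ∃ v : Fin (n + 1) → ℤ, v ≠ 0 ∧
      ‖(fun i => (v i : ℝ)) ᵥ* daniMat y t‖ ≤ Real.exp (-(1 / ((N : ℝ) + 1)) * t) := by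
  obtain ⟨w, hw, hinf⟩ := hy
  have hn' : (0 : ℝ) < n := by positivity
  set a := (n + w) / 2 with ha
  have hna : n < a := by rw [ha]; linarith
  have haw : a < w := by rw [ha]; linarith
  have ha0 : 0 < a := hn'.trans hna
  obtain ⟨N, hN⟩ := exists_nat_one_div_lt
    (show 0 < min ((w - a) / a) (1 / n - 1 / a) from lt_min (div_pos (by linarith) ha0)
      (sub_pos.2 (one_div_lt_one_div_of_lt hn' hna)))
  refine ⟨N, ?_⟩
  set γ : ℝ := 1 / ((N : ℝ) + 1) with hγdef
  have hγ : 0 < γ := by positivity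
  have hγ1 : 0 < w - (1 + γ) * a := by
    have := (lt_div_iff₀ ha0).1 (hN.trans_le (min_le_left _ _))
    linarith
  have hγ2 : 1 / a < 1 / n - γ := by
    have := hN.trans_le (min_le_right _ _)
    linarith
  rw [frequently_atTop]
  intro T
  obtain ⟨q, ⟨p, hp⟩, hqR⟩ : ∃ q ∈ {q : Fin n → ℤ | ∃ p : ℤ,
      |(∑ i, y i * (q i : ℝ)) + (p : ℝ)| ≤ ‖(fun i => (q i : ℝ) : Fin n → ℝ)‖ ^ (-w)},
      ¬ ‖(fun i => (q i : ℝ))‖ ≤ Real.exp (max (T / a) ((1 + γ) / (w - (1 + γ) * a))) := by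
    by_contra! hcon
    exact hinf ((finite_setOf_norm_intCast_le n _).subset hcon)
  rw [not_le] at hqR
  have hqpos : 0 < ‖(fun i => (q i : ℝ))‖ := (Real.exp_pos _).trans hqR
  set X := Real.log ‖(fun i => (q i : ℝ))‖ with hX
  have hXlt : max (T / a) ((1 + γ) / (w - (1 + γ) * a)) < X := (Real.lt_log_iff_exp_lt hqpos).2 hqR
  have hX1 : T < a * X := by
    have := (div_lt_iff₀ ha0).1 ((le_max_left _ _).trans_lt hXlt)
    linarith
  have hX2 : 1 + γ < X * (w - (1 + γ) * a) :=
    (div_lt_iff₀ hγ1).1 ((le_max_right _ _).trans_lt hXlt)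
  have hX0 : 0 < X := by
    by_contra! h
    nlinarith
  have hexp : ‖(fun i => (q i : ℝ))‖ = Real.exp X := (Real.exp_log hqpos).symm
  have ht1 := Nat.le_ceil (a * X)
  have ht2 := Nat.ceil_lt_add_one (a := a * X) (by positivity)
  set t := ⌈a * X⌉₊
  refine ⟨t, by exact_mod_cast (hX1.trans_le ht1).le, Fin.cons p q, fun hc => ?_, ?_⟩
  · have : (fun i => (q i : ℝ)) = 0 := by
      ext i
      simpa using congrFun hc i.succ
    rw [this, norm_zero] at hqpos
    exact lt_irrefl _ hqpos
  · refine (pi_norm_le_iff_of_nonneg (Real.exp_pos _).le).2 fun i => ?_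
    refine Fin.cases ?_ (fun i => ?_) i
    · rw [intCast_vecMul_daniMat_zero, Real.norm_eq_abs, abs_mul, Real.abs_exp]
      simp only [Fin.cons_succ, Fin.cons_zero]
      refine (mul_le_mul_of_nonneg_left hp (Real.exp_pos _).le).trans ?_
      rw [hexp, ← Real.exp_mul, ← Real.exp_add]
      refine Real.exp_le_exp.2 ?_
      nlinarith
    · rw [intCast_vecMul_daniMat_succ, Real.norm_eq_abs, abs_mul, Real.abs_exp]
      simp only [Fin.cons_succ]
      refine (mul_le_mul_of_nonneg_left (norm_le_pi_norm (fun i => (q i : ℝ)) i)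
        (Real.exp_pos _).le).trans ?_
      rw [hexp, ← Real.exp_add]
      refine Real.exp_le_exp.2 ?_
      have h3 : X ≤ (1 / n - γ) * t := by
        calc X = 1 / a * (a * X) := by field_simp
          _ ≤ (1 / n - γ) * t := mul_le_mul hγ2.le ht1 (by positivity) (by
              have : 0 < 1 / a := by positivity
              linarith)
      have h4 : -(t : ℝ) / n = -(1 / n * t) := by ring
      rw [h4]
      linarith

end

section

open Matrix Filter

theorem linearIndependent_row_mul {j k : ℕ} {A : Matrix (Fin j) (Fin k) ℝ}
    (hA : LinearIndependent ℝ A.row) {D : Matrix (Fin k) (Fin k) ℝ} (hD : D.det ≠ 0) :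
    LinearIndependent ℝ (A * D).row := by
  have hinj : Function.Injective D.vecMulLinear :=
    vecMul_injective_of_isUnit ((isUnit_iff_isUnit_det D).2 hD.isUnit)
  exact hA.map' D.vecMulLinear (LinearMap.ker_eq_bot.2 hinj)

theorem intCast_vecMul_castMat {j k : ℕ} (m : Fin j → ℤ) (V : Fin j → Fin k → ℤ) :
    (fun i => ((∑ a, m a • V a) i : ℝ)) = (fun a => (m a : ℝ)) ᵥ* castMat V := by
  ext i
  simp [vecMul, dotProduct, castMat]

theorem norm_mulVec_le_maxNormP {s n j : ℕ} (P : Matrix (Fin (s + 1)) (Fin (n + 1)) ℝ)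
    (w : Finset (Fin (n + 1)) → ℝ) {I : Finset (Fin (n + 1))} (hI : I.card = j) (h0 : 0 ∈ I) :
    ‖P.mulVec (cIw w I)‖ ≤ maxNormP P j w :=
  le_ciSup (f := fun I : {I : Finset (Fin (n + 1)) // 0 ∈ I ∧ I.card = j} =>
    ‖P.mulVec (cIw w I.1)‖) (Set.finite_range _).bddAbove ⟨I, h0, hI⟩

theorem abs_le_maxCoeff {n j : ℕ} (w : Finset (Fin (n + 1)) → ℝ) {I : Finset (Fin (n + 1))}
    (hI : I.card = j) (h0 : 0 ∉ I) : |w I| ≤ maxCoeff j w :=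
  le_ciSup (f := fun I : {I : Finset (Fin (n + 1)) // 0 ∉ I ∧ I.card = j} => |w I.1|)
    (Set.finite_range _).bddAbove ⟨I, h0, hI⟩

theorem abs_sum_cons_mul_le {s : ℕ} (x : Fin s → ℝ) (c : Fin (s + 1) → ℝ) :
    |∑ a, (Fin.cons 1 x : Fin (s + 1) → ℝ) a * c a| ≤
      (s + 1) * ‖(Fin.cons 1 x : Fin (s + 1) → ℝ)‖ * ‖c‖ := by
  refine (Finset.abs_sum_le_sum_abs _ _).trans ?_
  refine (Finset.sum_le_card_nsmul _ _
    (‖(Fin.cons 1 x : Fin (s + 1) → ℝ)‖ * ‖c‖) fun a _ => ?_).trans_eq ?_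
  · rw [abs_mul]
    exact mul_le_mul (norm_le_pi_norm (Fin.cons 1 x : Fin (s + 1) → ℝ) a) (norm_le_pi_norm c a)
      (abs_nonneg _) (norm_nonneg _)
  · simp [mul_assoc]

theorem cond36_of_not_isVWA {s n : ℕ} (hn : 0 < n) {P : Matrix (Fin (s + 1)) (Fin (n + 1)) ℝ}
    {x : Fin s → ℝ} {y : Fin n → ℝ} (hxy : Fin.cons 1 y = vecMul (Fin.cons 1 x) P)
    (hy : ¬ IsVWA y) : Cond36 P := by
  by_contra hcon
  apply hy
  have hn' : (0 : ℝ) < n := by positivity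
  simp only [Cond36, not_forall, not_exists, not_and, not_le] at hcon
  obtain ⟨β, hβ, hcon⟩ := hcon
  set K : ℝ := (s + 1) * ‖(Fin.cons 1 x : Fin (s + 1) → ℝ)‖ + 1 with hK
  have hK1 : 1 ≤ K := by rw [hK]; linarith [show 0 ≤
    ((s : ℝ) + 1) * ‖(Fin.cons 1 x : Fin (s + 1) → ℝ)‖ by positivity]
  refine isVWA_of_frequently hn (γ := β / n) (C := n * (K + 1)) (by positivity) ?_
  rw [frequently_atTop]
  intro T
  obtain ⟨t, htT, j, hj1, hjn, w, ⟨V, hV, hVw⟩, hlt⟩ := hcon (max T 1) (by positivity)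
  obtain ⟨h1, h2⟩ := max_lt_iff.1 hlt
  obtain rfl : w = fun I => (minorDet V I : ℝ) := funext hVw
  have ht0 : 0 ≤ t := by linarith [le_max_right T 1]
  have hexp : 0 < Real.exp (-β * t) := Real.exp_pos _
  have hmm : maxMinor (castMat V * daniMat y t) ≤ K * Real.exp (-β * t) := by
    refine maxMinor_daniMat_le hn V y t (by positivity) (fun I hI h0 => ?_) fun I hI h0 => ?_
    · rw [sum_cons_mul_eq hxy]
      calc _ ≤ Real.exp (((n : ℝ) + 1 - j) / n * t) *
            ((s + 1) * ‖(Fin.cons 1 x : Fin (s + 1) → ℝ)‖ *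
              maxNormP P j fun I => (minorDet V I : ℝ)) := by
            gcongr
            refine (abs_sum_cons_mul_le x _).trans ?_
            gcongr
            exact norm_mulVec_le_maxNormP P _ hI h0
        _ = (K - 1) * (Real.exp (((n : ℝ) + 1 - j) / n * t) *
              maxNormP P j fun I => (minorDet V I : ℝ)) := by rw [hK]; ring
        _ ≤ (K - 1) * Real.exp (-β * t) :=
            mul_le_mul_of_nonneg_left h1.le (by linarith)
        _ ≤ K * Real.exp (-β * t) := by gcongr; linarith
    · calc _ ≤ Real.exp (-((j : ℝ) / n) * t) * maxCoeff j fun I => (minorDet V I : ℝ) := by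
            gcongr
            exact abs_le_maxCoeff (fun I => (minorDet V I : ℝ)) hI h0
        _ ≤ 1 * Real.exp (-β * t) := by rw [one_mul]; exact h2.le
        _ ≤ _ := by gcongr
  have hθ : maxMinor (castMat V * daniMat y t) < ((K + 1) * Real.exp (-(β / n) * t)) ^ j := by
    refine hmm.trans_lt ?_
    rw [mul_pow, ← Real.exp_nat_mul]
    have h3 : K < (K + 1) ^ j :=
      (lt_add_one K).trans_le (le_self_pow₀ (by linarith) (by omega))
    have h4 : Real.exp (-β * t) ≤ Real.exp (j * (-(β / n) * t)) := by
      refine Real.exp_le_exp.2 ?_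
      have h5 : (j : ℝ) / n ≤ 1 := (div_le_one hn').2 (by exact_mod_cast hjn)
      have h6 : 0 ≤ β * t := by positivity
      have h7 : (j : ℝ) * (-(β / n) * t) = -(j / n * (β * t)) := by ring
      rw [h7]
      nlinarith
    exact mul_lt_mul h3 h4 hexp (by positivity)
  obtain ⟨m, hm0, hm⟩ := exists_ne_zero_vecMul_norm_le
    (linearIndependent_row_mul (linearIndependent_castMat hV)
      (by rw [det_daniMat hn]; exact one_ne_zero)) (by positivity) hθ
  refine ⟨t, (le_max_left _ _).trans htT, ∑ a, m a • V a, fun h0 => hm0 ?_, ?_⟩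
  · exact funext (Fintype.linearIndependent_iff.1 hV m h0)
  · rw [intCast_vecMul_castMat, vecMul_vecMul]
    refine hm.trans ?_
    rw [← mul_assoc]
    gcongr

end

section

open Matrix Filter Module

/-- The rational vector attached to an integer vector. -/
def ratVec {k : ℕ} (v : Fin k → ℤ) : Fin k → ℚ := fun i => (v i : ℚ)

theorem linearIndependent_ratVec {j k : ℕ} {V : Fin j → Fin k → ℤ} :
    LinearIndependent ℚ (fun a => ratVec (V a)) ↔ LinearIndependent ℤ V := by
  rw [← linearIndependent_algebraMap_comp_iff (R := ℤ) (S := ℚ) (v := V)]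
  have he : (fun a => ratVec (V a)) = fun i => algebraMap ℤ ℚ ∘ V i := by
    ext a i
    simp [ratVec]
  rw [he]

theorem exists_integer_family {k : ℕ} (W : Submodule ℚ (Fin k → ℚ)) :
    ∃ V : Fin (finrank ℚ W) → Fin k → ℤ, LinearIndependent ℤ V ∧ ∀ a, ratVec (V a) ∈ W := by
  have hcl : ∀ w : Fin k → ℚ, ∃ d : ℚˣ, ∃ z : Fin k → ℤ, ratVec z = d • w := fun w => by
    obtain ⟨b, hb⟩ := IsLocalization.exist_integer_multiples_of_finite (nonZeroDivisors ℤ) w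
    choose z hz using hb
    have hb0 : ((b : ℤ) : ℚ) ≠ 0 := by exact_mod_cast nonZeroDivisors.coe_ne_zero b
    refine ⟨Units.mk0 _ hb0, z, ?_⟩
    ext i
    have := hz i
    simp only [eq_intCast, zsmul_eq_mul] at this
    simpa [ratVec, Units.smul_def] using this
  let b := finBasis ℚ W
  choose d z hz using fun a => hcl (b a : Fin k → ℚ)
  refine ⟨z, linearIndependent_ratVec.1 ?_, fun a => ?_⟩
  · have h1 : LinearIndependent ℚ fun a => (b a : Fin k → ℚ) :=
      b.linearIndependent.map' W.subtype (Submodule.ker_subtype W)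
    have h2 := h1.units_smul d
    have : (fun a => ratVec (z a)) = d • fun a => (b a : Fin k → ℚ) := by
      ext1 a
      exact hz a
    rwa [this]
  · rw [hz, Units.smul_def]
    exact W.smul_mem _ (b a).2

theorem exists_mul_castMat_eq {j k : ℕ} {W : Submodule ℚ (Fin k → ℚ)} {V U : Fin j → Fin k → ℤ}
    (hj : j = finrank ℚ W) (hV : LinearIndependent ℤ V) (hVW : ∀ a, ratVec (V a) ∈ W)
    (hUW : ∀ a, ratVec (U a) ∈ W) :
    ∃ R : Matrix (Fin j) (Fin j) ℝ, castMat U = R * castMat V := by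
  have hli : LinearIndependent ℚ fun a => (⟨ratVec (V a), hVW a⟩ : W) :=
    LinearIndependent.of_comp W.subtype (linearIndependent_ratVec.2 hV)
  let b := basisOfLinearIndependentOfCardEqFinrank' _ hli (by simpa using hj)
  have hb : ∀ a, (b a : Fin k → ℚ) = ratVec (V a) := fun a => by simp [b]
  refine ⟨of fun a c => ((b.repr ⟨ratVec (U a), hUW a⟩ c : ℚ) : ℝ), ?_⟩
  ext a i
  have h1 := b.sum_repr ⟨ratVec (U a), hUW a⟩
  have h2 : ∑ c, b.repr ⟨ratVec (U a), hUW a⟩ c * (V c i : ℚ) = (U a i : ℚ) := by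
    have := congrFun (congrArg Subtype.val h1) i
    rw [Submodule.coe_sum, Finset.sum_apply] at this
    simp only [Submodule.coe_smul, hb] at this
    exact this
  have h3 := congrArg (fun x : ℚ => (x : ℝ)) h2
  simp only [mul_apply, castMat, of_apply]
  push_cast at h3
  exact h3.symm

theorem det_castMat_submatrix {j k : ℕ} (V : Fin j → Fin k → ℤ) (c : Fin j → Fin k) :
    ((castMat V).submatrix id c).det = (((of V).submatrix id c).det : ℤ) :=
  (RingHom.map_det (Int.castRingHom ℝ) ((of V).submatrix id c)).symm

/-- Every rational subspace contains an integer family whose wedge product is, up to sign, the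
smallest one among integer families spanning the subspace. -/
theorem exists_minimal_integer_family {k : ℕ} (W : Submodule ℚ (Fin k → ℚ)) :
    ∃ V : Fin (finrank ℚ W) → Fin k → ℤ, (LinearIndependent ℤ V ∧ ∀ a, ratVec (V a) ∈ W) ∧
      ∀ U : Fin (finrank ℚ W) → Fin k → ℤ, LinearIndependent ℤ U → (∀ a, ratVec (U a) ∈ W) →
        ∀ D : Matrix (Fin k) (Fin k) ℝ, maxMinor (castMat V * D) ≤ maxMinor (castMat U * D) := by
  let f : (Fin (finrank ℚ W) → Fin k → ℤ) → ℕ := fun V => ∑ c, ((of V).submatrix id c).det.natAbs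
  let G := {V : Fin (finrank ℚ W) → Fin k → ℤ | LinearIndependent ℤ V ∧ ∀ a, ratVec (V a) ∈ W}
  have hG : G.Nonempty := exists_integer_family W
  obtain ⟨V, hVG, hmin⟩ : ∃ V ∈ G, ∀ U ∈ G, f V ≤ f U :=
    ⟨Function.argminOn f G hG, Function.argminOn_mem f G hG,
      fun U hU => Function.argminOn_le f G hU⟩
  refine ⟨V, hVG, fun U hU hUW D => ?_⟩
  obtain ⟨R, hR⟩ := exists_mul_castMat_eq rfl hVG.1 hVG.2 hUW
  have hf : ∀ V, (f V : ℝ) = ∑ c, |((castMat V).submatrix id c).det| := fun V => by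
    simp only [f, det_castMat_submatrix, Nat.cast_sum, Nat.cast_natAbs, Int.cast_abs]
  have hfR : (f U : ℝ) = |R.det| * f V := by
    rw [hf, hf, Finset.mul_sum]
    refine Finset.sum_congr rfl fun c _ => ?_
    rw [← abs_mul, ← det_mul, hR]
    rfl
  have hpos : (0 : ℝ) < f V := by
    obtain ⟨c, hc⟩ := exists_det_submatrix_ne_zero (linearIndependent_castMat hVG.1)
    rw [hf]
    exact Finset.sum_pos' (fun c _ => abs_nonneg _) ⟨c, Finset.mem_univ _, abs_pos.2 hc⟩
  have hR1 : 1 ≤ |R.det| := by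
    have : (f V : ℝ) ≤ f U := by exact_mod_cast hmin U ⟨hU, hUW⟩
    rw [hfR] at this
    exact (le_mul_iff_one_le_left hpos).1 this
  rw [hR, Matrix.mul_assoc, maxMinor_mul_left]
  exact le_mul_of_one_le_left (maxMinor_nonneg _) hR1

/-- A minimal integer family spanning the rational subspace `W`. -/
noncomputable def minFamily {k : ℕ} (W : Submodule ℚ (Fin k → ℚ)) :
    Fin (finrank ℚ W) → Fin k → ℤ := (exists_minimal_integer_family W).choose

theorem linearIndependent_minFamily {k : ℕ} (W : Submodule ℚ (Fin k → ℚ)) :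
    LinearIndependent ℤ (minFamily W) := (exists_minimal_integer_family W).choose_spec.1.1

theorem ratVec_minFamily_mem {k : ℕ} (W : Submodule ℚ (Fin k → ℚ)) (a : Fin (finrank ℚ W)) :
    ratVec (minFamily W a) ∈ W := (exists_minimal_integer_family W).choose_spec.1.2 a

/-- The covolume (in the sup norm) of the image under `D` of the integer points of `W`. -/
noncomputable def covol {k : ℕ} (D : Matrix (Fin k) (Fin k) ℝ) (W : Submodule ℚ (Fin k → ℚ)) : ℝ :=
  maxMinor (castMat (minFamily W) * D)

theorem covol_le {j k : ℕ} (D : Matrix (Fin k) (Fin k) ℝ) {W : Submodule ℚ (Fin k → ℚ)}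
    (hj : j = finrank ℚ W) {U : Fin j → Fin k → ℤ} (hU : LinearIndependent ℤ U)
    (hUW : ∀ a, ratVec (U a) ∈ W) : covol D W ≤ maxMinor (castMat U * D) := by
  subst hj
  exact (exists_minimal_integer_family W).choose_spec.2 U hU hUW D

theorem covol_bot {k : ℕ} (D : Matrix (Fin k) (Fin k) ℝ) : covol D ⊥ = 1 := by
  have h : ∀ (j : ℕ) (A : Matrix (Fin j) (Fin k) ℝ), j = 0 → maxMinor A = 1 := by
    rintro j A rfl
    simp [maxMinor]
  exact h _ _ (finrank_bot ℚ _)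

theorem covol_sup_span_le {k : ℕ} (D : Matrix (Fin k) (Fin k) ℝ) {W : Submodule ℚ (Fin k → ℚ)}
    {v : Fin k → ℤ} (hv : ratVec v ∉ W) :
    covol D (W ⊔ Submodule.span ℚ {ratVec v}) ≤
      (finrank ℚ W + 1) * ‖(fun i => (v i : ℝ)) ᵥ* D‖ * covol D W := by
  have hU : LinearIndependent ℤ (Fin.cons v (minFamily W) : Fin (finrank ℚ W + 1) → Fin k → ℤ) := by
    rw [← linearIndependent_ratVec]
    have he : (fun a => ratVec ((Fin.cons v (minFamily W) : Fin (finrank ℚ W + 1) → _) a)) =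
        Fin.cons (ratVec v) fun a => ratVec (minFamily W a) := by
      ext1 a
      cases a using Fin.cases <;> rfl
    rw [he]
    refine (linearIndependent_ratVec.2 (linearIndependent_minFamily W)).finCons fun h => hv ?_
    exact Submodule.span_le.2 (Set.range_subset_iff.2 (ratVec_minFamily_mem W)) h
  have hW : finrank ℚ W + 1 = finrank ℚ (W ⊔ Submodule.span ℚ {ratVec v} : Submodule ℚ _) :=
    (Submodule.finrank_sup_span_singleton hv).symm
  refine (covol_le D hW hU fun a => ?_).trans ?_
  · cases a using Fin.cases with
    | zero => exact Submodule.mem_sup_right (Submodule.mem_span_singleton_self _)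
    | succ a => exact Submodule.mem_sup_left (ratVec_minFamily_mem W a)
  · have he : castMat (Fin.cons v (minFamily W) : Fin (finrank ℚ W + 1) → Fin k → ℤ) * D =
        of (Fin.cons ((fun i => (v i : ℝ)) ᵥ* D) (castMat (minFamily W) * D)) := by
      ext a i
      cases a using Fin.cases <;> rfl
    rw [he]
    exact maxMinor_cons_le _ _

end

section

open Matrix Filter Module

theorem card_le_of_pairwise_comparable {k : ℕ} (T : Finset (Submodule ℚ (Fin k → ℚ)))
    (hT : ∀ W ∈ T, ∀ W' ∈ T, W ≤ W' ∨ W' ≤ W) : T.card ≤ k + 1 := by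
  have hinj : Set.InjOn (fun W : Submodule ℚ (Fin k → ℚ) => finrank ℚ W) T := by
    intro W hW W' hW' h
    rcases hT W hW W' hW' with hle | hle
    · exact Submodule.eq_of_le_of_finrank_eq hle h
    · exact (Submodule.eq_of_le_of_finrank_eq hle h.symm).symm
  have hmaps : Set.MapsTo (fun W : Submodule ℚ (Fin k → ℚ) => finrank ℚ W) T
      (Finset.range (k + 1)) := fun W _ => by
    have := Submodule.finrank_le W
    simp only [finrank_fintype_fun_eq_card, Fintype.card_fin] at this
    simpa [Nat.lt_succ_iff] using this
  simpa using Finset.card_le_card_of_injOn _ hmaps hinj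

/-- A point at which some flag of rational subspaces is marked has no short integer vectors. -/
theorem le_norm_vecMul_of_marked {k : ℕ} {S : Finset (Submodule ℚ (Fin k → ℚ))} {v : Fin k → ℤ}
    (hv : v ≠ 0) (hbot : ⊥ ∈ S) (hS : ∀ W ∈ S, W ⊔ Submodule.span ℚ {ratVec v} ∈ S)
    {D : ℝ → Matrix (Fin k) (Fin k) ℝ} {ε ρ τ : ℝ} (hερ : ε ≤ ρ) (hρ : ρ ≤ 1)
    (h : Marked (fun W W' => W ≤ W' ∨ W' ≤ W) S (fun W x => covol (D x) W) ε ρ τ) :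
    ε ≤ k * ‖(fun i => (v i : ℝ)) ᵥ* D τ‖ := by
  classical
  obtain ⟨F, hFS, hF, hmark, hrest⟩ := h
  have hv0 : ratVec v ∉ (⊥ : Submodule ℚ (Fin k → ℚ)) := by
    rw [Submodule.mem_bot]
    intro h0
    refine hv (funext fun i => ?_)
    have := congrFun h0 i
    simpa [ratVec] using this
  let F' := (insert ⊥ F).filter fun W => ratVec v ∉ W
  have hF'ne : F'.Nonempty := ⟨⊥, by simpa [F'] using hv0⟩
  obtain ⟨W₀, hW₀, hmax⟩ := F'.exists_maximal hF'ne
  obtain ⟨hW₀F, hvW₀⟩ := Finset.mem_filter.1 hW₀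
  have hcomp : ∀ W ∈ F, W₀ ≤ W ∨ W ≤ W₀ := fun W hW => by
    rcases Finset.mem_insert.1 hW₀F with rfl | h0
    · exact Or.inl bot_le
    · exact hF _ h0 _ hW
  have hW₀S : W₀ ∈ S := by
    rcases Finset.mem_insert.1 hW₀F with rfl | h0
    exacts [hbot, hFS h0]
  set W₁ := W₀ ⊔ Submodule.span ℚ {ratVec v} with hW₁
  have hcomp₁ : ∀ W ∈ F, W₁ ≤ W ∨ W ≤ W₁ := fun W hW => by
    by_cases hvW : ratVec v ∈ W
    · rcases hcomp W hW with h | h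
      · exact Or.inl (sup_le h ((Submodule.span_singleton_le_iff_mem _ _).2 hvW))
      · exact absurd (h hvW) hvW₀
    · have hWF' : W ∈ F' := Finset.mem_filter.2 ⟨Finset.mem_insert_of_mem hW, hvW⟩
      rcases hcomp W hW with h | h
      · exact Or.inr ((hmax hWF' h).trans le_sup_left)
      · exact Or.inr (h.trans le_sup_left)
  have h1 : ε ≤ covol (D τ) W₁ := by
    by_cases h : W₁ ∈ F
    · exact (hmark _ h).1
    · exact hερ.trans (hrest _ (hS _ hW₀S) h hcomp₁)
  have h0 : covol (D τ) W₀ ≤ 1 := by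
    rcases Finset.mem_insert.1 hW₀F with rfl | h0
    · exact (covol_bot _).le
    · exact (hmark _ h0).2.trans hρ
  have hrank : (finrank ℚ W₀ + 1 : ℝ) ≤ k := by
    have h2 := Submodule.finrank_le W₁
    rw [hW₁, Submodule.finrank_sup_span_singleton hvW₀, finrank_fintype_fun_eq_card,
      Fintype.card_fin] at h2
    exact_mod_cast h2
  calc ε ≤ covol (D τ) W₁ := h1
    _ ≤ (finrank ℚ W₀ + 1) * ‖(fun i => (v i : ℝ)) ᵥ* D τ‖ * covol (D τ) W₀ :=
      covol_sup_span_le _ hvW₀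
    _ ≤ (finrank ℚ W₀ + 1) * ‖(fun i => (v i : ℝ)) ᵥ* D τ‖ * 1 := by gcongr
    _ ≤ k * ‖(fun i => (v i : ℝ)) ᵥ* D τ‖ := by rw [mul_one]; gcongr

/-- Every finite set of integer vectors has a finite set of rational subspaces containing `⊥`
which is stable under adding the span of one of these vectors. -/
theorem exists_finset_submodule {k : ℕ} {A : Set (Fin k → ℤ)} (hA : A.Finite) :
    ∃ S : Finset (Submodule ℚ (Fin k → ℚ)), ⊥ ∈ S ∧
      ∀ v ∈ A, ∀ W ∈ S, W ⊔ Submodule.span ℚ {ratVec v} ∈ S := by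
  classical
  refine ⟨hA.toFinset.powerset.image fun B : Finset (Fin k → ℤ) =>
    Submodule.span ℚ (ratVec '' (B : Set (Fin k → ℤ))),
    ?_, fun v hv W hW => ?_⟩
  · exact Finset.mem_image.2 ⟨∅, by simp, by simp⟩
  · obtain ⟨B, hB, rfl⟩ := Finset.mem_image.1 hW
    refine Finset.mem_image.2 ⟨insert v B, ?_, ?_⟩
    · rw [Finset.mem_powerset] at hB ⊢
      exact Finset.insert_subset (hA.mem_toFinset.2 hv) hB
    · rw [Finset.coe_insert, Set.image_insert_eq, Set.insert_eq, Set.union_comm,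
        Submodule.span_union]

end

section

open Matrix Filter Set Topology

theorem iteratedDeriv_dotProduct {m k : ℕ} {V : Set ℝ} (hV : IsOpen V) {g : ℝ → Fin m → ℝ}
    (hg : ContDiffOn ℝ (⊤ : ℕ∞) g V) (a : Fin m → ℝ) {τ : ℝ} (hτ : τ ∈ V) :
    iteratedDeriv k (fun τ => a ⬝ᵥ g τ) τ = a ⬝ᵥ iteratedDeriv k g τ := by
  let Λ : (Fin m → ℝ) →L[ℝ] ℝ := LinearMap.toContinuousLinearMap (dotProductBilin ℝ ℝ a)
  have h := Λ.iteratedFDeriv_comp_left (i := k) (hg.contDiffAt (hV.mem_nhds hτ))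
    (by exact_mod_cast le_top)
  rw [iteratedDeriv_eq_iteratedFDeriv, iteratedDeriv_eq_iteratedFDeriv]
  exact congrArg (fun T => T fun _ => (1 : ℝ)) h

theorem continuousOn_iteratedDeriv {F : Type*} [NormedAddCommGroup F] [NormedSpace ℝ F]
    {V : Set ℝ} (hV : IsOpen V) {g : ℝ → F} (hg : ContDiffOn ℝ (⊤ : ℕ∞) g V) (k : ℕ) :
    ContinuousOn (iteratedDeriv k g) V :=
  (hg.continuousOn_iteratedDerivWithin (by exact_mod_cast le_top) hV.uniqueDiffOn).congr
    fun _ hx => (iteratedDerivWithin_of_isOpen hV hx).symm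

theorem abs_dotProduct_le {m : ℕ} (a w : Fin m → ℝ) : |a ⬝ᵥ w| ≤ m * ‖a‖ * ‖w‖ := by
  refine (Finset.abs_sum_le_sum_abs _ _).trans ?_
  refine (Finset.sum_le_card_nsmul _ _ (‖a‖ * ‖w‖) fun i _ => ?_).trans_eq ?_
  · rw [abs_mul]
    exact mul_le_mul (norm_le_pi_norm a i) (norm_le_pi_norm w i) (abs_nonneg _) (norm_nonneg _)
  · simp [mul_assoc]

theorem exists_sphere_smul {m : ℕ} {a : Fin m → ℝ} (ha : a ≠ 0) :
    ∃ u ∈ Metric.sphere (0 : Fin m → ℝ) 1, a = ‖a‖ • u := by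
  have h : ‖a‖ ≠ 0 := norm_ne_zero_iff.2 ha
  exact ⟨‖a‖⁻¹ • a, by simp [norm_smul, h], by rw [smul_smul, mul_inv_cancel₀ h, one_smul]⟩

theorem exists_uniform_derivative_bound {m : ℕ} {V : Set ℝ} (hV : IsOpen V) (h0 : (0 : ℝ) ∈ V)
    {g : ℝ → Fin m → ℝ} (hg : ContDiffOn ℝ (⊤ : ℕ∞) g V)
    (hnf : ∀ a ≠ 0, ∃ k, iteratedDeriv k (fun τ => a ⬝ᵥ g τ) 0 ≠ 0) :
    ∃ (l : ℕ) (A r : ℝ), 0 < A ∧ 0 < r ∧ ∀ a ∈ Metric.sphere (0 : Fin m → ℝ) 1,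
      ∃ k ≤ l, ∀ τ ∈ Ioo (-r) r, A ≤ |a ⬝ᵥ iteratedDeriv k g τ| := by
  refine (isCompact_sphere (0 : Fin m → ℝ) 1).induction_on (p := fun S => ∃ (l : ℕ) (A r : ℝ),
    0 < A ∧ 0 < r ∧ ∀ a ∈ S, ∃ k ≤ l, ∀ τ ∈ Ioo (-r) r, A ≤ |a ⬝ᵥ iteratedDeriv k g τ|) ?_ ?_ ?_ ?_
  · exact ⟨0, 1, 1, one_pos, one_pos, by simp⟩
  · rintro S T hST ⟨l, A, r, hA, hr, h⟩
    exact ⟨l, A, r, hA, hr, fun a ha => h a (hST ha)⟩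
  · rintro S T ⟨l, A, r, hA, hr, h⟩ ⟨l', A', r', hA', hr', h'⟩
    refine ⟨max l l', min A A', min r r', lt_min hA hA', lt_min hr hr', ?_⟩
    rintro a (ha | ha)
    · obtain ⟨k, hk, hb⟩ := h a ha
      refine ⟨k, le_max_of_le_left hk, fun τ hτ => (min_le_left _ _).trans (hb τ ⟨?_, ?_⟩)⟩
      · linarith [hτ.1, min_le_left r r']
      · linarith [hτ.2, min_le_left r r']
    · obtain ⟨k, hk, hb⟩ := h' a ha
      refine ⟨k, le_max_of_le_right hk, fun τ hτ => (min_le_right _ _).trans (hb τ ⟨?_, ?_⟩)⟩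
      · linarith [hτ.1, min_le_right r r']
      · linarith [hτ.2, min_le_right r r']
  · intro a ha
    obtain ⟨k, hk⟩ := hnf a (ne_zero_of_mem_unit_sphere ⟨a, ha⟩)
    rw [iteratedDeriv_dotProduct hV hg a h0] at hk
    have hc : ContinuousAt (fun z : (Fin m → ℝ) × ℝ => |z.1 ⬝ᵥ iteratedDeriv k g z.2|) (a, 0) := by
      have h1 : ContinuousAt (iteratedDeriv k g) 0 :=
        (continuousOn_iteratedDeriv hV hg k).continuousAt (hV.mem_nhds h0)
      have h2 : ContinuousAt (fun z : (Fin m → ℝ) × ℝ => iteratedDeriv k g z.2) (a, 0) :=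
        ContinuousAt.comp' (f := fun z : (Fin m → ℝ) × ℝ => z.2) (x := (a, 0)) h1 continuousAt_snd
      refine ContinuousAt.abs (tendsto_finsetSum _ fun i _ => ?_)
      exact (((continuous_apply i).comp continuous_fst).continuousAt).mul
        ((continuous_apply i).continuousAt.comp h2)
    have hpos := abs_pos.2 hk
    have hev : ∀ᶠ z : (Fin m → ℝ) × ℝ in 𝓝 (a, 0),
        |a ⬝ᵥ iteratedDeriv k g 0| / 2 < |z.1 ⬝ᵥ iteratedDeriv k g z.2| :=
      hc.eventually_const_lt (half_lt_self hpos)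
    rw [nhds_prod_eq] at hev
    obtain ⟨pa, hpa, pb, hpb, hab⟩ := eventually_prod_iff.1 hev
    obtain ⟨r, hr, hball⟩ := Metric.eventually_nhds_iff_ball.1 hpb
    refine ⟨{b | pa b}, mem_nhdsWithin_of_mem_nhds hpa, k, _, r, half_pos hpos, hr,
      fun b hb => ⟨k, le_rfl, fun τ hτ => (hab hb (hball τ ?_)).le⟩⟩
    rwa [Real.ball_eq_Ioo, zero_sub, zero_add]

theorem exists_uniform_sup_bound {m : ℕ} {r : ℝ} (hr : 0 < r) {g : ℝ → Fin m → ℝ}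
    (hnf : ∀ a ≠ 0, ∃ k, iteratedDeriv k (fun τ => a ⬝ᵥ g τ) 0 ≠ 0) :
    ∃ κ > 0, ∀ a ∈ Metric.sphere (0 : Fin m → ℝ) 1, ∃ x ∈ Icc (-r) r, κ ≤ |a ⬝ᵥ g x| := by
  refine (isCompact_sphere (0 : Fin m → ℝ) 1).induction_on
    (p := fun S => ∃ κ > 0, ∀ a ∈ S, ∃ x ∈ Icc (-r) r, κ ≤ |a ⬝ᵥ g x|) ?_ ?_ ?_ ?_
  · exact ⟨1, one_pos, by simp⟩
  · rintro S T hST ⟨κ, hκ, h⟩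
    exact ⟨κ, hκ, fun a ha => h a (hST ha)⟩
  · rintro S T ⟨κ, hκ, h⟩ ⟨κ', hκ', h'⟩
    refine ⟨min κ κ', lt_min hκ hκ', ?_⟩
    rintro a (ha | ha)
    · obtain ⟨x, hx, hb⟩ := h a ha
      exact ⟨x, hx, (min_le_left _ _).trans hb⟩
    · obtain ⟨x, hx, hb⟩ := h' a ha
      exact ⟨x, hx, (min_le_right _ _).trans hb⟩
  · intro a ha
    obtain ⟨k, hk⟩ := hnf a (ne_zero_of_mem_unit_sphere ⟨a, ha⟩)
    obtain ⟨x, hx, hne⟩ : ∃ x ∈ Icc (-r) r, a ⬝ᵥ g x ≠ 0 := by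
      by_contra! hcon
      refine hk ?_
      have : (fun τ => a ⬝ᵥ g τ) =ᶠ[𝓝 0] fun _ => 0 := by
        filter_upwards [Icc_mem_nhds (neg_lt_zero.2 hr) hr] with τ hτ using hcon τ hτ
      rw [this.iteratedDeriv_eq]
      simp
    have hpos := abs_pos.2 hne
    have hc : Continuous fun b : Fin m → ℝ => |b ⬝ᵥ g x| := by fun_prop
    refine ⟨{b | |a ⬝ᵥ g x| / 2 < |b ⬝ᵥ g x|}, mem_nhdsWithin_of_mem_nhds
      (hc.continuousAt.eventually_const_lt (half_lt_self hpos)), _, half_pos hpos,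
      fun b hb => ⟨x, hx, le_of_lt hb⟩⟩

/-- Linear combinations of the components of a smooth curve, none of which is flat at `0`, are
uniformly good near `0`. -/
theorem exists_uniform_good {m : ℕ} {V : Set ℝ} (hV : IsOpen V) (h0 : (0 : ℝ) ∈ V)
    {g : ℝ → Fin m → ℝ} (hg : ContDiffOn ℝ (⊤ : ℕ∞) g V)
    (hnf : ∀ a ≠ 0, ∃ k, iteratedDeriv k (fun τ => a ⬝ᵥ g τ) 0 ≠ 0) :
    ∃ r > 0, Icc (-r) r ⊆ V ∧ ∃ (N : ℕ) (C κ : ℝ), 0 < N ∧ 0 < C ∧ 0 < κ ∧ ∀ a : Fin m → ℝ,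
      (∃ x ∈ Icc (-r) r, κ * ‖a‖ ≤ |a ⬝ᵥ g x|) ∧
      ∀ p q ε x, -r ≤ p → p ≤ q → q ≤ r → 0 < ε → x ∈ Icc p q →
        |a ⬝ᵥ g x| * (volume.real {y ∈ Icc p q | |a ⬝ᵥ g y| < ε}) ^ N ≤ C * ε * (q - p) ^ N := by
  obtain ⟨l, A, r₁, hA, hr₁, hlow⟩ := exists_uniform_derivative_bound hV h0 hg hnf
  obtain ⟨r₂, hr₂, hball⟩ := Metric.isOpen_iff.1 hV 0 h0
  rw [Real.ball_eq_Ioo, zero_sub, zero_add] at hball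
  set r := min r₁ r₂ / 2 with hr
  have hrpos : 0 < r := half_pos (lt_min hr₁ hr₂)
  have hr1 : r < r₁ := by linarith [min_le_left r₁ r₂]
  have hr2 : r < r₂ := by linarith [min_le_right r₁ r₂]
  have hrV : Icc (-r) r ⊆ V := fun x hx => hball ⟨by linarith [hx.1], by linarith [hx.2]⟩
  have hB : ∀ k : ℕ, ∃ B, ∀ x ∈ Icc (-r) r, ‖iteratedDeriv k g x‖ ≤ B := fun k =>
    isCompact_Icc.exists_bound_of_continuousOn ((continuousOn_iteratedDeriv hV hg k).mono hrV)
  choose B hB using hB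
  have hr0 : (0 : ℝ) ∈ Icc (-r) r := ⟨by linarith, hrpos.le⟩
  have hB0 : ∀ k, 0 ≤ B k := fun k => (norm_nonneg _).trans (hB k 0 hr0)
  set M := ∑ k ∈ Finset.range (l + 1), B k with hM
  have hM0 : 0 ≤ M := Finset.sum_nonneg fun k _ => hB0 k
  have hr4 : 0 < r / 2 := half_pos hrpos
  have hIcc : Icc (-(r / 2)) (r / 2) ⊆ Ioo (-r) r := fun x hx =>
    ⟨by linarith [hx.1], by linarith [hx.2]⟩
  obtain ⟨κ, hκ, hsup⟩ := exists_uniform_sup_bound hr4 hnf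
  set C : ℝ := (2 * (l + 1)) ^ (2 * l + 1) * (l + 1) * (1 + m * M / A) with hC
  have hC0 : 0 < C := by positivity
  refine ⟨r / 2, hr4, hIcc.trans (Ioo_subset_Icc_self.trans hrV), 2 * l + 1, C, κ, by omega, hC0,
    hκ, fun a => ?_⟩
  rcases eq_or_ne a 0 with rfl | ha
  · refine ⟨⟨0, ⟨by linarith, hr4.le⟩, by simp⟩, fun p q ε x hp hpq hq hε hx => ?_⟩
    have : 0 ≤ q - p := by linarith
    simp only [zero_dotProduct, abs_zero, zero_mul]
    positivity
  obtain ⟨u, hu, hau⟩ := exists_sphere_smul ha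
  have hnorm : 0 < ‖a‖ := norm_pos_iff.2 ha
  have habs : ∀ w : Fin m → ℝ, |a ⬝ᵥ w| = ‖a‖ * |u ⬝ᵥ w| := fun w => by
    conv_lhs => rw [hau]
    rw [smul_dotProduct, smul_eq_mul, abs_mul, abs_norm]
  refine ⟨?_, fun p q ε x hp hpq hq hε hx => ?_⟩
  · obtain ⟨x, hx, h⟩ := hsup u hu
    refine ⟨x, hx, ?_⟩
    rw [habs, mul_comm]
    gcongr
  · obtain ⟨k, hkl, hk⟩ := hlow u hu
    have hVr : Ioo (-r) r ⊆ V := Ioo_subset_Icc_self.trans hrV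
    have hder : ∀ x ∈ Ioo (-r) r, |iteratedDeriv k (fun τ => a ⬝ᵥ g τ) x| =
        ‖a‖ * |u ⬝ᵥ iteratedDeriv k g x| := fun x hx => by
      rw [iteratedDeriv_dotProduct hV hg a (hVr hx), habs]
    have hsm : ContDiffOn ℝ k (fun τ => a ⬝ᵥ g τ) (Ioo (-r) r) := by
      have h1 : ContDiffOn ℝ k g (Ioo (-r) r) := (hg.mono hVr).of_le (by exact_mod_cast le_top)
      unfold dotProduct
      exact ContDiffOn.sum fun i _ => contDiffOn_const.mul (contDiffOn_pi.1 h1 i)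
    have hmain := pow_measure_sublevel_le (k := k) (N := 2 * l + 1) isOpen_Ioo ordConnected_Ioo
      (by omega) (by omega) hsm (A := ‖a‖ * A) (B := ‖a‖ * (m * M)) (by positivity)
      (fun x hx => ?_) (fun x hx => ?_) hpq
      (fun y hy => ⟨by linarith [hy.1], by linarith [hy.2]⟩) hε hx
    · refine hmain.trans ?_
      rw [mul_div_mul_left _ _ hnorm.ne', hC]
      have : 0 ≤ q - p := by linarith
      have hkl' : (k : ℝ) ≤ l := by exact_mod_cast hkl
      gcongr
    · rw [hder x hx]
      gcongr
      exact hk x ⟨by linarith [hx.1], by linarith [hx.2]⟩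
    · rw [hder x hx]
      have hu1 : ‖u‖ = 1 := by simpa using hu
      have h1 := abs_dotProduct_le u (iteratedDeriv k g x)
      rw [hu1, mul_one] at h1
      have h2 : ‖iteratedDeriv k g x‖ ≤ M := (hB k x (Ioo_subset_Icc_self hx)).trans
        (Finset.single_le_sum (fun k _ => hB0 k) (Finset.mem_range.2 (by omega)))
      gcongr
      exact h1.trans (by gcongr)

end

section

open Matrix Filter Set Topology Module

theorem det_castMat_mul_daniMat_eq_dotProduct_of_mem {j n s : ℕ} (hn : 0 < n)
    {P : Matrix (Fin (s + 1)) (Fin (n + 1)) ℝ} (V : Fin j → Fin (n + 1) → ℤ) (t : ℝ)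
    {I : Finset (Fin (n + 1))} (hI : I.card = j) (h0 : 0 ∈ I) {x : Fin s → ℝ} {y : Fin n → ℝ}
    (hxy : (Fin.cons 1 y : Fin (n + 1) → ℝ) = vecMul (Fin.cons 1 x) P) :
    ((castMat V * daniMat y t).submatrix id (I.orderEmbOfFin hI)).det =
      (Real.exp (((n : ℝ) + 1 - j) / n * t) • P.mulVec (cIw (fun I => (minorDet V I : ℝ)) I)) ⬝ᵥ
        (Fin.cons 1 x : Fin (s + 1) → ℝ) := by
  rw [det_castMat_mul_daniMat_of_mem hn V y t I hI h0, sum_cons_mul_eq hxy, smul_dotProduct,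
    dotProduct_comm]
  rfl

theorem det_castMat_mul_daniMat_eq_dotProduct_of_notMem {j n s : ℕ} (V : Fin j → Fin (n + 1) → ℤ)
    (t : ℝ) {I : Finset (Fin (n + 1))} (hI : I.card = j) (h0 : 0 ∉ I) (x : Fin s → ℝ)
    (y : Fin n → ℝ) :
    ((castMat V * daniMat y t).submatrix id (I.orderEmbOfFin hI)).det =
      Pi.single 0 (Real.exp (-((j : ℝ) / n) * t) * minorDet V I) ⬝ᵥ
        (Fin.cons 1 x : Fin (s + 1) → ℝ) := by
  rw [det_castMat_mul_daniMat_of_notMem V y t I hI h0, single_dotProduct, Fin.cons_zero, mul_one]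

theorem exists_maxMinor_eq {j k : ℕ} {A : Matrix (Fin j) (Fin k) ℝ} (hA : 0 < maxMinor A) :
    ∃ (I : Finset (Fin k)) (hI : I.card = j),
      maxMinor A = |(A.submatrix id (I.orderEmbOfFin hI)).det| := by
  by_contra! hcon
  have h : ∀ (I : Finset (Fin k)) (hI : I.card = j),
      |(A.submatrix id (I.orderEmbOfFin hI)).det| < maxMinor A := fun I hI =>
    (abs_det_le_maxMinor A _).lt_of_ne (hcon I hI).symm
  refine lt_irrefl (maxMinor A) ((pi_norm_lt_iff hA).2 fun c => ?_)
  rw [Real.norm_eq_abs]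
  rcases abs_det_submatrix_eq A c with h0 | ⟨I, hI, h1⟩
  · rwa [h0, abs_zero]
  · rw [h1]
    exact h I hI

/-- The covolumes of a lattice moving along a curve in an affine subspace are, near each point
where they are positive, bounded below by a linear combination of the curve's coordinates. -/
theorem exists_dotProduct_le_covol {n s : ℕ} (hn : 0 < n)
    {P : Matrix (Fin (s + 1)) (Fin (n + 1)) ℝ} (W : Submodule ℚ (Fin (n + 1) → ℚ)) (t : ℝ)
    {x : Fin s → ℝ} {y : Fin n → ℝ}
    (hxy : (Fin.cons 1 y : Fin (n + 1) → ℝ) = vecMul (Fin.cons 1 x) P)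
    (hpos : 0 < covol (daniMat y t) W) :
    ∃ a : Fin (s + 1) → ℝ, covol (daniMat y t) W = |a ⬝ᵥ (Fin.cons 1 x : Fin (s + 1) → ℝ)| ∧
      ∀ (x' : Fin s → ℝ) (y' : Fin n → ℝ),
        (Fin.cons 1 y' : Fin (n + 1) → ℝ) = vecMul (Fin.cons 1 x') P →
        |a ⬝ᵥ (Fin.cons 1 x' : Fin (s + 1) → ℝ)| ≤ covol (daniMat y' t) W := by
  obtain ⟨I, hI, h⟩ := exists_maxMinor_eq hpos
  have key : ∃ a : Fin (s + 1) → ℝ, ∀ (x' : Fin s → ℝ) (y' : Fin n → ℝ),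
      (Fin.cons 1 y' : Fin (n + 1) → ℝ) = vecMul (Fin.cons 1 x') P →
      ((castMat (minFamily W) * daniMat y' t).submatrix id (I.orderEmbOfFin hI)).det =
        a ⬝ᵥ (Fin.cons 1 x' : Fin (s + 1) → ℝ) := by
    by_cases h0 : 0 ∈ I
    · exact ⟨_, fun x' y' h' => det_castMat_mul_daniMat_eq_dotProduct_of_mem hn _ t hI h0 h'⟩
    · exact ⟨_, fun x' y' _ => det_castMat_mul_daniMat_eq_dotProduct_of_notMem _ t hI h0 x' y'⟩
  obtain ⟨a, ha⟩ := key
  refine ⟨a, ?_, fun x' y' h' => ?_⟩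
  · rw [← ha x y hxy]
    exact h
  · rw [← ha x' y' h']
    exact abs_det_le_maxMinor _ _

theorem one_le_covol_of_finrank_eq {k : ℕ} {D : Matrix (Fin k) (Fin k) ℝ} (hD : D.det = 1)
    {W : Submodule ℚ (Fin k → ℚ)} (hW : finrank ℚ W = k) : 1 ≤ covol D W := by
  have key : ∀ (j : ℕ) (V : Fin j → Fin k → ℤ), j = k → LinearIndependent ℤ V →
      1 ≤ maxMinor (castMat V * D) := by
    rintro j V rfl hV
    refine le_trans ?_ (abs_det_le_maxMinor _ id)
    rw [submatrix_id_id, det_mul, hD, mul_one]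
    have h := det_castMat_submatrix V id
    rw [submatrix_id_id, submatrix_id_id] at h
    have hne : (castMat V).det ≠ 0 := by
      have := linearIndependent_castMat hV
      rw [linearIndependent_rows_iff_isUnit, isUnit_iff_isUnit_det] at this
      exact this.ne_zero
    rw [h] at hne ⊢
    exact_mod_cast Int.one_le_abs (by exact_mod_cast hne)
  exact key _ _ hW (linearIndependent_minFamily W)

theorem exists_dotProduct_le_covol_of_cond36 {n s : ℕ} (hn : 0 < n)
    {P : Matrix (Fin (s + 1)) (Fin (n + 1)) ℝ} {t b : ℝ} (hb : 0 < b)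
    {W : Submodule ℚ (Fin (n + 1) → ℚ)}
    (hW : b ≤ max (Real.exp ((((n : ℝ) + 1 - (finrank ℚ W : ℝ)) / (n : ℝ)) * t) *
        maxNormP P (finrank ℚ W) (fun I => (minorDet (minFamily W) I : ℝ)))
      (Real.exp (-((finrank ℚ W : ℝ) / (n : ℝ)) * t) *
        maxCoeff (finrank ℚ W) (fun I => (minorDet (minFamily W) I : ℝ)))) :
    ∃ a : Fin (s + 1) → ℝ, b ≤ ‖a‖ ∧ ∀ (x : Fin s → ℝ) (y : Fin n → ℝ),
        (Fin.cons 1 y : Fin (n + 1) → ℝ) = vecMul (Fin.cons 1 x) P →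
        |a ⬝ᵥ (Fin.cons 1 x : Fin (s + 1) → ℝ)| ≤ covol (daniMat y t) W := by
  rcases le_max_iff.1 hW with h | h
  · rcases isEmpty_or_nonempty
      {I : Finset (Fin (n + 1)) // 0 ∈ I ∧ I.card = finrank ℚ W} with he | he
    · rw [maxNormP, Real.iSup_of_isEmpty, mul_zero] at h
      exact absurd h hb.not_ge
    · obtain ⟨⟨I, h0, hI⟩, hmax⟩ := exists_eq_ciSup_of_finite
        (f := fun I : {I : Finset (Fin (n + 1)) // 0 ∈ I ∧ I.card = finrank ℚ W} =>
          ‖P.mulVec (cIw (fun I => (minorDet (minFamily W) I : ℝ)) I.1)‖)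
      rw [maxNormP, ← hmax] at h
      refine ⟨Real.exp (((n : ℝ) + 1 - finrank ℚ W) / n * t) •
        P.mulVec (cIw (fun I => (minorDet (minFamily W) I : ℝ)) I), ?_, fun x y hxy => ?_⟩
      · rw [norm_smul, Real.norm_eq_abs, Real.abs_exp]
        exact h
      · rw [← det_castMat_mul_daniMat_eq_dotProduct_of_mem hn (minFamily W) t hI h0 hxy]
        exact abs_det_le_maxMinor _ _
  · rcases isEmpty_or_nonempty
      {I : Finset (Fin (n + 1)) // 0 ∉ I ∧ I.card = finrank ℚ W} with he | he
    · rw [maxCoeff, Real.iSup_of_isEmpty, mul_zero] at h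
      exact absurd h hb.not_ge
    · obtain ⟨⟨I, h0, hI⟩, hmax⟩ := exists_eq_ciSup_of_finite
        (f := fun I : {I : Finset (Fin (n + 1)) // 0 ∉ I ∧ I.card = finrank ℚ W} =>
          |(minorDet (minFamily W) I.1 : ℝ)|)
      rw [maxCoeff, ← hmax] at h
      refine ⟨Pi.single 0 (Real.exp (-((finrank ℚ W : ℝ) / n) * t) * minorDet (minFamily W) I), ?_,
        fun x y _ => ?_⟩
      · rw [Pi.norm_single, Real.norm_eq_abs, abs_mul, Real.abs_exp]
        exact h
      · rw [← det_castMat_mul_daniMat_eq_dotProduct_of_notMem (minFamily W) t hI h0 x y]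
        exact abs_det_le_maxMinor _ _

/-- Under `Cond36`, the covolumes of all rational subspaces are bounded below somewhere on
the curve. -/
theorem exists_le_covol {n s : ℕ} (hn : 0 < n) {P : Matrix (Fin (s + 1)) (Fin (n + 1)) ℝ}
    {κ b t : ℝ} (hκ : 0 < κ) (hb : 0 < b) (hb1 : b ≤ 1) {J : Set ℝ} (hJ : J.Nonempty)
    {x : ℝ → Fin s → ℝ} {y : ℝ → Fin n → ℝ}
    (hxy : ∀ τ ∈ J, (Fin.cons 1 (y τ) : Fin (n + 1) → ℝ) = vecMul (Fin.cons 1 (x τ)) P)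
    (hsup : ∀ a : Fin (s + 1) → ℝ, ∃ τ ∈ J,
      κ * ‖a‖ ≤ |a ⬝ᵥ (Fin.cons 1 (x τ) : Fin (s + 1) → ℝ)|)
    (hcond : ∀ j : ℕ, 1 ≤ j → j ≤ n → ∀ w : Finset (Fin (n + 1)) → ℝ, IsPrim j w →
      b ≤ max (Real.exp ((((n : ℝ) + 1 - (j : ℝ)) / (n : ℝ)) * t) * maxNormP P j w)
            (Real.exp (-((j : ℝ) / (n : ℝ)) * t) * maxCoeff j w))
    (W : Submodule ℚ (Fin (n + 1) → ℚ)) :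
    ∃ τ ∈ J, min 1 κ * b ≤ covol (daniMat (y τ) t) W := by
  have hb' : min 1 κ * b ≤ 1 := mul_le_one₀ (min_le_left _ _) hb.le hb1
  obtain ⟨τ₀, hτ₀⟩ := hJ
  have hle : finrank ℚ W ≤ n + 1 := by
    simpa using Submodule.finrank_le W
  rcases Nat.eq_zero_or_pos (finrank ℚ W) with h0 | h0
  · rw [Submodule.finrank_eq_zero] at h0
    subst h0
    exact ⟨τ₀, hτ₀, by rwa [covol_bot]⟩
  rcases hle.eq_or_lt with h1 | h1
  · exact ⟨τ₀, hτ₀, hb'.trans (one_le_covol_of_finrank_eq (det_daniMat hn _ _) h1)⟩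
  obtain ⟨a, hba, ha⟩ := exists_dotProduct_le_covol_of_cond36 hn hb
    (hcond _ h0 (Nat.lt_succ_iff.1 h1) (fun I => (minorDet (minFamily W) I : ℝ))
      ⟨minFamily W, linearIndependent_minFamily W, fun _ => rfl⟩)
  obtain ⟨τ, hτ, hτa⟩ := hsup a
  refine ⟨τ, hτ, le_trans ?_ (hτa.trans (ha _ _ (hxy τ hτ)))⟩
  exact mul_le_mul (min_le_right _ _) hba hb.le hκ.le

end

section

open Matrix Filter Set Topology Module

theorem continuous_daniMat {n : ℕ} (t : ℝ) : Continuous fun y : Fin n → ℝ => daniMat y t := by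
  refine continuous_matrix fun i c => ?_
  simp only [daniMat, of_apply]
  split_ifs
  · cases i using Fin.cases with
    | zero => simpa using continuous_const
    | succ i =>
      simp only [Fin.cons_succ]
      fun_prop
  · exact continuous_const
  · exact continuous_const

theorem continuous_covol {k : ℕ} (W : Submodule ℚ (Fin k → ℚ)) :
    Continuous fun D : Matrix (Fin k) (Fin k) ℝ => covol D W := by
  refine Continuous.norm (continuous_pi fun c => Continuous.matrix_det ?_)
  exact (continuous_const.matrix_mul continuous_id).matrix_submatrix _ _

theorem volume_covol_lt_le {n s : ℕ} (hn : 0 < n) {P : Matrix (Fin (s + 1)) (Fin (n + 1)) ℝ}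
    {x : ℝ → Fin s → ℝ} {y : ℝ → Fin n → ℝ} {p q ε ρ C t : ℝ} {N : ℕ} (hN : 0 < N) (hC : 0 < C)
    (hε : 0 < ε) (hρ : 0 < ρ) (hpq : p < q)
    (hxy : ∀ τ ∈ Icc p q, (Fin.cons 1 (y τ) : Fin (n + 1) → ℝ) = vecMul (Fin.cons 1 (x τ)) P)
    (hgood : ∀ (a : Fin (s + 1) → ℝ), ∀ τ ∈ Icc p q,
      |a ⬝ᵥ (Fin.cons 1 (x τ) : Fin (s + 1) → ℝ)| * (volume.real {τ' ∈ Icc p q |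
        |a ⬝ᵥ (Fin.cons 1 (x τ') : Fin (s + 1) → ℝ)| < ε}) ^ N ≤ C * ε * (q - p) ^ N)
    {W : Submodule ℚ (Fin (n + 1) → ℚ)} (hW : ∃ τ ∈ Icc p q, ρ ≤ covol (daniMat (y τ) t) W) :
    volume {τ ∈ Icc p q | covol (daniMat (y τ) t) W < ε} ≤
      ENNReal.ofReal ((C * ε / ρ) ^ (1 / N : ℝ)) * volume (Icc p q) := by
  obtain ⟨τ, hτ, hWτ⟩ := hW
  obtain ⟨a, ha, hle⟩ := exists_dotProduct_le_covol hn W t (hxy τ hτ) (hρ.trans_le hWτ)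
  have hsub : {τ ∈ Icc p q | covol (daniMat (y τ) t) W < ε} ⊆
      {τ' ∈ Icc p q | |a ⬝ᵥ (Fin.cons 1 (x τ') : Fin (s + 1) → ℝ)| < ε} :=
    fun τ' h => ⟨h.1, (hle _ _ (hxy τ' h.1)).trans_lt h.2⟩
  refine (measure_mono hsub).trans ?_
  set E := {τ' ∈ Icc p q | |a ⬝ᵥ (Fin.cons 1 (x τ') : Fin (s + 1) → ℝ)| < ε} with hE
  have hfin : volume E ≠ ⊤ := ((measure_mono fun τ' h => h.1).trans_lt
    (measure_Icc_lt_top (a := p) (b := q))).ne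
  have hgoodτ := hgood a τ hτ
  rw [← ha] at hgoodτ
  have h1 : (volume.real E) ^ N ≤ ((C * ε / ρ) ^ (1 / N : ℝ) * (q - p)) ^ N := by
    rw [mul_pow, ← Real.rpow_natCast (_ ^ (1 / N : ℝ)), ← Real.rpow_mul (by positivity),
      one_div_mul_cancel (by positivity), Real.rpow_one, div_mul_eq_mul_div, le_div_iff₀ hρ,
      mul_comm]
    refine le_trans ?_ hgoodτ
    gcongr
  have h2 : volume.real E ≤ (C * ε / ρ) ^ (1 / N : ℝ) * (q - p) :=
    le_of_pow_le_pow_left₀ hN.ne' (mul_nonneg (by positivity) (by linarith)) h1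
  rw [Real.volume_Icc, ← ENNReal.ofReal_mul (by positivity)]
  exact (ENNReal.le_ofReal_iff_toReal_le hfin (mul_nonneg (by positivity) (by linarith))).2 h2

/-- A quantitative nondivergence estimate along a good curve in an affine subspace. -/
theorem volume_exists_short_vector_le {n s : ℕ} (hn : 0 < n)
    {P : Matrix (Fin (s + 1)) (Fin (n + 1)) ℝ} {x : ℝ → Fin s → ℝ} {y : ℝ → Fin n → ℝ} {r : ℝ}
    (hr : 0 < r) (hy : ContinuousOn y (Icc (-r) r))
    (hxy : ∀ τ ∈ Icc (-r) r, (Fin.cons 1 (y τ) : Fin (n + 1) → ℝ) = vecMul (Fin.cons 1 (x τ)) P)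
    {N : ℕ} {C κ b t ε : ℝ} (hN : 0 < N) (hC : 0 < C) (hκ : 0 < κ)
    (hgood : ∀ a : Fin (s + 1) → ℝ,
      (∃ τ ∈ Icc (-r) r, κ * ‖a‖ ≤ |a ⬝ᵥ (Fin.cons 1 (x τ) : Fin (s + 1) → ℝ)|) ∧
      ∀ p q ε τ, -r ≤ p → p ≤ q → q ≤ r → 0 < ε → τ ∈ Icc p q →
        |a ⬝ᵥ (Fin.cons 1 (x τ) : Fin (s + 1) → ℝ)| * (volume.real {τ' ∈ Icc p q |
          |a ⬝ᵥ (Fin.cons 1 (x τ') : Fin (s + 1) → ℝ)| < ε}) ^ N ≤ C * ε * (q - p) ^ N)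
    (hb : 0 < b) (hb1 : b ≤ 1)
    (hcond : ∀ j : ℕ, 1 ≤ j → j ≤ n → ∀ w : Finset (Fin (n + 1)) → ℝ, IsPrim j w →
      b ≤ max (Real.exp ((((n : ℝ) + 1 - (j : ℝ)) / (n : ℝ)) * t) * maxNormP P j w)
            (Real.exp (-((j : ℝ) / (n : ℝ)) * t) * maxCoeff j w))
    (hε : 0 < ε) (hερ : ε ≤ min 1 κ * b) :
    volume {τ ∈ Icc (-r) r | ∃ v : Fin (n + 1) → ℤ, v ≠ 0 ∧
        (n + 1) * ‖(fun i => (v i : ℝ)) ᵥ* daniMat (y τ) t‖ < ε} ≤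
      (4 ^ (n + 2) - 1 : ℕ) * ENNReal.ofReal ((C * ε / (min 1 κ * b)) ^ (1 / N : ℝ)) *
        volume (Icc (-r) r) := by
  have hrr : -r ≤ r := by linarith
  have hρ : 0 < min 1 κ * b := hε.trans_le hερ
  have hJ : (Icc (-r) r).Nonempty := nonempty_Icc.2 hrr
  let E : ℕ → Set ℝ := fun R => {τ ∈ Icc (-r) r | ∃ v : Fin (n + 1) → ℤ, v ≠ 0 ∧
    ‖(fun i => (v i : ℝ))‖ ≤ R ∧ (n + 1) * ‖(fun i => (v i : ℝ)) ᵥ* daniMat (y τ) t‖ < ε}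
  have hEmono : Monotone E := by
    rintro R R' hR τ ⟨hτ, v, hv, hvR, h⟩
    exact ⟨hτ, v, hv, hvR.trans (by exact_mod_cast hR), h⟩
  have hsub : {τ ∈ Icc (-r) r | ∃ v : Fin (n + 1) → ℤ, v ≠ 0 ∧
      (n + 1) * ‖(fun i => (v i : ℝ)) ᵥ* daniMat (y τ) t‖ < ε} ⊆ ⋃ R, E R := by
    rintro τ ⟨hτ, v, hv, h⟩
    obtain ⟨R, hR⟩ := exists_nat_ge ‖(fun i => (v i : ℝ))‖
    exact mem_iUnion.2 ⟨R, hτ, v, hv, hR, h⟩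
  refine (measure_mono hsub).trans ?_
  rw [hEmono.measure_iUnion]
  refine iSup_le fun R => ?_
  let y' : ℝ → Fin n → ℝ := fun τ => y (projIcc (-r) r hrr τ)
  have hy' : Continuous y' := (continuousOn_iff_continuous_domRestrict.1 hy).comp continuous_projIcc
  have hyy' : ∀ τ ∈ Icc (-r) r, y' τ = y τ := fun τ hτ => by
    simp only [y', projIcc_of_mem hrr hτ]
  obtain ⟨S, hbot, hS⟩ := exists_finset_submodule (finite_setOf_norm_intCast_le (n + 1) R)
  refine le_trans (measure_mono ?_) (measure_not_marked_le (fun W W' => W ≤ W' ∨ W' ≤ W)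
    (fun _ _ => Or.symm) (fun _ => Or.inl le_rfl) (fun W τ => covol (daniMat (y' τ) t) W) ε
    (min 1 κ * b) (ENNReal.ofReal ((C * ε / (min 1 κ * b)) ^ (1 / N : ℝ))) (n + 2) S (-r) r
    (fun W _ => (continuous_covol W).comp ((continuous_daniMat t).comp hy'))
    (fun T _ hT => card_le_of_pairwise_comparable T hT) (fun W _ => ?_)
    fun W _ p q hp hpq hq hW => ?_)
  · rintro τ ⟨hτ, v, hv, hvR, h⟩
    refine ⟨hτ, fun hmark => h.not_ge ?_⟩
    have := le_norm_vecMul_of_marked hv hbot (hS v hvR) (D := fun τ => daniMat (y' τ) t) hερ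
      (mul_le_one₀ (min_le_left _ _) hb.le hb1) hmark
    simp only [hyy' τ hτ] at this
    exact_mod_cast this
  · obtain ⟨τ, hτ, h⟩ := exists_le_covol hn hκ hb hb1 hJ hxy (fun a => (hgood a).1) hcond W
    exact ⟨τ, hτ, by simpa only [hyy' τ hτ] using h⟩
  · have hsub : Icc p q ⊆ Icc (-r) r := Icc_subset_Icc hp hq
    exact volume_covol_lt_le hn hN hC hε hρ hpq
      (fun τ hτ => by rw [hyy' τ (hsub hτ)]; exact hxy τ (hsub hτ))
      (fun a τ hτ => (hgood a).2 p q ε τ hp hpq.le hq hε hτ) hW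

end

section

open Matrix Filter Set Topology Module

theorem volume_frequently_short_vector_eq_zero {n s : ℕ} (hn : 0 < n)
    {P : Matrix (Fin (s + 1)) (Fin (n + 1)) ℝ} (hP : Cond36 P) {x : ℝ → Fin s → ℝ}
    {y : ℝ → Fin n → ℝ} {r : ℝ} (hr : 0 < r) (hy : ContinuousOn y (Icc (-r) r))
    (hxy : ∀ τ ∈ Icc (-r) r, (Fin.cons 1 (y τ) : Fin (n + 1) → ℝ) = vecMul (Fin.cons 1 (x τ)) P)
    {N : ℕ} {C κ γ : ℝ} (hN : 0 < N) (hC : 0 < C) (hκ : 0 < κ) (hγ : 0 < γ)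
    (hgood : ∀ a : Fin (s + 1) → ℝ,
      (∃ τ ∈ Icc (-r) r, κ * ‖a‖ ≤ |a ⬝ᵥ (Fin.cons 1 (x τ) : Fin (s + 1) → ℝ)|) ∧
      ∀ p q ε τ, -r ≤ p → p ≤ q → q ≤ r → 0 < ε → τ ∈ Icc p q →
        |a ⬝ᵥ (Fin.cons 1 (x τ) : Fin (s + 1) → ℝ)| * (volume.real {τ' ∈ Icc p q |
          |a ⬝ᵥ (Fin.cons 1 (x τ') : Fin (s + 1) → ℝ)| < ε}) ^ N ≤ C * ε * (q - p) ^ N) :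
    volume {τ | τ ∈ Icc (-r) r ∧ ∃ᶠ t : ℕ in atTop, ∃ v : Fin (n + 1) → ℤ, v ≠ 0 ∧
      ‖(fun i => (v i : ℝ)) ᵥ* daniMat (y τ) t‖ ≤ Real.exp (-γ * t)} = 0 := by
  set β := γ / 2 with hβ
  have hβ0 : 0 < β := half_pos hγ
  have hκ' : 0 < min 1 κ := lt_min one_pos hκ
  obtain ⟨T, -, hT⟩ := hP β hβ0
  have hlim : Tendsto (fun t : ℕ => ((n : ℝ) + 2) * Real.exp (-β * t)) atTop (𝓝 0) := by
    have h1 : Tendsto (fun t : ℕ => -β * (t : ℝ)) atTop atBot :=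
      tendsto_natCast_atTop_atTop.const_mul_atTop_of_neg (neg_lt_zero.2 hβ0)
    simpa using (Real.tendsto_exp_atBot.comp h1).const_mul ((n : ℝ) + 2)
  have hev : ∀ᶠ t : ℕ in atTop, T ≤ t ∧ ((n : ℝ) + 2) * Real.exp (-β * t) < min 1 κ :=
    (tendsto_natCast_atTop_atTop.eventually_ge_atTop T).and (hlim.eventually_lt_const hκ')
  obtain ⟨T₀, hT₀⟩ := eventually_atTop.1 hev
  let p : ℕ → ℝ → Prop := fun t τ => T₀ ≤ t ∧ τ ∈ Icc (-r) r ∧ ∃ v : Fin (n + 1) → ℤ, v ≠ 0 ∧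
    ((n : ℝ) + 1) * ‖(fun i => (v i : ℝ)) ᵥ* daniMat (y τ) t‖ < (n + 2) * Real.exp (-γ * t)
  set A : ℝ := (4 ^ (n + 2) - 1 : ℕ) * (C * (n + 2) / min 1 κ) ^ (1 / N : ℝ) * (r - -r) with hA
  set θ : ℝ := Real.exp (-β / N) with hθ
  have hθ1 : θ < 1 :=
    Real.exp_lt_one_iff.2 (div_neg_of_neg_of_pos (neg_lt_zero.2 hβ0) (by positivity))
  have hbound : ∀ t, volume {τ | p t τ} ≤ ENNReal.ofReal (A * θ ^ t) := fun t => by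
    by_cases ht : T₀ ≤ t
    · obtain ⟨hTt, hεt⟩ := hT₀ t ht
      have hexp : Real.exp (-γ * t) = Real.exp (-β * t) * Real.exp (-β * t) := by
        rw [← Real.exp_add]
        congr 1
        rw [hβ]
        ring
      have hmain := volume_exists_short_vector_le hn hr hy hxy (b := Real.exp (-β * t)) (t := t)
        (ε := (n + 2) * Real.exp (-γ * t)) hN hC hκ hgood (Real.exp_pos _)
        (Real.exp_le_one_iff.2 (by
          have : 0 ≤ β * t := by positivity
          linarith))
        (hT t hTt) (by positivity) (by
          rw [hexp, ← mul_assoc]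
          gcongr)
      refine (measure_mono ?_).trans (hmain.trans_eq ?_)
      · exact fun τ h => ⟨h.2.1, h.2.2⟩
      have h1 : C * ((n + 2) * Real.exp (-γ * t)) / (min 1 κ * Real.exp (-β * t)) =
          C * (n + 2) / min 1 κ * Real.exp (-β * t) := by
        rw [hexp]
        have := (Real.exp_pos (-β * t)).ne'
        field_simp
      have h2 : Real.exp (-β * t) ^ (1 / N : ℝ) = θ ^ t := by
        rw [hθ, ← Real.exp_mul, ← Real.exp_nat_mul]
        congr 1
        ring
      rw [h1, Real.mul_rpow (by positivity) (by positivity), h2, Real.volume_Icc,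
        ← ENNReal.ofReal_natCast, ← ENNReal.ofReal_mul (by positivity),
        ← ENNReal.ofReal_mul (by positivity), hA]
      congr 1
      ring
    · have : {τ | p t τ} = ∅ := eq_empty_of_forall_notMem fun τ h => ht h.1
      rw [this, measure_empty]
      exact zero_le
  have hsum : ∑' t, volume {τ | p t τ} ≠ ⊤ := by
    refine ne_top_of_le_ne_top ?_ (ENNReal.tsum_le_tsum hbound)
    exact ((summable_geometric_of_lt_one (Real.exp_pos _).le hθ1).mul_left A).tsum_ofReal_ne_top
  refine measure_mono_null ?_ (measure_setOfPred_frequently_eq_zero hsum)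
  rintro τ ⟨hτ, hfreq⟩
  refine (hfreq.and_eventually (eventually_ge_atTop T₀)).mono fun t ht => ?_
  obtain ⟨⟨v, hv, hle⟩, htT⟩ := ht
  refine ⟨htT, hτ, v, hv, ?_⟩
  have h1 : ((n : ℝ) + 1) * ‖(fun i => (v i : ℝ)) ᵥ* daniMat (y τ) t‖ ≤
      (n + 1) * Real.exp (-γ * t) := by gcongr
  have h2 := Real.exp_pos (-γ * t)
  linarith

/-- Under `Cond36`, a smooth curve in the affine subspace which is not flat at a point
consists, near this point, almost entirely of points which are not very well approximable. -/
theorem volume_isVWA_curve_eq_zero {n s : ℕ} (hn : 0 < n)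
    {P : Matrix (Fin (s + 1)) (Fin (n + 1)) ℝ} (hP : Cond36 P) {V : Set ℝ} (hV : IsOpen V)
    (h0 : (0 : ℝ) ∈ V) {x : ℝ → Fin s → ℝ} (hx : ContDiffOn ℝ (⊤ : ℕ∞) x V)
    {y : ℝ → Fin n → ℝ} (hy : ContinuousOn y V)
    (hxy : ∀ τ ∈ V, (Fin.cons 1 (y τ) : Fin (n + 1) → ℝ) = vecMul (Fin.cons 1 (x τ)) P)
    (hnf : ∀ c ≠ 0, ∃ k ≥ 1, iteratedDeriv k (fun τ => c ⬝ᵥ x τ) 0 ≠ 0) :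
    ∃ r > 0, Icc (-r) r ⊆ V ∧ volume {τ ∈ Icc (-r) r | IsVWA (y τ)} = 0 := by
  have hg : ContDiffOn ℝ (⊤ : ℕ∞) (fun τ => (Fin.cons 1 (x τ) : Fin (s + 1) → ℝ)) V := by
    refine contDiffOn_pi.2 fun i => ?_
    cases i using Fin.cases with
    | zero => simpa using contDiffOn_const
    | succ i => simpa using contDiffOn_pi.1 hx i
  have hnf' : ∀ a : Fin (s + 1) → ℝ, a ≠ 0 →
      ∃ k, iteratedDeriv k (fun τ => a ⬝ᵥ (Fin.cons 1 (x τ) : Fin (s + 1) → ℝ)) 0 ≠ 0 := by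
    intro a ha
    have he : (fun τ => a ⬝ᵥ (Fin.cons 1 (x τ) : Fin (s + 1) → ℝ)) =
        fun τ => a 0 + Fin.tail a ⬝ᵥ x τ := by
      ext τ
      simp [dotProduct, Fin.sum_univ_succ, Fin.tail]
    rw [he]
    by_cases hc : Fin.tail a = 0
    · refine ⟨0, ?_⟩
      have h00 : a 0 ≠ 0 := fun h00 => ha (by
        rw [← Fin.cons_self_tail a, hc, h00]
        ext i
        cases i using Fin.cases <;> rfl)
      simpa [hc] using h00
    · obtain ⟨k, hk, hne⟩ := hnf _ hc
      exact ⟨k, by rwa [iteratedDeriv_const_add hk]⟩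
  obtain ⟨r, hr, hrV, N, C, κ, hN, hC, hκ, hgood⟩ := exists_uniform_good hV h0 hg hnf'
  refine ⟨r, hr, hrV, ?_⟩
  refine measure_mono_null ?_ (measure_iUnion_null fun M : ℕ =>
    volume_frequently_short_vector_eq_zero hn hP hr (hy.mono hrV)
      (fun τ hτ => hxy τ (hrV hτ)) (γ := 1 / ((M : ℝ) + 1)) hN hC hκ (by positivity) hgood)
  rintro τ ⟨hτ, hvwa⟩
  obtain ⟨M, hM⟩ := frequently_of_isVWA hn hvwa
  exact mem_iUnion.2 ⟨M, hτ, hM⟩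

end

section

open Filter Topology Equiv

theorem iteratedFDeriv_comp_perm_of_contDiffOn {E F : Type*} [NormedAddCommGroup E]
    [NormedSpace ℝ E] [NormedAddCommGroup F] [NormedSpace ℝ F] {f : E → F} {U : Set E}
    (hU : IsOpen U) (hf : ContDiffOn ℝ (⊤ : ℕ∞) f U) {x : E} (hx : x ∈ U) {m : ℕ}
    (σ : Perm (Fin m)) (v : Fin m → E) :
    iteratedFDeriv ℝ m f x (v ∘ σ) = iteratedFDeriv ℝ m f x v := by
  have hat : ∀ y ∈ U, ContDiffAt ℝ (⊤ : ℕ∞) f y := fun y hy => hf.contDiffAt (hU.mem_nhds hy)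
  have hleft : ∀ (k : ℕ), ∀ y ∈ U, ∀ w : Fin (k + 1) → E,
      iteratedFDeriv ℝ (k + 1) f y w =
        fderiv ℝ (fun z => iteratedFDeriv ℝ k f z (Fin.tail w)) y (w 0) := fun k y hy w =>
    ((hat y hy).differentiableAt_iteratedFDeriv
      (mod_cast ENat.natCast_lt_top k)).iteratedFDeriv_succ_apply_left'
  have hswap : ∀ (k : ℕ) (i : Fin k), ∀ y ∈ U, ∀ w : Fin (k + 1) → E,
      iteratedFDeriv ℝ (k + 1) f y (w ∘ swap i.castSucc i.succ) =
        iteratedFDeriv ℝ (k + 1) f y w := by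
    intro k
    induction k with
    | zero => exact fun i => i.elim0
    | succ k ih =>
      intro i y hy w
      cases i using Fin.cases with
      | zero =>
        have hC : ∀ u : Fin k → E, ContDiffAt ℝ 2 (fun z => iteratedFDeriv ℝ k f z u) y := by
          intro u
          have h := (hat y hy).iteratedFDeriv_right (m := 2) (i := k) 
            (WithTop.coe_le_coe.2 (le_top : (2 + k : ℕ∞) ≤ ⊤))
          exact (ContinuousMultilinearMap.apply ℝ (fun _ : Fin k => E) F u).contDiff.contDiffAt.comp
            y h
        have hsymm : ∀ w : Fin (k + 2) → E, iteratedFDeriv ℝ (k + 2) f y w =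
            fderiv ℝ (fderiv ℝ fun z => iteratedFDeriv ℝ k f z (Fin.tail (Fin.tail w))) y
              (w 0) (w 1) := by
          intro w
          rw [hleft _ _ hy]
          have h1 : (fun z => iteratedFDeriv ℝ (k + 1) f z (Fin.tail w)) =ᶠ[𝓝 y]
              fun z => fderiv ℝ (fun z => iteratedFDeriv ℝ k f z (Fin.tail (Fin.tail w))) z (w 1) :=
            eventually_of_mem (hU.mem_nhds hy) fun z hz => hleft k z hz (Fin.tail w)
          have h2 : DifferentiableAt ℝ
              (fderiv ℝ fun z => iteratedFDeriv ℝ k f z (Fin.tail (Fin.tail w))) y :=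
            ((hC _).fderiv_right (m := 1) (by norm_num)).differentiableAt one_ne_zero
          rw [h1.fderiv_eq, fderiv_clm_apply h2 (differentiableAt_const _)]
          simp
        rw [hsymm, hsymm]
        have h3 : IsSymmSndFDerivAt ℝ
            (fun z => iteratedFDeriv ℝ k f z (Fin.tail (Fin.tail w))) y :=
          (hC _).isSymmSndFDerivAt (by simp)
        have ht : Fin.tail (Fin.tail (w ∘ swap (Fin.castSucc 0) (Fin.succ 0))) =
            Fin.tail (Fin.tail w) := by
          ext j
          simp only [Fin.tail, Function.comp_apply]
          rw [swap_apply_of_ne_of_ne] <;> simp [Fin.ext_iff]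
        rw [ht, Function.comp_apply, Function.comp_apply]
        simpa using h3.eq _ _
      | succ i =>
        rw [hleft _ _ hy, hleft _ _ hy]
        have ht : Fin.tail (w ∘ swap i.succ.castSucc i.succ.succ) =
            Fin.tail w ∘ swap i.castSucc i.succ := by
          ext j
          simp only [Fin.tail, Function.comp_apply, ← Fin.succ_castSucc]
          rw [← (Fin.succ_injective _).swap_apply]
        have h0 : (w ∘ swap i.succ.castSucc i.succ.succ) 0 = w 0 := by
          rw [Function.comp_apply, swap_apply_of_ne_of_ne] <;> simp [Fin.ext_iff]
        rw [h0, ht]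
        have h1 : (fun z => iteratedFDeriv ℝ (k + 1) f z (Fin.tail w ∘ swap i.castSucc i.succ))
            =ᶠ[𝓝 y] fun z => iteratedFDeriv ℝ (k + 1) f z (Fin.tail w) :=
          eventually_of_mem (hU.mem_nhds hy) fun z hz => ih i z hz _
        rw [h1.fderiv_eq]
  cases m with
  | zero => congr 1; exact Subsingleton.elim _ _
  | succ m =>
    have hσ : σ ∈ Submonoid.closure (Set.range fun i : Fin m => swap i.castSucc i.succ) := by
      rw [Perm.mclosure_swap_castSucc_succ]
      trivial
    induction hσ using Submonoid.closure_induction generalizing v with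
    | mem τ hτ =>
      obtain ⟨i, rfl⟩ := hτ
      exact hswap m i x hx v
    | one => rfl
    | mul a b _ _ iha ihb => rw [← iha v, ← ihb (v ∘ a)]; rfl

end

section

open Filter Topology Asymptotics

theorem isBigO_sub_sum_iteratedFDeriv {E : Type*} [NormedAddCommGroup E] [NormedSpace ℝ E]
    {φ : E → ℝ} {x : E} {n : ℕ} (hφ : ContDiffAt ℝ (n + 1 : ℕ) φ x) :
    (fun y => φ (x + y) - ∑ k ∈ Finset.range (n + 1),
      (k.factorial : ℝ)⁻¹ • iteratedFDeriv ℝ k φ x fun _ => y) =O[𝓝 0] fun y => ‖y‖ ^ (n + 1) := by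
  obtain ⟨u, hu, hφu⟩ := hφ.contDiffOn' le_rfl (by simp)
  have hcont : ContinuousAt (fun z => ‖iteratedFDeriv ℝ (n + 1) φ z‖) x :=
    (hφ.continuousAt_iteratedFDeriv le_rfl).norm
  have hev : ∀ᶠ z in 𝓝 x, ContDiffAt ℝ (n + 1 : ℕ) φ z ∧
      ‖iteratedFDeriv ℝ (n + 1) φ z‖ ≤ ‖iteratedFDeriv ℝ (n + 1) φ x‖ + 1 :=
    (hφ.eventually (by simp)).and (hcont.eventually_le_const (lt_add_one _))
  obtain ⟨ε, hε, hball⟩ := Metric.eventually_nhds_iff_ball.1 hev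
  refine IsBigO.of_bound ((n.factorial : ℝ)⁻¹ * (‖iteratedFDeriv ℝ (n + 1) φ x‖ + 1)) ?_
  filter_upwards [Metric.ball_mem_nhds (0 : E) hε] with y hy
  have hmem : ∀ t ∈ Set.Icc (0 : ℝ) 1, x + t • y ∈ Metric.ball x ε := by
    intro t ht
    rw [mem_ball_zero_iff] at hy
    rw [mem_ball_iff_norm, add_sub_cancel_left, norm_smul, Real.norm_of_nonneg ht.1]
    exact (mul_le_of_le_one_left (norm_nonneg _) ht.2).trans_lt hy
  rw [map_add_eq_sum_add_integral_iteratedFDeriv fun t ht => (hball _ (hmem t ht)).1,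
    add_sub_cancel_left, norm_smul, norm_inv, Real.norm_natCast, norm_pow, norm_norm, mul_assoc]
  gcongr
  refine (intervalIntegral.norm_integral_le_of_norm_le_const
    (C := (‖iteratedFDeriv ℝ (n + 1) φ x‖ + 1) * ‖y‖ ^ (n + 1)) fun t ht => ?_).trans_eq (by simp)
  rw [Set.uIoc_of_le zero_le_one] at ht
  have ht' : t ∈ Set.Icc (0 : ℝ) 1 := ⟨ht.1.le, ht.2⟩
  rw [norm_smul, norm_pow, Real.norm_of_nonneg (sub_nonneg.2 ht.2)]
  have h1 : (1 - t) ^ n ≤ 1 := pow_le_one₀ (sub_nonneg.2 ht.2) (by linarith [ht.1])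
  have h2 := (iteratedFDeriv ℝ (n + 1) φ (x + t • y)).le_opNorm fun _ => y
  rw [Finset.prod_const, Finset.card_univ, Fintype.card_fin] at h2
  calc _ ≤ 1 * ‖iteratedFDeriv ℝ (n + 1) φ (x + t • y) fun _ => y‖ := by gcongr
    _ ≤ _ := by
      rw [one_mul]
      refine h2.trans ?_
      gcongr
      exact (hball _ (hmem t ht')).2

theorem eq_zero_of_isLittleO_pow {p : Polynomial ℝ} {n : ℕ} (hp : p.natDegree ≤ n)
    (h : (fun t => p.eval t) =o[𝓝[≠] 0] fun t : ℝ => t ^ n) : p = 0 := by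
  by_contra hne
  obtain ⟨q, hq, hndvd⟩ := Polynomial.exists_eq_pow_rootMultiplicity_mul_and_not_dvd p hne 0
  set k := p.rootMultiplicity 0
  rw [map_zero, sub_zero] at hq hndvd
  have hq0 : q ≠ 0 := by
    rintro rfl
    simp at hndvd
  have hk : k ≤ n := by
    rw [hq, Polynomial.natDegree_mul (by simp) hq0, Polynomial.natDegree_X_pow] at hp
    exact (Nat.le_add_right _ _).trans hp
  have hlim : Tendsto (fun t => q.eval t) (𝓝[≠] 0) (𝓝 0) := by
    have h1 : (fun t => q.eval t) =o[𝓝[≠] 0] fun t : ℝ => t ^ (n - k) := by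
      refine IsLittleO.of_bound fun c hc => ?_
      filter_upwards [h.bound hc, self_mem_nhdsWithin] with t ht ht0
      have hpos : 0 < ‖t ^ k‖ := norm_pos_iff.2 (pow_ne_zero _ ht0)
      rw [hq, Polynomial.eval_mul, Polynomial.eval_pow, Polynomial.eval_X, norm_mul,
        ← Nat.add_sub_of_le hk, pow_add, norm_mul, mul_left_comm] at ht
      exact le_of_mul_le_mul_left ht hpos
    refine (isLittleO_one_iff ℝ).1 (h1.trans_isBigO ?_)
    exact (((continuous_pow (n - k)).tendsto (0 : ℝ)).mono_left nhdsWithin_le_nhds).isBigO_one ℝ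
  have h0 : q.eval 0 = 0 :=
    tendsto_nhds_unique (q.continuous.continuousWithinAt.tendsto) hlim
  exact hndvd (Polynomial.X_dvd_iff.2 (by rwa [Polynomial.coeff_zero_eq_eval_zero]))

end

section

open Filter Topology Equiv

/-- The exponents of the curve `τ ↦ (τ ^ kroneckerExponent B i)ᵢ`. -/
def kroneckerExponent {d : ℕ} (B : ℕ) (i : Fin d) : ℕ := B ^ d + B ^ (i : ℕ)

theorem sum_kroneckerExponent {d B m : ℕ} (r : Fin m → Fin d) :
    ∑ j, kroneckerExponent B (r j) =
      m * B ^ d + ∑ i : Fin d, (Finset.univ.filter fun j => r j = i).card * B ^ (i : ℕ) := by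
  simp only [kroneckerExponent, Finset.sum_add_distrib, Finset.sum_const, Finset.card_univ,
    Fintype.card_fin, smul_eq_mul]
  rw [← Finset.sum_fiberwise Finset.univ r]
  refine congrArg _ (Finset.sum_congr rfl fun i _ => ?_)
  rw [Finset.sum_congr rfl fun j hj => by rw [(Finset.mem_filter.1 hj).2], Finset.sum_const,
    smul_eq_mul]

theorem sum_lt_pow_of_lt {d B : ℕ} {c : Fin d → ℕ} (hc : ∀ i, c i < B) :
    ∑ i : Fin d, c i * B ^ (i : ℕ) < B ^ d :=
  (finFunctionFinEquiv fun i => (⟨c i, hc i⟩ : Fin B)).2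

theorem sum_mul_pow_injective {d B : ℕ} {c c' : Fin d → ℕ} (hc : ∀ i, c i < B)
    (hc' : ∀ i, c' i < B) (h : ∑ i : Fin d, c i * B ^ (i : ℕ) = ∑ i : Fin d, c' i * B ^ (i : ℕ)) :
    c = c' := by
  have := finFunctionFinEquiv.injective (a₁ := fun i => (⟨c i, hc i⟩ : Fin B))
    (a₂ := fun i => (⟨c' i, hc' i⟩ : Fin B)) (Fin.ext h)
  funext i
  exact congrArg Fin.val (congrFun this i)

theorem exists_perm_of_sum_kroneckerExponent_eq {d B m m' : ℕ} (hm : m < B) (hm' : m' < B)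
    {r : Fin m → Fin d} {r' : Fin m' → Fin d}
    (h : ∑ j, kroneckerExponent B (r j) = ∑ j, kroneckerExponent B (r' j)) :
    ∃ σ : Fin m ≃ Fin m', r' ∘ σ = r := by
  have hcard : ∀ {k : ℕ} (hk : k < B) (q : Fin k → Fin d) (i : Fin d),
      (Finset.univ.filter fun j => q j = i).card < B := fun hk q i =>
    ((Finset.card_le_univ _).trans_eq (Fintype.card_fin _)).trans_lt hk
  rw [sum_kroneckerExponent, sum_kroneckerExponent] at h
  have h1 := sum_lt_pow_of_lt (hcard hm r)
  have h2 := sum_lt_pow_of_lt (hcard hm' r')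
  have hpos : 0 < B ^ d := Nat.zero_lt_of_lt h1
  have hmm : m = m' := by
    have h3 := congrArg (· / B ^ d) h
    rwa [mul_comm m, mul_comm m', Nat.mul_add_div hpos, Nat.mul_add_div hpos, Nat.div_eq_of_lt h1,
      Nat.div_eq_of_lt h2] at h3
  subst hmm
  have h4 := congrFun (sum_mul_pow_injective (hcard hm r) (hcard hm r') (Nat.add_left_cancel h))
  have h5 : ∀ i, Fintype.card {j // r j = i} = Fintype.card {j // r' j = i} := fun i => by
    rw [Fintype.card_subtype, Fintype.card_subtype, h4]
  refine ⟨(sigmaFiberEquiv r).symm.trans ((Equiv.sigmaCongrRight fun i =>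
    Fintype.equivOfCardEq (h5 i)).trans (sigmaFiberEquiv r')), ?_⟩
  funext j
  simp only [Function.comp_apply, trans_apply]
  exact (Fintype.equivOfCardEq (h5 (r j)) ⟨j, rfl⟩).2

theorem sum_kroneckerExponent_lt {d B m l : ℕ} (hm : m < B) (hl : m ≤ l) (r : Fin m → Fin d) :
    ∑ j, kroneckerExponent B (r j) < (l + 1) * B ^ d := by
  rw [sum_kroneckerExponent]
  have h1 := sum_lt_pow_of_lt (c := fun i => (Finset.univ.filter fun j => r j = i).card) (B := B)
    fun i => ((Finset.card_le_univ _).trans_eq (Fintype.card_fin _)).trans_lt hm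
  have h2 : m * B ^ d ≤ l * B ^ d := Nat.mul_le_mul_right _ hl
  rw [add_mul, one_mul]
  exact add_lt_add_of_le_of_lt h2 h1

theorem kroneckerExponent_pos {d B : ℕ} (hB : 0 < B) (i : Fin d) :
    B ^ d < kroneckerExponent B i := Nat.lt_add_of_pos_right (pow_pos hB _)

end

section

open Filter Topology Asymptotics Polynomial

def kroneckerCurve (d B : ℕ) (τ : ℝ) : Fin d → ℝ := fun i => τ ^ kroneckerExponent B i

theorem contDiff_kroneckerCurve (d B : ℕ) {k : ℕ∞} : ContDiff ℝ k (kroneckerCurve d B) :=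
  contDiff_pi.2 fun _ => contDiff_id.pow _

theorem kroneckerCurve_zero {d B : ℕ} (hB : 0 < B) : kroneckerCurve d B 0 = 0 :=
  funext fun i => zero_pow (Nat.zero_lt_of_lt (kroneckerExponent_pos hB i)).ne'

theorem norm_kroneckerCurve_le {d B : ℕ} (hB : 0 < B) {τ : ℝ} (hτ : |τ| ≤ 1) :
    ‖kroneckerCurve d B τ‖ ≤ |τ| ^ (B ^ d + 1) := by
  refine (pi_norm_le_iff_of_nonneg (by positivity)).2 fun i => ?_
  rw [kroneckerCurve, norm_pow, Real.norm_eq_abs]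
  exact pow_le_pow_of_le_one (abs_nonneg _) hτ (kroneckerExponent_pos hB i)

theorem map_kroneckerCurve {d B k : ℕ}
    (T : ContinuousMultilinearMap ℝ (fun _ : Fin k => Fin d → ℝ) ℝ) (τ : ℝ) :
    T (fun _ => kroneckerCurve d B τ) = ∑ r : Fin k → Fin d,
      τ ^ (∑ j, kroneckerExponent B (r j)) * T fun j => Pi.single (r j) 1 := by
  have h : kroneckerCurve d B τ =
      ∑ i, τ ^ kroneckerExponent B i • (Pi.single i 1 : Fin d → ℝ) := by
    ext i
    simp [kroneckerCurve, Finset.sum_apply, Pi.single_apply]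
  rw [h]
  have := T.toMultilinearMap.map_sum (α := fun _ => Fin d)
    (fun _ i => τ ^ kroneckerExponent B i • (Pi.single i 1 : Fin d → ℝ))
  refine this.trans (Finset.sum_congr rfl fun r _ => ?_)
  rw [MultilinearMap.map_smul_univ, Finset.prod_pow_eq_pow_sum]
  rfl

/-- A function all of whose derivatives along the curve `τ ↦ x + kroneckerCurve d (l + 1) τ` vanish
at `0` has vanishing derivatives of order at most `l` at `x`. -/
theorem exists_iteratedDeriv_comp_kroneckerCurve_ne_zero {d l : ℕ} {U : Set (Fin d → ℝ)}
    (hU : IsOpen U) {φ : (Fin d → ℝ) → ℝ} (hφ : ContDiffOn ℝ (⊤ : ℕ∞) φ U) {x : Fin d → ℝ}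
    (hx : x ∈ U) {m : ℕ} (hm : 1 ≤ m) (hml : m ≤ l) (hne : iteratedFDeriv ℝ m φ x ≠ 0) :
    ∃ k ≥ 1, iteratedDeriv k (fun τ => φ (x + kroneckerCurve d (l + 1) τ)) 0 ≠ 0 := by
  by_contra! hflat
  have hB : 0 < l + 1 := l.succ_pos
  set γ := kroneckerCurve d (l + 1)
  have hγ0 : γ 0 = 0 := kroneckerCurve_zero hB
  have hγc : Tendsto γ (𝓝 0) (𝓝 0) := by
    have := (contDiff_kroneckerCurve d (l + 1) (k := 0)).continuous.tendsto 0
    rwa [kroneckerCurve_zero hB] at this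
  set K := (l + 1) * (l + 1) ^ d with hK
  set ψ := fun τ => φ (x + γ τ)
  set T := fun k => iteratedFDeriv ℝ k φ x
  set R : ℝ[X] := ∑ k ∈ Finset.range (l + 1), ∑ r : Fin k → Fin d,
    monomial (∑ j, kroneckerExponent (l + 1) (r j))
      ((k.factorial : ℝ)⁻¹ * T k fun j => Pi.single (r j) 1) with hR
  have hReval : ∀ τ, R.eval τ =
      ∑ k ∈ Finset.range (l + 1), (k.factorial : ℝ)⁻¹ • T k fun _ => γ τ := by
    intro τ
    simp only [hR, eval_finsetSum, eval_monomial]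
    refine Finset.sum_congr rfl fun k _ => ?_
    rw [map_kroneckerCurve, Finset.smul_sum]
    refine Finset.sum_congr rfl fun r _ => ?_
    rw [smul_eq_mul]
    ring
  have hdeg : (R - C (φ x)).natDegree ≤ K := by
    rw [natDegree_sub_C]
    refine natDegree_sum_le_of_forall_le _ _ fun k hk =>
      natDegree_sum_le_of_forall_le _ _ fun r _ => ?_
    have hk' := Finset.mem_range.1 hk
    exact (natDegree_monomial_le _).trans
      (sum_kroneckerExponent_lt hk' (Nat.lt_succ_iff.1 hk') r).le
  have hψ : (fun τ => ψ τ - φ x) =o[𝓝 0] fun τ => τ ^ K := by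
    have hV : IsOpen {τ | x + γ τ ∈ U} :=
      hU.preimage (continuous_const.add (contDiff_kroneckerCurve d (l + 1) (k := 0)).continuous)
    obtain ⟨ε, hε, hball⟩ := Metric.isOpen_iff.1 hV 0 (by simpa [hγ0] using hx)
    have hψs : ContDiffOn ℝ K ψ (Metric.ball 0 ε) :=
      (hφ.of_le (by exact_mod_cast le_top)).comp
        (contDiff_const.add (contDiff_kroneckerCurve d (l + 1))).contDiffOn hball
    have h := taylor_isLittleO (convex_ball 0 ε) (Metric.mem_ball_self hε) hψs
    rw [Metric.isOpen_ball.nhdsWithin_eq (Metric.mem_ball_self hε)] at h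
    simp only [sub_zero] at h
    refine h.congr_left fun τ => ?_
    rw [taylor_within_apply, Finset.sum_range_succ', Finset.sum_eq_zero fun k _ => ?_]
    · simp [ψ, hγ0]
    · rw [iteratedDerivWithin_of_isOpen Metric.isOpen_ball (Metric.mem_ball_self hε),
        hflat _ (Nat.le_add_left 1 k), smul_zero]
  have hrem : (fun τ => ψ τ - R.eval τ) =o[𝓝 0] fun τ => τ ^ K := by
    have hT := isBigO_sub_sum_iteratedFDeriv (n := l)
      ((hφ.contDiffAt (hU.mem_nhds hx)).of_le (by exact_mod_cast le_top))
    have h1 := hT.comp_tendsto hγc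
    have h2 : (fun τ => ‖γ τ‖ ^ (l + 1)) =O[𝓝 0] fun τ : ℝ => τ ^ (K + 1) := by
      refine IsBigO.of_bound 1 ?_
      filter_upwards [Metric.closedBall_mem_nhds (0 : ℝ) one_pos] with τ hτ
      have hτ' : |τ| ≤ 1 := by simpa using hτ
      rw [one_mul, norm_pow, norm_norm, norm_pow, Real.norm_eq_abs]
      calc ‖γ τ‖ ^ (l + 1) ≤ (|τ| ^ ((l + 1) ^ d + 1)) ^ (l + 1) := by
            gcongr
            exact norm_kroneckerCurve_le hB hτ'
        _ = |τ| ^ (K + (l + 1)) := by rw [← pow_mul, hK]; ring_nf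
        _ ≤ _ := pow_le_pow_of_le_one (abs_nonneg _) hτ' (by omega)
    have h3 : (fun τ : ℝ => τ ^ (K + 1)) =o[𝓝 0] fun τ => τ ^ K := isLittleO_pow_pow K.lt_succ_self
    have h4 := (h1.trans h2).trans_isLittleO h3
    refine h4.congr_left fun τ => ?_
    simp only [Function.comp_apply, hReval]
    rfl
  have hzero : R - C (φ x) = 0 := by
    refine eq_zero_of_isLittleO_pow hdeg ?_
    refine ((hψ.sub hrem).mono nhdsWithin_le_nhds).congr_left fun τ => ?_
    simp
  refine hne (ContinuousMultilinearMap.toMultilinearMap_injective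
    (Module.Basis.ext_multilinear (fun _ => Pi.basisFun ℝ (Fin d)) fun r₀ => ?_))
  have hE : ∑ j, kroneckerExponent (l + 1) (r₀ j) ≠ 0 := by
    have : 0 < ∑ j, kroneckerExponent (l + 1) (r₀ j) :=
      Finset.sum_pos (fun j _ => Nat.zero_lt_of_lt (kroneckerExponent_pos hB _))
        ⟨⟨0, hm⟩, Finset.mem_univ _⟩
    exact this.ne'
  have hcoeff := congrArg (fun p => coeff p (∑ j, kroneckerExponent (l + 1) (r₀ j))) hzero
  set t := (m.factorial : ℝ)⁻¹ * T m fun j => Pi.single (r₀ j) 1 with ht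
  have hsum : ∑ k ∈ Finset.range (l + 1), ∑ r : Fin k → Fin d,
      (if ∑ j, kroneckerExponent (l + 1) (r j) = ∑ j, kroneckerExponent (l + 1) (r₀ j)
        then t * t else 0) = 0 := by
    simp only [coeff_sub, coeff_C, hE, if_false, sub_zero, coeff_zero, hR, finsetSum_coeff,
      coeff_monomial] at hcoeff
    refine Eq.trans ?_ ((congrArg (t * ·) hcoeff).trans (mul_zero t))
    simp only [Finset.mul_sum]
    refine Finset.sum_congr rfl fun k hk => ?_
    refine Finset.sum_congr rfl fun r _ => ?_
    split_ifs with h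
    · congr 1
      obtain ⟨σ, rfl⟩ := exists_perm_of_sum_kroneckerExponent_eq (Finset.mem_range.1 hk)
        (Nat.lt_succ_of_le hml) h
      obtain rfl : k = m := by simpa using Fintype.card_congr σ
      rw [ht]
      congr 1
      exact (iteratedFDeriv_comp_perm_of_contDiffOn hU hφ hx σ _).symm
    · simp
  have h1 := (Finset.sum_eq_zero_iff_of_nonneg fun k _ => Finset.sum_nonneg fun r _ => by
    split_ifs <;> [exact mul_self_nonneg t; exact le_rfl]).1 hsum m
      (Finset.mem_range.2 (Nat.lt_succ_of_le hml))
  have h2 := (Finset.sum_eq_zero_iff_of_nonneg fun r _ => by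
    split_ifs <;> [exact mul_self_nonneg t; exact le_rfl]).1 h1 r₀
    (Finset.mem_univ _)
  rw [if_pos rfl, mul_self_eq_zero, ht, mul_eq_zero] at h2
  simpa [T, Nat.factorial_ne_zero] using h2

end

section

open Filter Topology Set

/-- A measurable set which misses almost all points of a curve `t ↦ x + η t` close to `x`, for
almost all of its points `x` and a curve `η` from a fixed countable family, is a null set. -/
theorem volume_eq_zero_of_translated_curves {d : ℕ} {B : Set (Fin d → ℝ)} (hB : MeasurableSet B)
    {η : ℕ → ℝ → Fin d → ℝ} (hη : ∀ l, Continuous (η l)) (hη0 : ∀ l, η l 0 = 0)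
    (h : ∀ᵐ x, x ∈ B → ∃ l, ∃ r > 0, volume {t ∈ Icc 0 r | x + η l t ∈ B} = 0) :
    volume B = 0 := by
  by_contra hne
  set Z := toMeasurable volume {x | ¬(x ∈ B → ∃ l, ∃ r > 0,
    volume {t ∈ Icc 0 r | x + η l t ∈ B} = 0)}
  have hZ : volume Z = 0 := (measure_toMeasurable _).trans (ae_iff.1 h)
  obtain ⟨K, hKB, hK, hK0⟩ := (hB.diff (measurableSet_toMeasurable _ _)).exists_lt_isCompact
    (μ := volume) (r := 0) (by
      rw [measure_sdiff_null hZ]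
      exact pos_iff_ne_zero.2 hne)
  let Q : ℕ → ℕ → Set (Fin d → ℝ) := fun l k =>
    {x ∈ K | volume {t ∈ Icc (0 : ℝ) (1 / (k + 1)) | x + η l t ∈ K} = 0}
  have hKQ : K ⊆ ⋃ l, ⋃ k, Q l k := by
    intro x hx
    have hxZ : x ∈ B → ∃ l, ∃ r > 0, volume {t ∈ Icc 0 r | x + η l t ∈ B} = 0 :=
      not_not.1 fun hc => (hKB hx).2 (subset_toMeasurable _ _ hc)
    obtain ⟨l, r, hr, hnull⟩ := hxZ (hKB hx).1
    obtain ⟨k, hk⟩ := exists_nat_one_div_lt hr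
    refine mem_iUnion.2 ⟨l, mem_iUnion.2 ⟨k, hx, measure_mono_null ?_ hnull⟩⟩
    exact fun t ht => ⟨⟨ht.1.1, ht.1.2.trans hk.le⟩, (hKB ht.2).1⟩
  obtain ⟨l, k, hQ0⟩ : ∃ l k, volume (Q l k) ≠ 0 := by
    by_contra! hc
    exact hK0.ne' (measure_mono_null hKQ
      (measure_iUnion_null fun l => measure_iUnion_null fun k => hc l k))
  have hclosed : ∀ C : Set (Fin d → ℝ), IsClosed C →
      IsClosed {p : (Fin d → ℝ) × ℝ | p.2 ∈ Icc (0 : ℝ) (1 / (k + 1)) ∧ p.1 + η l p.2 ∈ C} :=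
    fun C hC => (isClosed_Icc.preimage continuous_snd).inter
      (hC.preimage (continuous_fst.add ((hη l).comp continuous_snd)))
  have hQm : MeasurableSet (Q l k) :=
    hK.measurableSet.inter (measurable_measure_prodMk_left
      (hclosed K hK.isClosed).measurableSet (measurableSet_singleton 0))
  obtain ⟨K', hK'Q, hK', hK'0⟩ := hQm.exists_lt_isCompact (pos_iff_ne_zero.2 hQ0)
  obtain ⟨W, hK'W, hW, hW2⟩ := K'.exists_isOpen_lt_of_lt (2 * volume K') (by
    rw [two_mul]
    exact ENNReal.lt_add_right hK'.measure_lt_top.ne hK'0.ne')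
  obtain ⟨δ, hδ, hδW⟩ := hK'.exists_thickening_subset_open hW hK'W
  set S : Set ((Fin d → ℝ) × ℝ) := {p | p.1 ∈ K' ∧ p.2 ∈ Icc (0 : ℝ) (1 / (k + 1)) ∧
    p.1 + η l p.2 ∈ K'}
  have hS : MeasurableSet S :=
    ((hK'.isClosed.preimage continuous_fst).inter (hclosed K' hK'.isClosed)).measurableSet
  have hS0 : (volume.prod volume) S = 0 := by
    refine (Measure.measure_prod_null hS).2 (Eventually.of_forall fun x => ?_)
    by_cases hx : x ∈ K'
    · refine measure_mono_null ?_ (hK'Q hx).2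
      exact fun t ht => ⟨ht.2.1, (hK'Q ht.2.2).1⟩
    · refine measure_mono_null (fun t ht => ?_) measure_empty
      exact hx ht.1
  rw [Measure.prod_apply_symm hS, lintegral_eq_zero_iff (measurable_measure_prodMk_right hS)] at hS0
  have hO : IsOpen (Ioo (0 : ℝ) (1 / (k + 1)) ∩ η l ⁻¹' Metric.ball 0 δ) :=
    isOpen_Ioo.inter (Metric.isOpen_ball.preimage (hη l))
  have hOne : (Ioo (0 : ℝ) (1 / (k + 1)) ∩ η l ⁻¹' Metric.ball 0 δ).Nonempty := by
    refine nonempty_of_mem (f := 𝓝[>] 0) (inter_mem (Ioo_mem_nhdsGT (by positivity))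
      (mem_nhdsWithin_of_mem_nhds ((hη l).continuousAt.preimage_mem_nhds ?_)))
    rw [hη0]
    exact Metric.ball_mem_nhds _ hδ
  obtain ⟨t, ht, htO⟩ := (Measure.dense_of_ae hS0).inter_open_nonempty _ hO hOne
  have htS : volume {x | (x, t) ∈ S} = 0 := htO
  set v := η l t
  have hnull : volume (K' ∩ (fun x => x + v) ⁻¹' K') = 0 := by
    refine measure_mono_null ?_ htS
    exact fun x hx => ⟨hx.1, ⟨ht.1.1.le, ht.1.2.le⟩, hx.2⟩
  have hsub : K' ∪ (fun x => x + v) ⁻¹' K' ⊆ W := by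
    refine union_subset hK'W fun x hx => hδW (Metric.mem_thickening_iff.2 ⟨x + v, hx, ?_⟩)
    simpa [dist_eq_norm] using ht.2
  have hadd := measure_union_add_inter (μ := volume) K'
    (hK'.measurableSet.preimage (measurable_add_const v))
  rw [hnull, add_zero, measure_preimage_add_right, ← two_mul] at hadd
  exact (hadd ▸ measure_mono hsub).not_gt hW2

end

section

open Filter Topology Set Matrix

theorem InW.mono {n : ℕ} {y : Fin n → ℝ} {v w : ℝ} (hw : 0 < w) (hwv : w ≤ v) (h : InW y v) :
    InW y w := by
  refine Set.Infinite.mono ?_ h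
  rintro q ⟨p, hp⟩
  refine ⟨p, hp.trans ?_⟩
  by_cases hq : q = 0
  · have h0 : (fun i => (q i : ℝ) : Fin n → ℝ) = 0 := by
      ext i
      simp [hq]
    rw [h0, norm_zero, Real.zero_rpow (by linarith), Real.zero_rpow (by linarith)]
  · refine Real.rpow_le_rpow_of_exponent_le ?_ (neg_le_neg hwv)
    obtain ⟨i, hi⟩ := Function.ne_iff.1 hq
    refine le_trans ?_ (norm_le_pi_norm _ i)
    rw [Real.norm_eq_abs]
    exact_mod_cast Int.one_le_abs hi

theorem measurableSet_setOf_isVWA (n : ℕ) : MeasurableSet {y : Fin n → ℝ | IsVWA y} := by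
  have h1 : {y : Fin n → ℝ | IsVWA y} = ⋃ M : ℕ, {y | InW y (n + 1 / ((M : ℝ) + 1))} := by
    ext y
    simp only [mem_iUnion, Set.mem_ofPred_eq]
    constructor
    · rintro ⟨v, hv, hy⟩
      obtain ⟨M, hM⟩ := exists_nat_one_div_lt (sub_pos.2 hv)
      exact ⟨M, hy.mono (by positivity) (by linarith)⟩
    · rintro ⟨M, hM⟩
      exact ⟨_, lt_add_of_pos_right _ (by positivity), hM⟩
  have h2 : ∀ v : ℝ, {y : Fin n → ℝ | InW y v} = ⋂ F : Finset (Fin n → ℤ),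
      ⋃ q : {q : Fin n → ℤ // q ∉ F}, ⋃ p : ℤ, {y | |(∑ i, y i * (q.1 i : ℝ)) + (p : ℝ)| ≤
        ‖(fun i => (q.1 i : ℝ) : Fin n → ℝ)‖ ^ (-v)} := by
    intro v
    ext y
    simp only [mem_iInter, mem_iUnion, Set.mem_ofPred_eq]
    constructor
    · intro hy F
      obtain ⟨q, hq, hqF⟩ := hy.exists_notMem_finset F
      exact ⟨⟨q, hqF⟩, hq⟩
    · intro hy hfin
      obtain ⟨q, hq⟩ := hy hfin.toFinset
      exact q.2 (hfin.mem_toFinset.2 hq)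
  rw [h1]
  refine MeasurableSet.iUnion fun M => ?_
  rw [h2]
  refine MeasurableSet.iInter fun F => MeasurableSet.iUnion fun q =>
    MeasurableSet.iUnion fun p => ?_
  refine (isClosed_le ?_ continuous_const).measurableSet
  fun_prop

theorem measurableSet_inter_preimage_of_continuousOn {X Y : Type*} [TopologicalSpace X]
    [MeasurableSpace X] [BorelSpace X] [TopologicalSpace Y] [MeasurableSpace Y] [BorelSpace Y]
    {f : X → Y} {U : Set X} {W : Set Y} (hf : ContinuousOn f U) (hU : MeasurableSet U)
    (hW : MeasurableSet W) : MeasurableSet (U ∩ f ⁻¹' W) := by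
  rw [← Subtype.image_preimage_coe]
  exact hU.subtype_image ((continuousOn_iff_continuous_domRestrict.1 hf).measurable hW)

theorem eq_add_vecMul_of_cons_eq {s n : ℕ} {P : Matrix (Fin (s + 1)) (Fin (n + 1)) ℝ}
    {x : Fin s → ℝ} {y : Fin n → ℝ}
    (h : (Fin.cons 1 y : Fin (n + 1) → ℝ) = vecMul (Fin.cons 1 x) P) :
    y = (fun j => P 0 j.succ) + x ᵥ* P.submatrix Fin.succ Fin.succ := by
  ext j
  have := congrFun h j.succ
  simpa [vecMul, dotProduct, Fin.sum_univ_succ] using this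

/-- Under `Cond36`, every smooth map into the subspace which is nondegenerate in it is
extremal. -/
theorem isExtremal_of_cond36 {s n : ℕ} (hn : 0 < n) {L : AffineSubspace ℝ (Fin n → ℝ)}
    {P : Matrix (Fin (s + 1)) (Fin (n + 1)) ℝ} {h : (Fin s → ℝ) → Fin n → ℝ}
    (hP : ∀ x, Fin.cons 1 (h x) = vecMul (Fin.cons 1 x) P) (hinj : Function.Injective h)
    (hL : (L : Set (Fin n → ℝ)) = range h) (hcond : Cond36 P) {d : ℕ} {U : Set (Fin d → ℝ)}
    (hU : IsOpen U) {f : (Fin d → ℝ) → Fin n → ℝ} (hf : ContDiffOn ℝ (⊤ : ℕ∞) f U)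
    (hfL : ∀ x ∈ U, f x ∈ L) (hnd : ∀ᵐ x ∂(volume.restrict U), NondegAt U L f x) :
    IsExtremal U f := by
  set b : Fin n → ℝ := fun j => P 0 j.succ
  set A := (P.submatrix Fin.succ Fin.succ : Matrix (Fin s) (Fin n) ℝ).vecMulLinear
  have hh : ∀ z, h z = b + A z := fun z => eq_add_vecMul_of_cons_eq (hP z)
  have hA : LinearMap.ker A = ⊥ := LinearMap.ker_eq_bot.2 fun z w hzw =>
    hinj (by rw [hh, hh, hzw])
  obtain ⟨G, hG⟩ := A.exists_leftInverse_of_injective hA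
  have hGA : ∀ z, G (A z) = z := fun z => LinearMap.congr_fun hG z
  have hdir : ∀ z, A z ∈ L.direction := fun z => by
    have h1 : h z ∈ L := by
      rw [← SetLike.mem_coe, hL]
      exact mem_range_self z
    have h2 : h 0 ∈ L := by
      rw [← SetLike.mem_coe, hL]
      exact mem_range_self 0
    have h3 := L.vsub_mem_direction h1 h2
    rwa [hh, hh, map_zero, add_zero, vsub_eq_sub, add_sub_cancel_left] at h3
  set Gc := LinearMap.toContinuousLinearMap G
  have hfG : ∀ x ∈ U, h (Gc (f x) - Gc b) = f x := fun x hx => by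
    obtain ⟨z, hz⟩ : f x ∈ range h := hL ▸ hfL x hx
    have : Gc (f x) - Gc b = z := by
      rw [← map_sub, ← hz, hh, add_sub_cancel_left]
      exact hGA z
    rw [this, hz]
  have hB : MeasurableSet (U ∩ f ⁻¹' {y | IsVWA y}) :=
    measurableSet_inter_preimage_of_continuousOn hf.continuousOn hU.measurableSet
      (measurableSet_setOf_isVWA n)
  refine volume_eq_zero_of_translated_curves hB (η := fun l => kroneckerCurve d (l + 1))
    (fun l => (contDiff_kroneckerCurve d (l + 1) (k := 0)).continuous)
    (fun l => kroneckerCurve_zero l.succ_pos) ?_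
  filter_upwards [(ae_restrict_iff' hU.measurableSet).1 hnd] with x hx hxB
  obtain ⟨l, hl⟩ := hx hxB.1
  refine ⟨l, ?_⟩
  set γ := fun τ => x + kroneckerCurve d (l + 1) τ
  have hγ : ContDiff ℝ (⊤ : ℕ∞) γ := contDiff_const.add (contDiff_kroneckerCurve d (l + 1))
  have hfγ : ContDiffOn ℝ (⊤ : ℕ∞) (fun τ => f (γ τ)) (γ ⁻¹' U) :=
    hf.comp hγ.contDiffOn fun τ hτ => hτ
  obtain ⟨r, hr, hrV, hnull⟩ := volume_isVWA_curve_eq_zero hn hcond (V := γ ⁻¹' U)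
    (hU.preimage hγ.continuous) (by simpa [γ, kroneckerCurve_zero] using hxB.1)
    (x := fun τ => Gc (f (γ τ)) - Gc b) ((Gc.contDiff.comp_contDiffOn hfγ).sub contDiffOn_const)
    (y := fun τ => f (γ τ)) hfγ.continuousOn
    (fun τ hτ => by rw [← hP, hfG _ hτ]) (fun c hc => by
      set ℓ : (Fin n → ℝ) →L[ℝ] ℝ :=
        LinearMap.toContinuousLinearMap ((dotProductBilin ℝ ℝ c).comp G) with hℓ
      have hℓv : ∀ v, ℓ v = c ⬝ᵥ G v := fun v => rfl
      have hne : ∃ m, 1 ≤ m ∧ m ≤ l ∧ iteratedFDeriv ℝ m (ℓ ∘ f) x ≠ 0 := by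
        by_contra! hzero
        have hspan : L.direction ≤ LinearMap.ker ℓ.toLinearMap := by
          rw [← hl, Submodule.span_le]
          rintro _ ⟨m, hm, hml, u, rfl⟩
          have h1 := hzero m hm hml
          rw [ℓ.iteratedFDeriv_comp_left (hf.contDiffAt (hU.mem_nhds hxB.1))
            (by exact_mod_cast le_top)] at h1
          have h2 := congrArg (fun T => T u) h1
          rw [iteratedFDerivWithin_of_isOpen m hU hxB.1]
          exact h2
        refine hc (dotProduct_eq_zero _ fun z => ?_)
        have h3 : ℓ (A z) = 0 := hspan (hdir z)
        rwa [hℓv, hGA] at h3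
      obtain ⟨m, hm, hml, hmne⟩ := hne
      obtain ⟨k, hk, hkne⟩ := exists_iteratedDeriv_comp_kroneckerCurve_ne_zero hU
        (ℓ.contDiff.comp_contDiffOn hf) hxB.1 hm hml hmne
      refine ⟨k, hk, ?_⟩
      have he : (fun τ => c ⬝ᵥ (Gc (f (γ τ)) - Gc b)) =
          fun τ => -ℓ b + (ℓ ∘ f) (x + kroneckerCurve d (l + 1) τ) := by
        ext τ
        rw [dotProduct_sub, neg_add_eq_sub]
        rfl
      rwa [he, iteratedDeriv_const_add hk])
  refine ⟨r, hr, measure_mono_null ?_ hnull⟩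
  exact fun τ hτ => ⟨⟨by linarith [hτ.1.1], hτ.1.2⟩, hτ.2.2⟩

end

section

open Set Matrix

theorem contDiff_affineMap {s n : ℕ} (h : (Fin s → ℝ) →ᵃ[ℝ] (Fin n → ℝ)) {k : WithTop ℕ∞} :
    ContDiff ℝ k h := by
  rw [h.decomp]
  exact (LinearMap.toContinuousLinearMap h.linear).contDiff.add contDiff_const

theorem fderiv_affineMap {s n : ℕ} (h : (Fin s → ℝ) →ᵃ[ℝ] (Fin n → ℝ)) (x : Fin s → ℝ) :
    fderiv ℝ h x = LinearMap.toContinuousLinearMap h.linear := by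
  rw [h.decomp]
  exact ((LinearMap.toContinuousLinearMap h.linear).hasFDerivAt.add_const (h 0)).fderiv

theorem nondegAt_affineMap {s n : ℕ} {L : AffineSubspace ℝ (Fin n → ℝ)}
    {h : (Fin s → ℝ) →ᵃ[ℝ] (Fin n → ℝ)} (hL : range h = (L : Set (Fin n → ℝ)))
    (x : Fin s → ℝ) : NondegAt univ L h x := by
  have hmap : L = (⊤ : AffineSubspace ℝ (Fin s → ℝ)).map h :=
    SetLike.coe_injective (by simp [hL])
  refine ⟨1, le_antisymm (Submodule.span_le.2 ?_) fun y hy => Submodule.subset_span ?_⟩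
  · rintro _ ⟨m, hm, hm', u, rfl⟩
    obtain rfl : m = 1 := le_antisymm hm' hm
    rw [iteratedFDerivWithin_univ, iteratedFDeriv_one_apply, fderiv_affineMap, hmap,
      AffineSubspace.map_direction]
    exact ⟨u 0, by simp, rfl⟩
  · rw [hmap, AffineSubspace.map_direction] at hy
    obtain ⟨z, -, rfl⟩ := hy
    refine ⟨1, le_rfl, le_rfl, fun _ => z, ?_⟩
    rw [iteratedFDerivWithin_univ, iteratedFDeriv_one_apply, fderiv_affineMap]
    rfl

theorem exists_affineMap_eq_of_cons_eq {s n : ℕ} {P : Matrix (Fin (s + 1)) (Fin (n + 1)) ℝ}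
    {h : (Fin s → ℝ) → Fin n → ℝ} (hP : ∀ x, Fin.cons 1 (h x) = vecMul (Fin.cons 1 x) P) :
    ∃ g : (Fin s → ℝ) →ᵃ[ℝ] (Fin n → ℝ), ⇑g = h := by
  refine ⟨(P.submatrix Fin.succ Fin.succ : Matrix (Fin s) (Fin n) ℝ).vecMulLinear.toAffineMap +
    AffineMap.const ℝ _ (fun j => P 0 j.succ), funext fun x => ?_⟩
  rw [eq_add_vecMul_of_cons_eq (hP x), add_comm]
  rfl

theorem exists_not_isVWA_of_affineExtremal {s n : ℕ} {L : AffineSubspace ℝ (Fin n → ℝ)}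
    {h : (Fin s → ℝ) →ᵃ[ℝ] (Fin n → ℝ)} (hinj : Function.Injective h)
    (hL : range h = (L : Set (Fin n → ℝ))) (hext : AffineExtremal L) : ∃ y ∈ L, ¬IsVWA y := by
  by_contra! hall
  have h1 : {x : Fin s → ℝ | x ∈ univ ∧ IsVWA (h x)} = univ := by
    refine eq_univ_of_forall fun x => ⟨mem_univ x, hall _ ?_⟩
    rw [← SetLike.mem_coe, ← hL]
    exact mem_range_self x
  have h2 := hext s h hinj hL
  rw [IsExtremal, h1] at h2
  exact (isOpen_univ.measure_pos volume univ_nonempty).ne' h2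

theorem not_isVWA_fin_zero (y : Fin 0 → ℝ) : ¬IsVWA y :=
  fun ⟨_, _, hv⟩ => hv (toFinite _)

theorem cond36_fin_zero {s : ℕ} (P : Matrix (Fin (s + 1)) (Fin (0 + 1)) ℝ) : Cond36 P :=
  fun _ _ => ⟨1, one_pos, fun _ _ _ hj hj' => absurd (hj.trans hj') (by norm_num)⟩

end

/-- **Theorem 4.2.** Let `L` be an `s`-dimensional affine subspace of `ℝ^n` parametrized by
the (injective) affine map `h : ℝ^s → ℝ^n` determined by `(1, h(x)) = x̃ P`,
`P ∈ M_{s+1,n+1}(ℝ)`. Then the following are equivalent to condition (3.6):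
(i) `L` contains at least one not very well approximable point; (ii) `L` is extremal;
(iii) any smooth map into `L` which is nondegenerate in `L` is extremal. -/
theorem extremality_criterion_affine_subspace (s n : ℕ)
    (L : AffineSubspace ℝ (Fin n → ℝ))
    (P : Matrix (Fin (s + 1)) (Fin (n + 1)) ℝ)
    (h : (Fin s → ℝ) → Fin n → ℝ)
    (hP : ∀ x, Fin.cons 1 (h x) = Matrix.vecMul (Fin.cons 1 x) P)
    (hinj : Function.Injective h)
    (hL : (L : Set (Fin n → ℝ)) = Set.range h) :
    (Cond36 P ↔ ∃ y ∈ L, ¬ IsVWA y) ∧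
    ((∃ y ∈ L, ¬ IsVWA y) ↔ AffineExtremal L) ∧
    (AffineExtremal L ↔
      ∀ (d : ℕ) (U : Set (Fin d → ℝ)), IsOpen U →
        ∀ f : (Fin d → ℝ) → Fin n → ℝ, ContDiffOn ℝ (⊤ : ℕ∞) f U →
          (∀ x ∈ U, f x ∈ L) →
          (∀ᵐ x ∂(volume.restrict U), NondegAt U L f x) →
          IsExtremal U f) := by
  obtain ⟨g, rfl⟩ := exists_affineMap_eq_of_cons_eq hP
  have hcond : (∃ y ∈ L, ¬IsVWA y) → Cond36 P := by
    rintro ⟨y, hyL, hy⟩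
    rcases Nat.eq_zero_or_pos n with rfl | hn
    · exact cond36_fin_zero P
    · obtain ⟨x, rfl⟩ : y ∈ Set.range g := hL ▸ hyL
      exact cond36_of_not_isVWA hn (hP x) hy
  have hmaps : Cond36 P → ∀ (d : ℕ) (U : Set (Fin d → ℝ)), IsOpen U →
      ∀ f : (Fin d → ℝ) → Fin n → ℝ, ContDiffOn ℝ (⊤ : ℕ∞) f U → (∀ x ∈ U, f x ∈ L) →
        (∀ᵐ x ∂(volume.restrict U), NondegAt U L f x) → IsExtremal U f := by
    intro hc d U hU f hf hfL hnd
    rcases Nat.eq_zero_or_pos n with rfl | hn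
    · simp [IsExtremal, not_isVWA_fin_zero]
    · exact isExtremal_of_cond36 hn hP hinj hL hc hU hf hfL hnd
  have hext : (∀ (d : ℕ) (U : Set (Fin d → ℝ)), IsOpen U →
      ∀ f : (Fin d → ℝ) → Fin n → ℝ, ContDiffOn ℝ (⊤ : ℕ∞) f U → (∀ x ∈ U, f x ∈ L) →
        (∀ᵐ x ∂(volume.restrict U), NondegAt U L f x) → IsExtremal U f) → AffineExtremal L := by
    intro hall s' h' _ hL'
    exact hall s' Set.univ isOpen_univ h' (contDiff_affineMap h').contDiffOn
      (fun x _ => by rw [← SetLike.mem_coe, ← hL']; exact Set.mem_range_self x)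
      (Filter.Eventually.of_forall fun x => nondegAt_affineMap hL' x)
  have hpoint : AffineExtremal L → ∃ y ∈ L, ¬IsVWA y :=
    exists_not_isVWA_of_affineExtremal hinj hL.symm
  exact ⟨⟨fun hc => hpoint (hext (hmaps hc)), hcond⟩,
    ⟨fun hy => hext (hmaps (hcond hy)), hpoint⟩,
    ⟨fun he => hmaps (hcond (hpoint he)), hext⟩⟩
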